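/- For every ε ∈ (0,1/10) there exist a₀ ∈ (0,1), h₀ ∈ (0,1) and a constant C, depending only on ε and the cutoffs, such that for all 0 < h ≤ h₀ and all a with h^{2/3−ε} ≤ a ≤ a₀, all X ≥ 0, Y ∈ ℝ and all T with 0 < |T| ≤ 5/2, writing t := √(a(1+a)) T: |W_{0,a}(T,X,Y)| + |G^♯(T,X,Y)| ≤ C (√a/h²) min(1, (h/(a|t|))^{1/2}). -/

import Mathlib

open Real Complex Filter MeasureTheory

/-- `A₊(z) = e^{-iπ/3} Ai(e^{-iπ/3} z)`. -/
noncomputable def Aplus (Ai : ℂ → ℂ) (z : ℂ) : ℂ :=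
  Complex.exp (-(Real.pi / 3 : ℂ) * Complex.I) * Ai (Complex.exp (-(Real.pi / 3 : ℂ) * Complex.I) * z)

/-- `A₋(z) = e^{iπ/3} Ai(e^{iπ/3} z)`. -/
noncomputable def Aminus (Ai : ℂ → ℂ) (z : ℂ) : ℂ :=
  Complex.exp ((Real.pi / 3 : ℂ) * Complex.I) * Ai (Complex.exp ((Real.pi / 3 : ℂ) * Complex.I) * z)

/-- `B(u) = (4/3)u + π/2 − L(u^{2/3})`. -/
noncomputable def Bfun (L : ℝ → ℝ) (u : ℝ) : ℝ :=
  (4/3) * u + Real.pi / 2 - L (u ^ ((2 : ℝ)/3))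

/-- The phase `Ψ_{N,a}(T,X,Y,Υ,S,A,η)` of the tangential reflected waves, with `λ = a^{3/2}/h`. -/
noncomputable def PsiTan (L : ℝ → ℝ) (h a : ℝ) (N : ℤ) (T X Y Υ S A η : ℝ) : ℝ :=
  η * (Y + Υ ^ 3 / 3 + Υ * (X - A) + S ^ 3 / 3 + S * (1 - A)
      + T * Real.sqrt (1 + a) * (A - 1) / (Real.sqrt (1 + a * A) + Real.sqrt (1 + a))
      - (4/3) * (N : ℝ) * A ^ ((3:ℝ)/2))
    + ((N : ℝ) / (a ^ ((3:ℝ)/2) / h)) * Bfun L (η * (a ^ ((3:ℝ)/2) / h) * A ^ ((3:ℝ)/2))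

/-- The `N`-th tangential reflected wave `W_{N,a}(T,X,Y)`; the integration variables are
`S = v.1`, `Υ = v.2.1`, `A = v.2.2.1`, `η = v.2.2.2`. -/
noncomputable def Wtan (L : ℝ → ℝ) (ψ : ℝ → ℝ) (χ₂ : ℝ × ℝ → ℝ) (ψ₃ : ℝ → ℝ)
    (h a : ℝ) (N : ℤ) (T X Y : ℝ) : ℂ :=
  ((a ^ 2 / (2 * Real.pi * h) ^ 3 : ℝ) : ℂ) * ∫ v : ℝ × ℝ × ℝ × ℝ,
    Complex.exp (Complex.I *
      (((a ^ ((3:ℝ)/2) / h) * PsiTan L h a N T X Y v.2.1 v.1 v.2.2.1 v.2.2.2 : ℝ) : ℂ)) *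
    ((v.2.2.2 ^ 2 * ψ v.2.2.2 * χ₂ (v.1, v.2.1) * ψ₃ v.2.2.1 : ℝ) : ℂ)

/-- `G^♯(T,X,Y) = Σ_{|N| ≤ 2a^{−1/2}} W_{N,a}(T,X,Y)`. -/
noncomputable def Gsharp (L : ℝ → ℝ) (ψ : ℝ → ℝ) (χ₂ : ℝ × ℝ → ℝ) (ψ₃ : ℝ → ℝ)
    (h a : ℝ) (T X Y : ℝ) : ℂ :=
  ∑' N : ℤ, Set.indicator {N : ℤ | |(N : ℝ)| ≤ 2 / Real.sqrt a}
    (fun N => Wtan L ψ χ₂ ψ₃ h a N T X Y) N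

section LineBounded

variable {E E' : Type*} [NormedAddCommGroup E] [NormedSpace ℝ E]
  [NormedAddCommGroup E'] [NormedSpace ℝ E']

/-- `f` is `k` times differentiable along `ν` at the points of `U`, and all these derivatives are
continuous on `U` and bounded there by `C`. -/
def LineBounded (U : Set E) (ν : E) : ℕ → ℝ → (E → ℂ) → Prop
  | 0, C, f => ContinuousOn f U ∧ ∀ x ∈ U, ‖f x‖ ≤ C
  | k + 1, C, f => ContinuousOn f U ∧ (∀ x ∈ U, ‖f x‖ ≤ C) ∧
      ∃ f' : E → ℂ, (∀ x ∈ U, HasLineDerivAt ℝ f (f' x) x ν) ∧ LineBounded U ν k C f'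

namespace LineBounded

variable {U V : Set E} {ν : E} {k : ℕ} {C D : ℝ} {f g : E → ℂ}

theorem continuousOn (h : LineBounded U ν k C f) : ContinuousOn f U := by
  cases k <;> exact h.1

theorem bound (h : LineBounded U ν k C f) : ∀ x ∈ U, ‖f x‖ ≤ C := by
  cases k
  · exact h.2
  · exact h.2.1

theorem mono (h : LineBounded U ν k C f) (hCD : C ≤ D) : LineBounded U ν k D f := by
  induction k generalizing f with
  | zero => exact ⟨h.1, fun x hx => (h.2 x hx).trans hCD⟩
  | succ k ih =>
    obtain ⟨h1, h2, f', h3, h4⟩ := h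
    exact ⟨h1, fun x hx => (h2 x hx).trans hCD, f', h3, ih h4⟩

theorem mono_set (h : LineBounded U ν k C f) (hVU : V ⊆ U) : LineBounded V ν k C f := by
  induction k generalizing f with
  | zero => exact ⟨h.1.mono hVU, fun x hx => h.2 x (hVU hx)⟩
  | succ k ih =>
    obtain ⟨h1, h2, f', h3, h4⟩ := h
    exact ⟨h1.mono hVU, fun x hx => h2 x (hVU hx), f', fun x hx => h3 x (hVU hx), ih h4⟩

theorem pred (h : LineBounded U ν (k + 1) C f) : LineBounded U ν k C f := by
  induction k generalizing f with
  | zero => exact ⟨h.1, h.2.1⟩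
  | succ k ih =>
    obtain ⟨h1, h2, f', h3, h4⟩ := h
    exact ⟨h1, h2, f', h3, ih h4⟩

theorem of_le {l : ℕ} (h : LineBounded U ν k C f) (hl : l ≤ k) : LineBounded U ν l C f := by
  induction hl with
  | refl => exact h
  | step _ ih => exact ih h.pred

theorem congr (hU : IsOpen U) (h : LineBounded U ν k C f) (hfg : Set.EqOn f g U) :
    LineBounded U ν k C g := by
  cases k with
  | zero => exact ⟨h.1.congr hfg.symm, fun x hx => hfg hx ▸ h.2 x hx⟩
  | succ k =>
    obtain ⟨h1, h2, f', h3, h4⟩ := h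
    exact ⟨h1.congr hfg.symm, fun x hx => hfg hx ▸ h2 x hx, f', fun x hx =>
      (h3 x hx).congr_of_eventuallyEq (hfg.symm.eventuallyEq_of_mem (hU.mem_nhds hx)), h4⟩

theorem const (c : ℂ) (hc : ‖c‖ ≤ C) : LineBounded U ν k C fun _ => c := by
  induction k generalizing c with
  | zero => exact ⟨continuousOn_const, fun _ _ => hc⟩
  | succ k ih =>
    refine ⟨continuousOn_const, fun _ _ => hc, fun _ => 0, fun x _ => ?_, ih 0 ?_⟩
    · exact hasDerivAt_const _ _
    · simpa using (norm_nonneg c).trans hc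

theorem add (hf : LineBounded U ν k C f) (hg : LineBounded U ν k D g) :
    LineBounded U ν k (C + D) fun x => f x + g x := by
  induction k generalizing f g with
  | zero => exact ⟨hf.1.add hg.1, fun x hx => norm_add_le_of_le (hf.2 x hx) (hg.2 x hx)⟩
  | succ k ih =>
    obtain ⟨h1, h2, f', h3, h4⟩ := hf
    obtain ⟨i1, i2, g', i3, i4⟩ := hg
    exact ⟨h1.add i1, fun x hx => norm_add_le_of_le (h2 x hx) (i2 x hx), fun x => f' x + g' x,
      fun x hx => HasDerivAt.add (h3 x hx) (i3 x hx), ih h4 i4⟩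

theorem mul (hC : 0 ≤ C) (hD : 0 ≤ D) (hf : LineBounded U ν k C f) (hg : LineBounded U ν k D g) :
    LineBounded U ν k (2 ^ k * (C * D)) fun x => f x * g x := by
  induction k generalizing f g with
  | zero =>
    exact ⟨hf.1.mul hg.1, fun x hx => by
      simpa using mul_le_mul (hf.2 x hx) (hg.2 x hx) (norm_nonneg _) hC⟩
  | succ k ih =>
    have hf0 := hf.pred
    have hg0 := hg.pred
    obtain ⟨h1, h2, f', h3, h4⟩ := hf
    obtain ⟨i1, i2, g', i3, i4⟩ := hg
    have hCD := mul_nonneg hC hD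
    refine ⟨h1.mul i1, fun x hx => ?_, fun x => f' x * g x + f x * g' x, fun x hx => ?_, ?_⟩
    · rw [norm_mul]
      refine (mul_le_mul (h2 x hx) (i2 x hx) (norm_nonneg _) hC).trans ?_
      exact le_mul_of_one_le_left hCD (one_le_pow₀ one_le_two)
    · have := HasDerivAt.mul (h3 x hx) (i3 x hx)
      simp only [zero_smul, add_zero] at this
      exact this
    · exact ((ih h4 hg0).add (ih hf0 i4)).mono (by rw [pow_succ]; linarith)

theorem const_mul (c : ℂ) (hf : LineBounded U ν k C f) :
    LineBounded U ν k (‖c‖ * C) fun x => c * f x := by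
  induction k generalizing f with
  | zero =>
    exact ⟨continuousOn_const.mul hf.1, fun x hx => by
      rw [norm_mul]; exact mul_le_mul_of_nonneg_left (hf.2 x hx) (norm_nonneg _)⟩
  | succ k ih =>
    obtain ⟨h1, h2, f', h3, h4⟩ := hf
    refine ⟨continuousOn_const.mul h1, fun x hx => ?_, fun x => c * f' x, fun x hx => ?_, ih h4⟩
    · rw [norm_mul]; exact mul_le_mul_of_nonneg_left (h2 x hx) (norm_nonneg _)
    · exact HasDerivAt.const_mul c (h3 x hx)

theorem star (hf : LineBounded U ν k C f) :
    LineBounded U ν k C fun x => (starRingEnd ℂ) (f x) := by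
  induction k generalizing f with
  | zero => exact ⟨Complex.continuous_conj.comp_continuousOn hf.1, fun x hx => by simpa using hf.2 x hx⟩
  | succ k ih =>
    obtain ⟨h1, h2, f', h3, h4⟩ := hf
    refine ⟨Complex.continuous_conj.comp_continuousOn h1, fun x hx => by simpa using h2 x hx,
      fun x => (starRingEnd ℂ) (f' x), fun x hx => ?_, ih h4⟩
    exact HasDerivAt.star (h3 x hx)

theorem comp_affine {W : Set E'} {μ : E'} (hf : LineBounded U ν k C f) (l : E' →L[ℝ] E) (b : E)
    (hl : l μ = ν) (hW : Set.MapsTo (fun x => l x + b) W U) :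
    LineBounded W μ k C fun x => f (l x + b) := by
  have hc : Continuous fun x : E' => l x + b := by fun_prop
  induction k generalizing f with
  | zero => exact ⟨hf.1.comp hc.continuousOn hW, fun x hx => hf.2 _ (hW hx)⟩
  | succ k ih =>
    obtain ⟨h1, h2, f', h3, h4⟩ := hf
    refine ⟨h1.comp hc.continuousOn hW, fun x hx => h2 _ (hW hx), fun x => f' (l x + b),
      fun x hx => ?_, ih h4⟩
    have := h3 _ (hW hx)
    unfold HasLineDerivAt at this ⊢
    convert this using 3
    simp [hl]; abel

theorem comp_linear {W : Set E'} {μ : E'} (hf : LineBounded U ν k C f) (l : E' →L[ℝ] E)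
    (hl : l μ = ν) (hW : Set.MapsTo l W U) :
    LineBounded W μ k C fun x => f (l x) := by
  simpa using hf.comp_affine (W := W) l 0 hl (by simpa using hW)

theorem comp_add {W : Set E} (hf : LineBounded U ν k C f) (b : E)
    (hW : Set.MapsTo (fun x => x + b) W U) : LineBounded W ν k C fun x => f (x + b) :=
  hf.comp_affine (ContinuousLinearMap.id ℝ E) b rfl hW

theorem smul_dir (hf : LineBounded U ν k C f) (c : ℝ) (hC : 0 ≤ C) (hD : |c| ≤ D) (hD1 : 1 ≤ D) :
    LineBounded U (c • ν) k (D ^ k * C) f := by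
  induction k generalizing f C with
  | zero => simpa using (show LineBounded U (c • ν) 0 C f from hf)
  | succ k ih =>
    obtain ⟨h1, h2, f', h3, h4⟩ := hf
    refine ⟨h1, fun x hx => (h2 x hx).trans (le_mul_of_one_le_left hC (one_le_pow₀ hD1)),
      fun x => c * f' x, fun x hx => ?_, ?_⟩
    · simpa using (h3 x hx).smul c
    · have := ih (h4.const_mul (c : ℂ)) (mul_nonneg (norm_nonneg _) hC)
      refine this.mono ?_
      rw [pow_succ, mul_assoc]
      have : ‖(c : ℂ)‖ ≤ D := by simpa using hD
      gcongr

/-- Reciprocals of functions bounded below have bounded derivatives. -/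
theorem exists_inv (k : ℕ) (C : ℝ) {c : ℝ} (hc : 0 < c) : ∃ D, 0 ≤ D ∧
    ∀ {E : Type*} [NormedAddCommGroup E] [NormedSpace ℝ E] (U : Set E) (ν : E) (f : E → ℂ),
      LineBounded U ν k C f → (∀ x ∈ U, c ≤ ‖f x‖) → LineBounded U ν k D fun x => (f x)⁻¹ := by
  have key : ∀ {E : Type _} [NormedAddCommGroup E] [NormedSpace ℝ E] (U : Set E) (f : E → ℂ),
      (∀ x ∈ U, c ≤ ‖f x‖) → (∀ x ∈ U, ‖(f x)⁻¹‖ ≤ c⁻¹) ∧ ∀ x ∈ U, f x ≠ 0 := by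
    intro E _ _ U f h
    refine ⟨fun x hx => ?_, fun x hx => norm_pos_iff.mp (hc.trans_le (h x hx))⟩
    rw [norm_inv]
    exact inv_anti₀ hc (h x hx)
  have hc' : 0 ≤ c⁻¹ := by positivity
  induction k with
  | zero => 
    exact ⟨c⁻¹, hc', fun U ν f hf h => ⟨hf.1.inv₀ (key U f h).2, (key U f h).1⟩⟩
  | succ k ih =>
    obtain ⟨D, hD, ih⟩ := ih
    refine ⟨max c⁻¹ (2 ^ k * (|C| * (2 ^ k * (D * D)))), le_max_of_le_left hc',
      fun U ν f hf h => ?_⟩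
    have hi := ih U ν f hf.pred h
    obtain ⟨h1, h2, f', h3, h4⟩ := hf
    refine ⟨h1.inv₀ (key U f h).2, fun x hx => ((key U f h).1 x hx).trans (le_max_left _ _),
      fun x => (-1) * (f' x * ((f x)⁻¹ * (f x)⁻¹)), fun x hx => ?_, ?_⟩
    · have h0 := (key U f h).2 x hx
      have := HasDerivAt.inv (h3 x hx) (by simpa using h0)
      simp only [zero_smul, add_zero] at this
      have e : (-1) * (f' x * ((f x)⁻¹ * (f x)⁻¹)) = -f' x / f x ^ 2 := by field_simp
      exact (congrArg (fun c => HasDerivAt (fun t : ℝ => (f (x + t • ν))⁻¹) c 0) e).mpr this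
    · have := ((h4.mono (le_abs_self C)).mul (abs_nonneg C) (by positivity)
        (hi.mul hD hD hi)).const_mul (-1)
      exact this.mono (by simp)

end LineBounded

end LineBounded

section NonStationary

variable {E : Type*} [NormedAddCommGroup E]

theorem continuous_of_tsupport_subset {a : E → ℂ} {U : Set E} (hU : IsOpen U)
    (ha : ContinuousOn a U) (hs : tsupport a ⊆ U) : Continuous a := by
  refine continuous_iff_continuousAt.mpr fun x => ?_
  by_cases hx : x ∈ U
  · exact ha.continuousAt (hU.mem_nhds hx)
  · have : a =ᶠ[nhds x] fun _ => 0 := notMem_tsupport_iff_eventuallyEq.mp fun h => hx (hs h)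
    exact continuousAt_const.congr this.symm

theorem continuous_mul_of_tsupport_subset {F a : E → ℂ} {U : Set E} (hU : IsOpen U)
    (hF : ContinuousOn F U) (ha : ContinuousOn a U) (hs : tsupport a ⊆ U) :
    Continuous fun v => F v * a v :=
  continuous_of_tsupport_subset hU (hF.mul ha)
    ((tsupport_mul_subset_right (f := F) (g := a)).trans hs)

theorem norm_integral_le_of_tsupport_subset [MeasurableSpace E] [OpensMeasurableSpace E]
    (μ : Measure E)
    {G : E → ℂ} {B : Set E} (hB : μ B ≠ ⊤) {C : ℝ} (hC : ∀ x, ‖G x‖ ≤ C)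
    (hG : ∀ x, x ∉ B → G x = 0) : ‖∫ v, G v ∂μ‖ ≤ C * μ.real B := by
  rw [← setIntegral_eq_integral_of_forall_compl_eq_zero hG]
  exact norm_setIntegral_le_of_norm_le_const hB.lt_top fun x _ => hC x

variable [NormedSpace ℝ E]

/-- Non-stationary phase by repeated integration by parts along a fixed direction. -/
theorem exists_nonstationary_bound [FiniteDimensional ℝ E] [MeasurableSpace E] [BorelSpace E]
    (μ : Measure E) [μ.IsAddHaarMeasure] (k : ℕ) (C R : ℝ) {c : ℝ} (hc : 0 < c) (hR : 0 ≤ R) :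
    ∃ K, 0 ≤ K ∧ ∀ (U B : Set E) (ν : E) (F f a : E → ℂ) (κ : ℝ), 0 < κ → IsOpen U →
      ContinuousOn F U → (∀ v ∈ U, ‖F v‖ ≤ 1) →
      (∀ v ∈ U, HasLineDerivAt ℝ F (I * κ * f v * F v) v ν) →
      LineBounded U ν k C f → (∀ v ∈ U, c ≤ ‖f v‖) → LineBounded U ν k C a →
      IsCompact B → tsupport a ⊆ U → tsupport a ⊆ B → μ.real B ≤ R →
      ‖∫ v, F v * a v ∂μ‖ ≤ K * (κ⁻¹) ^ k := by
  induction k generalizing C with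
  | zero =>
    refine ⟨|C| * R, by positivity, ?_⟩
    intro U B ν F f a κ hκ hU hFc hF hF' hf hfc ha hB haU haB hBR
    rw [pow_zero, mul_one]
    refine (norm_integral_le_of_tsupport_subset μ (C := |C|) (B := B) hB.measure_ne_top
      (fun x => ?_) fun x hx => ?_).trans (by gcongr)
    · by_cases hx : x ∈ tsupport a
      · rw [norm_mul]
        calc ‖F x‖ * ‖a x‖ ≤ 1 * |C| :=
              mul_le_mul (hF x (haU hx)) ((ha.bound x (haU hx)).trans (le_abs_self C))
                (norm_nonneg _) zero_le_one
          _ = |C| := one_mul _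
      · simp [image_eq_zero_of_notMem_tsupport hx]
    · rw [image_eq_zero_of_notMem_tsupport fun h => hx (haB h), mul_zero]
  | succ k ih =>
    obtain ⟨D, hD, hinv⟩ := LineBounded.exists_inv (k + 1) C hc
    set C' := max C (2 ^ (k + 1) * (|C| * D)) with hC'
    obtain ⟨K, hK, ih⟩ := ih C'
    refine ⟨K, hK, ?_⟩
    intro U B ν F f a κ hκ hU hFc hF hF' hf hfc ha hB haU haB hBR
    have hfi := hinv U ν f hf hfc
    have hb := (ha.mono (le_abs_self C)).mul (abs_nonneg C) hD hfi
    obtain ⟨hb1, hb2, b', hb3, hb4⟩ := hb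
    have hf0 : ∀ v ∈ U, f v ≠ 0 := fun v hv => norm_pos_iff.mp (hc.trans_le (hfc v hv))
    set b : E → ℂ := fun v => a v * (f v)⁻¹ with hbdef
    set a₁ : E → ℂ := U.indicator b' with ha₁
    have hbs : tsupport b ⊆ tsupport a := tsupport_mul_subset_left (f := a) (g := fun v => (f v)⁻¹)
    have hbz : ∀ v, v ∉ tsupport a → b =ᶠ[nhds v] fun _ => 0 := fun v hv =>
      notMem_tsupport_iff_eventuallyEq.mp fun h => hv (hbs h)
    have hbd : ∀ v, HasLineDerivAt ℝ b (a₁ v) v ν := by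
      intro v
      by_cases hv : v ∈ U
      · rw [ha₁, Set.indicator_of_mem hv]
        exact hb3 v hv
      · rw [ha₁, Set.indicator_of_notMem hv]
        have h0 : HasLineDerivAt ℝ (fun _ : E => (0 : ℂ)) 0 v ν := hasDerivAt_const _ _
        exact h0.congr_of_eventuallyEq (hbz v fun h => hv (haU h))
    have hsupp : Function.support a₁ ⊆ tsupport a := by
      intro v hv
      by_contra hva
      have h0 : HasLineDerivAt ℝ (fun _ : E => (0 : ℂ)) 0 v ν := hasDerivAt_const _ _
      exact hv ((hbd v).unique (h0.congr_of_eventuallyEq (hbz v hva)))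
    have ha₁s : tsupport a₁ ⊆ tsupport a := closure_minimal hsupp (isClosed_tsupport a)
    have ha₁b : LineBounded U ν k (2 ^ (k + 1) * (|C| * D)) a₁ :=
      hb4.congr hU fun v hv => by rw [ha₁, Set.indicator_of_mem hv]
    have hcomp : IsCompact (tsupport a) := hB.of_isClosed_subset (isClosed_tsupport a) haB
    have hcb : HasCompactSupport b := hcomp.of_isClosed_subset (isClosed_tsupport b) hbs
    have hca : HasCompactSupport a := hcomp
    have hca₁ : HasCompactSupport a₁ := hcomp.of_isClosed_subset (isClosed_tsupport a₁) ha₁s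
    have hibp := integral_bilinear_hasLineDerivAt_right_eq_neg_left_of_integrable
      (μ := μ) (f := F) (f' := fun v => I * κ * f v * F v) (g := b) (g' := a₁) (v := ν)
      (B := ContinuousLinearMap.mul ℝ ℂ)
    simp only [ContinuousLinearMap.mul_apply'] at hibp
    have e1 : ∀ v, I * κ * f v * F v * b v = (I * κ) * (F v * a v) := by
      intro v
      by_cases hv : v ∈ U
      · rw [hbdef]; have := hf0 v hv; field_simp
      · have : a v = 0 := image_eq_zero_of_notMem_tsupport fun h => hv (haU h)
        simp [hbdef, this]
    have i1 : Integrable (fun v => F v * a v) μ :=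
      (continuous_mul_of_tsupport_subset hU hFc ha.continuousOn haU).integrable_of_hasCompactSupport
        hca.mul_left
    have i2 : Integrable (fun v => F v * a₁ v) μ :=
      (continuous_mul_of_tsupport_subset hU hFc ha₁b.continuousOn
        (ha₁s.trans haU)).integrable_of_hasCompactSupport hca₁.mul_left
    have i3 : Integrable (fun v => F v * b v) μ :=
      (continuous_mul_of_tsupport_subset hU hFc hb1
        (hbs.trans haU)).integrable_of_hasCompactSupport hcb.mul_left
    have hibp := hibp (by simp only [e1]; exact i1.const_mul _) i2 i3
      (fun v hv => hF' v (haU (hbs hv))) fun v _ => hbd v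
    simp only [e1, integral_const_mul] at hibp
    have hIκ : (I * κ : ℂ) ≠ 0 := mul_ne_zero I_ne_zero (by exact_mod_cast hκ.ne')
    have hmain : ‖∫ v, F v * a₁ v ∂μ‖ = κ * ‖∫ v, F v * a v ∂μ‖ := by
      rw [hibp, norm_neg, norm_mul, norm_mul, norm_I, one_mul, Complex.norm_real,
        Real.norm_of_nonneg hκ.le]
    have := ih U B ν F f a₁ κ hκ hU hFc hF hF' (hf.pred.mono (le_max_left _ _)) hfc
      (ha₁b.mono (le_max_right _ _)) hB (ha₁s.trans haU) (ha₁s.trans haB) hBR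
    rw [hmain] at this
    rw [pow_succ, ← mul_assoc, ← div_eq_mul_inv, le_div_iff₀ hκ]
    linarith

end NonStationary

section UnifLineBounded

variable {ι κ E : Type*} [NormedAddCommGroup E] [NormedSpace ℝ E]

/-- A family of functions which is `LineBounded` uniformly over the parameters in `P`. -/
def UnifLineBounded (P : Set ι) (U : ι → Set E) (ν : ι → E) (k : ℕ) (f : ι → E → ℂ) : Prop :=
  ∃ C, 0 ≤ C ∧ ∀ i ∈ P, LineBounded (U i) (ν i) k C (f i)

theorem hasLineDerivAt_ofReal_iff {g : E → ℝ} {d : ℂ} {x ν : E} :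
    HasLineDerivAt ℝ (fun x => (g x : ℂ)) d x ν ↔ d = (d.re : ℂ) ∧ HasLineDerivAt ℝ g d.re x ν := by
  constructor
  · intro h
    have h1 : HasLineDerivAt ℝ g d.re x ν := by
      exact HasFDerivAt.comp_hasDerivAt (f := fun t : ℝ => (g (x + t • ν) : ℂ)) (0 : ℝ)
        Complex.reCLM.hasFDerivAt h
    exact ⟨HasDerivAt.unique h (HasDerivAt.ofReal_comp h1), h1⟩
  · rintro ⟨h, h1⟩
    rw [h]
    exact HasDerivAt.ofReal_comp h1

theorem hasLineDerivAt_one_iff {F : Type*} [NormedAddCommGroup F] [NormedSpace ℝ F] {f : ℝ → F}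
    {d : F} {x : ℝ} : HasLineDerivAt ℝ f d x 1 ↔ HasDerivAt f d x := by
  unfold HasLineDerivAt
  simp only [smul_eq_mul, mul_one]
  constructor
  · intro h
    have h' : HasDerivAt (fun t => f (x + t)) d (x + -x) := by simpa using h
    simpa using h'.comp_add_const x (-x)
  · intro h
    have h' : HasDerivAt f d (x + 0) := by simpa using h
    exact h'.comp_const_add x 0

namespace UnifLineBounded

variable {P : Set ι} {U W : ι → Set E} {ν : ι → E} {k : ℕ} {f g : ι → E → ℂ}

theorem continuousOn (h : UnifLineBounded P U ν k f) {i : ι} (hi : i ∈ P) :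
    ContinuousOn (f i) (U i) := by
  obtain ⟨C, -, h⟩ := h
  exact (h i hi).continuousOn

theorem exists_bound (h : UnifLineBounded P U ν k f) :
    ∃ C, 0 ≤ C ∧ ∀ i ∈ P, ∀ x ∈ U i, ‖f i x‖ ≤ C := by
  obtain ⟨C, hC, h⟩ := h
  exact ⟨C, hC, fun i hi => (h i hi).bound⟩

theorem of_le {l : ℕ} (h : UnifLineBounded P U ν k f) (hl : l ≤ k) : UnifLineBounded P U ν l f := by
  obtain ⟨C, hC, h⟩ := h
  exact ⟨C, hC, fun i hi => (h i hi).of_le hl⟩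

theorem congr (hU : ∀ i ∈ P, IsOpen (U i)) (h : UnifLineBounded P U ν k f)
    (hfg : ∀ i ∈ P, Set.EqOn (f i) (g i) (U i)) : UnifLineBounded P U ν k g := by
  obtain ⟨C, hC, h⟩ := h
  exact ⟨C, hC, fun i hi => (h i hi).congr (hU i hi) (hfg i hi)⟩

theorem reparam {P' : Set κ} (h : UnifLineBounded P U ν k f) (r : κ → ι) (hr : Set.MapsTo r P' P) :
    UnifLineBounded P' (fun j => U (r j)) (fun j => ν (r j)) k (fun j => f (r j)) := by
  obtain ⟨C, hC, h⟩ := h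
  exact ⟨C, hC, fun j hj => h (r j) (hr hj)⟩

theorem of_lineBounded {V : Set E} {μ : E} {C : ℝ} {F : E → ℂ} (h : LineBounded V μ k C F) :
    UnifLineBounded P (fun _ => V) (fun _ => μ) k (fun _ => F) :=
  ⟨|C|, abs_nonneg C, fun _ _ => h.mono (le_abs_self C)⟩

theorem const {M : ℝ} (c : ι → ℂ) (hc : ∀ i ∈ P, ‖c i‖ ≤ M) :
    UnifLineBounded P U ν k fun i _ => c i :=
  ⟨|M|, abs_nonneg M, fun i hi => LineBounded.const _ ((hc i hi).trans (le_abs_self M))⟩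

theorem add (hf : UnifLineBounded P U ν k f) (hg : UnifLineBounded P U ν k g) :
    UnifLineBounded P U ν k fun i x => f i x + g i x := by
  obtain ⟨C, hC, hf⟩ := hf
  obtain ⟨D, hD, hg⟩ := hg
  exact ⟨C + D, add_nonneg hC hD, fun i hi => (hf i hi).add (hg i hi)⟩

theorem mul (hf : UnifLineBounded P U ν k f) (hg : UnifLineBounded P U ν k g) :
    UnifLineBounded P U ν k fun i x => f i x * g i x := by
  obtain ⟨C, hC, hf⟩ := hf
  obtain ⟨D, hD, hg⟩ := hg
  exact ⟨2 ^ k * (C * D), by positivity, fun i hi => (hf i hi).mul hC hD (hg i hi)⟩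

theorem const_mul {M : ℝ} (c : ι → ℂ) (hc : ∀ i ∈ P, ‖c i‖ ≤ M) (hf : UnifLineBounded P U ν k f) :
    UnifLineBounded P U ν k fun i x => c i * f i x :=
  (const c hc).mul hf

theorem neg (hf : UnifLineBounded P U ν k f) : UnifLineBounded P U ν k fun i x => -f i x := by
  simpa using hf.const_mul (M := 1) (fun _ => -1) (by simp)

theorem sub (hf : UnifLineBounded P U ν k f) (hg : UnifLineBounded P U ν k g) :
    UnifLineBounded P U ν k fun i x => f i x - g i x := by
  simpa [sub_eq_add_neg] using hf.add hg.neg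

theorem pow (hf : UnifLineBounded P U ν k f) (n : ℕ) :
    UnifLineBounded P U ν k fun i x => f i x ^ n := by
  induction n with
  | zero => simpa using const (M := 1) (fun _ => 1) (by simp)
  | succ n ih => simpa [pow_succ] using ih.mul hf

theorem inv {c : ℝ} (hc : 0 < c) (hf : UnifLineBounded P U ν k f)
    (h : ∀ i ∈ P, ∀ x ∈ U i, c ≤ ‖f i x‖) : UnifLineBounded P U ν k fun i x => (f i x)⁻¹ := by
  obtain ⟨C, hC, hf⟩ := hf
  obtain ⟨D, hD, hinv⟩ := LineBounded.exists_inv k C hc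
  exact ⟨D, hD, fun i hi => hinv _ _ _ (hf i hi) (h i hi)⟩

theorem of_zero {M : ℝ} (hf : ∀ i ∈ P, ContinuousOn (f i) (U i))
    (hM : ∀ i ∈ P, ∀ x ∈ U i, ‖f i x‖ ≤ M) : UnifLineBounded P U ν 0 f :=
  ⟨|M|, abs_nonneg M, fun i hi => ⟨hf i hi, fun x hx => (hM i hi x hx).trans (le_abs_self M)⟩⟩

theorem of_deriv {M : ℝ} (hf : ∀ i ∈ P, ContinuousOn (f i) (U i))
    (hM : ∀ i ∈ P, ∀ x ∈ U i, ‖f i x‖ ≤ M) {f' : ι → E → ℂ}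
    (hd : ∀ i ∈ P, ∀ x ∈ U i, HasLineDerivAt ℝ (f i) (f' i x) x (ν i))
    (hf' : UnifLineBounded P U ν k f') : UnifLineBounded P U ν (k + 1) f := by
  obtain ⟨C, hC, hf'⟩ := hf'
  exact ⟨max |M| C, hC.trans (le_max_right _ _), fun i hi => ⟨hf i hi, fun x hx =>
    (hM i hi x hx).trans ((le_abs_self M).trans (le_max_left _ _)), f' i, hd i hi,
    (hf' i hi).mono (le_max_right _ _)⟩⟩

theorem exists_deriv (hf : UnifLineBounded P U ν (k + 1) f) :
    ∃ f' : ι → E → ℂ, (∀ i ∈ P, ∀ x ∈ U i, HasLineDerivAt ℝ (f i) (f' i x) x (ν i)) ∧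
      UnifLineBounded P U ν k f' := by
  obtain ⟨C, hC, hf⟩ := hf
  have : ∀ i, ∃ f' : E → ℂ, i ∈ P → (∀ x ∈ U i, HasLineDerivAt ℝ (f i) (f' x) x (ν i)) ∧
      LineBounded (U i) (ν i) k C f' := by
    intro i
    by_cases hi : i ∈ P
    · obtain ⟨-, -, f', h1, h2⟩ := hf i hi
      exact ⟨f', fun _ => ⟨h1, h2⟩⟩
    · exact ⟨fun _ => 0, fun h => absurd h hi⟩
  choose f' hf' using this
  exact ⟨f', fun i hi => (hf' i hi).1, C, hC, fun i hi => (hf' i hi).2⟩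

theorem clm {M : ℝ} (l : ι → E →L[ℝ] ℝ) (h : ∀ i ∈ P, ∀ x ∈ U i, |l i x| ≤ M)
    (hν : ∀ i ∈ P, |l i (ν i)| ≤ M) : UnifLineBounded P U ν k fun i x => (l i x : ℂ) := by
  cases k with
  | zero =>
    exact of_zero (M := M) (fun i _ => by fun_prop) fun i hi x hx => by
      simpa using h i hi x hx
  | succ k =>
    refine of_deriv (M := M) (fun i _ => by fun_prop) (fun i hi x hx => by simpa using h i hi x hx)
      (f' := fun i _ => (l i (ν i) : ℂ)) (fun i _ x _ => ?_)
      (const (M := M) _ fun i hi => by simpa using hν i hi)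
    exact HasDerivAt.ofReal_comp ((l i).hasFDerivAt.hasLineDerivAt (ν i))

theorem comp {V : ι → Set ℝ} {F : ι → ℝ → ℂ} (hF : UnifLineBounded P V (fun _ => 1) k F)
    {s : ι → E → ℝ} (hs : UnifLineBounded P U ν k fun i x => (s i x : ℂ))
    (hUV : ∀ i ∈ P, Set.MapsTo (s i) (U i) (V i)) :
    UnifLineBounded P U ν k fun i x => F i (s i x) := by
  have hsc : ∀ i ∈ P, ContinuousOn (s i) (U i) := fun i hi =>
    (Complex.continuous_re.comp_continuousOn (hs.continuousOn hi)).congr fun x _ => rfl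
  induction k generalizing F with
  | zero =>
    obtain ⟨C, hC, h⟩ := hF.exists_bound
    exact of_zero (fun i hi => (hF.continuousOn hi).comp (hsc i hi) (hUV i hi))
      fun i hi x hx => h i hi _ (hUV i hi hx)
  | succ k ih =>
    obtain ⟨C, hC, h⟩ := hF.exists_bound
    obtain ⟨F', hF1, hF2⟩ := hF.exists_deriv
    obtain ⟨s', hs1, hs2⟩ := hs.exists_deriv
    refine of_deriv (fun i hi => (hF.continuousOn hi).comp (hsc i hi) (hUV i hi))
      (fun i hi x hx => h i hi _ (hUV i hi hx)) (f' := fun i x => s' i x * F' i (s i x)) ?_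
      (hs2.mul (ih hF2 (hs.of_le (Nat.le_succ k))))
    intro i hi x hx
    obtain ⟨h1, h2⟩ := hasLineDerivAt_ofReal_iff.mp (hs1 i hi x hx)
    have h3 := hasLineDerivAt_one_iff.mp (hF1 i hi _ (hUV i hi hx))
    rw [show x = x + (0 : ℝ) • ν i by simp] at h3
    have := HasDerivAt.scomp (0 : ℝ) h3 h2
    rw [h1]
    simp only [zero_smul, add_zero, Complex.real_smul] at this
    exact this

theorem sqrt {c : ℝ} (hc : 0 < c) {s : ι → E → ℝ}
    (hs : UnifLineBounded P U ν k fun i x => (s i x : ℂ)) (h : ∀ i ∈ P, ∀ x ∈ U i, c < s i x) :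
    UnifLineBounded P U ν k fun i x => (√(s i x) : ℂ) := by
  obtain ⟨M, hM, hb⟩ := hs.exists_bound
  have key : ∀ k, UnifLineBounded P (fun _ => Set.Ioo c (M + 1)) (fun _ => (1 : ℝ)) k
      fun _ x => (√x : ℂ) := by
    intro k
    have hcont : ContinuousOn (fun x : ℝ => (√x : ℂ)) (Set.Ioo c (M + 1)) := by fun_prop
    have hbd : ∀ x ∈ Set.Ioo c (M + 1), ‖(√x : ℂ)‖ ≤ √(M + 1) := by
      intro x hx
      rw [Complex.norm_real, Real.norm_of_nonneg (Real.sqrt_nonneg _)]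
      exact Real.sqrt_le_sqrt hx.2.le
    induction k with
    | zero => exact of_zero (fun _ _ => hcont) fun _ _ => hbd
    | succ k ih =>
      refine of_deriv (fun _ _ => hcont) (fun _ _ => hbd) (f' := fun _ x => (1 / 2 : ℂ) * (√x : ℂ)⁻¹)
        (fun i hi x hx => ?_) (const_mul (M := 1) _ (by norm_num)
          (ih.inv (c := √c) (Real.sqrt_pos.mpr hc) fun i hi x hx => ?_))
      · have := (Real.hasDerivAt_sqrt (hc.trans hx.1).ne').ofReal_comp
        rw [hasLineDerivAt_one_iff]
        exact this.congr_deriv (by push_cast; field_simp)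
      · rw [Complex.norm_real, Real.norm_of_nonneg (Real.sqrt_nonneg _)]
        exact Real.sqrt_le_sqrt hx.1.le
  refine (key k).comp hs fun i hi x hx => ⟨h i hi x hx, ?_⟩
  have := hb i hi x hx
  rw [Complex.norm_real] at this
  linarith [le_abs_self (s i x), Real.norm_eq_abs (s i x)]

theorem exists_diffQuot_bound {V : ι → Set ℝ} {F : ι → ℝ → ℂ} (hV : ∀ i ∈ P, Convex ℝ (V i))
    (hF : UnifLineBounded P V (fun _ => 1) (k + 1) F) :
    ∃ C, ∀ q ∈ {q : ι × ℝ | q.1 ∈ P ∧ q.2 ≠ 0}, ∀ t ∈ V q.1 ∩ {t | t + q.2 ∈ V q.1},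
      ‖((q.2 : ℂ))⁻¹ * (F q.1 (t + q.2) - F q.1 t)‖ ≤ C := by
  obtain ⟨F', hF1, hF2⟩ := hF.exists_deriv
  obtain ⟨C, hC, hb⟩ := hF2.exists_bound
  refine ⟨C, fun q hq t ht => ?_⟩
  have := Convex.norm_image_sub_le_of_norm_hasDerivWithin_le (f := F q.1) (f' := F' q.1)
    (s := V q.1) (C := C)
    (fun x hx => (hasLineDerivAt_one_iff.mp (hF1 _ hq.1 x hx)).hasDerivWithinAt)
    (fun x hx => hb _ hq.1 x hx) (hV _ hq.1) ht.1 ht.2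
  rw [add_sub_cancel_left] at this
  have h0 : 0 < ‖q.2‖ := norm_pos_iff.mpr hq.2
  rw [norm_mul, norm_inv, Complex.norm_real, inv_mul_le_iff₀ h0]
  linarith

/-- Difference quotients of a uniformly bounded family on intervals. -/
theorem diffQuot {V : ι → Set ℝ} {F : ι → ℝ → ℂ} (hV : ∀ i ∈ P, Convex ℝ (V i))
    (hF : UnifLineBounded P V (fun _ => 1) (k + 1) F) :
    UnifLineBounded {q : ι × ℝ | q.1 ∈ P ∧ q.2 ≠ 0}
      (fun q => V q.1 ∩ {t | t + q.2 ∈ V q.1}) (fun _ => 1) k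
      (fun q t => ((q.2 : ℂ))⁻¹ * (F q.1 (t + q.2) - F q.1 t)) := by
  induction k generalizing F with
  | zero =>
    obtain ⟨C, hb⟩ := exists_diffQuot_bound hV hF
    exact of_zero (fun q hq => continuousOn_const.mul (ContinuousOn.sub
      ((hF.continuousOn hq.1).comp (by fun_prop) fun t ht => ht.2)
      ((hF.continuousOn hq.1).mono fun t ht => ht.1))) hb
  | succ k ih =>
    obtain ⟨C, hb⟩ := exists_diffQuot_bound hV hF
    obtain ⟨F', hF1, hF2⟩ := hF.exists_deriv
    refine of_deriv (fun q hq => continuousOn_const.mul (ContinuousOn.sub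
      ((hF.continuousOn hq.1).comp (by fun_prop) fun t ht => ht.2)
      ((hF.continuousOn hq.1).mono fun t ht => ht.1))) hb
      (f' := fun q t => ((q.2 : ℂ))⁻¹ * (F' q.1 (t + q.2) - F' q.1 t)) ?_ (ih hF2)
    intro q hq t ht
    rw [hasLineDerivAt_one_iff]
    have h1 := (hasLineDerivAt_one_iff.mp (hF1 _ hq.1 _ ht.2)).comp_add_const t q.2
    exact (h1.sub (hasLineDerivAt_one_iff.mp (hF1 _ hq.1 _ ht.1))).const_mul _

end UnifLineBounded

theorem exists_lineBounded_of_contDiff {χ : E → ℝ} (hχ : ContDiff ℝ (⊤ : ℕ∞) χ)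
    (hc : HasCompactSupport χ) (ν : E) (k : ℕ) :
    ∃ C, LineBounded Set.univ ν k C fun v => (χ v : ℂ) := by
  induction k generalizing χ with
  | zero =>
    obtain ⟨C, hC⟩ := hc.exists_bound_of_continuous hχ.continuous
    exact ⟨C, (Complex.continuous_ofReal.comp hχ.continuous).continuousOn,
      fun x _ => by simpa using hC x⟩
  | succ k ih =>
    obtain ⟨C, hC⟩ := hc.exists_bound_of_continuous hχ.continuous
    have h1 : ContDiff ℝ (⊤ : ℕ∞) fun v => fderiv ℝ χ v ν :=
      (hχ.fderiv_right (m := (⊤ : ℕ∞)) (by simp)).clm_apply contDiff_const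
    have h2 : HasCompactSupport fun v => fderiv ℝ χ v ν :=
      (hc.fderiv (𝕜 := ℝ)).comp_left (g := fun l : E →L[ℝ] ℝ => l ν) rfl
    obtain ⟨D, hD⟩ := ih h1 h2
    refine ⟨max C D, (Complex.continuous_ofReal.comp hχ.continuous).continuousOn, fun x _ => ?_,
      fun v => (fderiv ℝ χ v ν : ℂ), fun x _ => ?_, hD.mono (le_max_right _ _)⟩
    · simpa using (hC x).trans (le_max_left _ _)
    · exact HasDerivAt.ofReal_comp
        ((hχ.differentiable (by simp)).differentiableAt.hasFDerivAt.hasLineDerivAt ν)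

end UnifLineBounded

section SecondOrder

variable {E : Type*} [NormedAddCommGroup E] [NormedSpace ℝ E]

theorem min_one_inv_pow_le {x : ℝ} (hx : 0 < x) : min 1 (x⁻¹ ^ 4) ≤ 16 * (1 + x) ^ (-(4 : ℝ)) := by
  have h1 : (1 + x) ^ (-(4 : ℝ)) = ((1 + x) ^ 4)⁻¹ := by
    rw [Real.rpow_neg (by positivity)]; norm_cast
  rw [h1, ← div_eq_mul_inv, le_div_iff₀ (by positivity)]
  rcases le_total x 1 with h | h
  · calc min 1 (x⁻¹ ^ 4) * (1 + x) ^ 4 ≤ 1 * (1 + 1) ^ 4 := by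
          gcongr; exact min_le_left _ _
      _ = 16 := by norm_num
  · calc min 1 (x⁻¹ ^ 4) * (1 + x) ^ 4 ≤ x⁻¹ ^ 4 * (x + x) ^ 4 := by
          gcongr; exact min_le_right _ _
      _ = 16 := by field_simp; ring

variable [MeasurableSpace E] [BorelSpace E]

/-- The square of an oscillatory integral as an integral of correlations. -/
theorem norm_integral_sq_le_integral_correlation [FiniteDimensional ℝ E] (μ : Measure E)
    [μ.IsAddHaarMeasure] {g : E → ℂ} (hg : Continuous g) (hgc : HasCompactSupport g)
    {b : E → ℝ} (hb : Integrable b μ)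
    (h : ∀ z, z ≠ 0 → ‖∫ v, g (v + z) * (starRingEnd ℂ) (g v) ∂μ‖ ≤ b z) [Nontrivial E] :
    ‖∫ v, g v ∂μ‖ ^ 2 ≤ ∫ z, b z ∂μ := by
  have hF : Continuous fun p : E × E => g (p.1 + p.2) * (starRingEnd ℂ) (g p.1) := by fun_prop
  have hFc : HasCompactSupport fun p : E × E => g (p.1 + p.2) * (starRingEnd ℂ) (g p.1) := by
    refine HasCompactSupport.intro (K := tsupport g ×ˢ ((fun p : E × E => p.1 - p.2) ''
      (tsupport g ×ˢ tsupport g))) ?_ ?_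
    · exact hgc.isCompact.prod ((hgc.isCompact.prod hgc.isCompact).image (by fun_prop))
    · intro p hp
      by_contra hne
      have h2 : p.1 ∈ tsupport g := by
        by_contra hc
        exact hne (by simp [image_eq_zero_of_notMem_tsupport hc])
      have h1 : p.1 + p.2 ∈ tsupport g := by
        by_contra hc
        exact hne (by simp [image_eq_zero_of_notMem_tsupport hc])
      exact hp ⟨h2, (p.1 + p.2, p.1), ⟨h1, h2⟩, by simp⟩
  have e : ((‖∫ v, g v ∂μ‖ ^ 2 : ℝ) : ℂ)
      = ∫ z, ∫ v, g (v + z) * (starRingEnd ℂ) (g v) ∂μ ∂μ := by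
    rw [← integral_integral_swap_of_hasCompactSupport
      (f := fun v z => g (v + z) * (starRingEnd ℂ) (g v)) hF hFc]
    simp_rw [integral_mul_const, integral_add_left_eq_self (μ := μ) g, integral_const_mul]
    rw [integral_conj, Complex.mul_conj, Complex.normSq_eq_norm_sq]
  have h0 : ‖((‖∫ v, g v ∂μ‖ ^ 2 : ℝ) : ℂ)‖ = ‖∫ v, g v ∂μ‖ ^ 2 := by
    rw [Complex.norm_real, Real.norm_of_nonneg (by positivity)]
  rw [← h0, e]
  refine norm_integral_le_of_norm_le hb ?_
  have : ∀ᵐ z ∂μ, z ≠ (0 : E) := by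
    simp [ae_iff]
  filter_upwards [this] with z hz using h z hz

omit [MeasurableSpace E] [BorelSpace E] in
theorem hasLineDerivAt_cexp {φ : E → ℝ} {v ν : E} {d : ℝ} (M : ℝ) (h : HasLineDerivAt ℝ φ d v ν) :
    HasLineDerivAt ℝ (fun v => cexp (I * (M * φ v : ℝ))) (I * (M * d : ℝ) * cexp (I * (M * φ v : ℝ)))
      v ν := by
  have h1 : HasDerivAt (fun t : ℝ => I * ((M * φ (v + t • ν) : ℝ) : ℂ)) (I * (M * d : ℝ)) 0 := by
    exact (HasDerivAt.ofReal_comp (HasDerivAt.const_mul M h)).const_mul I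
  have := h1.cexp
  simp only [zero_smul, add_zero] at this
  rw [mul_comm] at this
  exact this

theorem norm_cexp_I_mul (x : ℝ) : ‖cexp (I * (x : ℝ))‖ = 1 := by
  rw [mul_comm]; exact Complex.norm_exp_ofReal_mul_I x

/-- Decay of order `|M| ^ (-3/2)` of a three dimensional oscillatory integral whose phase `φ` has
increments `φ (v + z) - φ v` with a derivative of size `‖z‖` along some fixed direction. -/
theorem exists_second_order_bound [FiniteDimensional ℝ E] (hE : Module.finrank ℝ E = 3)
    (μ : Measure E) [μ.IsAddHaarMeasure] (C R : ℝ) {c : ℝ} (hc : 0 < c) (hR : 0 ≤ R) :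
    ∃ K, 0 ≤ K ∧ ∀ (U B : Set E) (φ : E → ℝ) (a : E → ℂ) (M : ℝ), M ≠ 0 → IsOpen U →
      ContinuousOn φ U → IsCompact B → tsupport a ⊆ U → tsupport a ⊆ B → μ.real B ≤ R →
      (∀ z : E, z ≠ 0 → ∃ (ν : E) (f : E → ℝ),
        (∀ v ∈ U, v + z ∈ U → HasLineDerivAt ℝ (fun v => φ (v + z) - φ v) (‖z‖ * f v) v ν) ∧
        LineBounded (U ∩ {v | v + z ∈ U}) ν 4 C (fun v => (f v : ℂ)) ∧
        (∀ v ∈ U, v + z ∈ U → c ≤ |f v|) ∧ LineBounded U ν 4 C a) →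
      ‖∫ v, cexp (I * (M * φ v : ℝ)) * a v ∂μ‖ ≤ K * |M| ^ (-(3 / 2) : ℝ) := by
  have : Nontrivial E := Module.nontrivial_of_finrank_pos (R := ℝ) (by omega)
  set C' := max C (2 ^ 4 * (|C| * |C|)) with hC'
  obtain ⟨K₁, hK₁, h1⟩ := exists_nonstationary_bound μ 4 C' R hc hR
  set K₂ := max K₁ (|C| * |C| * R) with hK₂
  have hK₂0 : 0 ≤ K₂ := hK₁.trans (le_max_left _ _)
  have hint : Integrable (fun z : E => (1 + ‖z‖) ^ (-(4 : ℝ))) μ :=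
    integrable_one_add_norm (by rw [hE]; norm_num)
  set S := ∫ z : E, (1 + ‖z‖) ^ (-(4 : ℝ)) ∂μ with hS
  have hS0 : 0 ≤ S := integral_nonneg fun z => by positivity
  refine ⟨√(K₂ * 16 * S), by positivity, ?_⟩
  intro U B φ a M hM hU hφ hB haU haB hBR hz
  have hM0 : 0 < |M| := abs_pos.mpr hM
  obtain ⟨z₀, hz₀⟩ := exists_ne (0 : E)
  have hab : ∀ v, ‖a v‖ ≤ |C| := by
    obtain ⟨ν, f, -, -, -, h⟩ := hz z₀ hz₀
    intro v
    by_cases hv : v ∈ tsupport a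
    · exact (h.bound v (haU hv)).trans (le_abs_self C)
    · simp [image_eq_zero_of_notMem_tsupport hv]
  have hac : ContinuousOn a U := by
    obtain ⟨ν, f, -, -, -, h⟩ := hz z₀ hz₀
    exact h.continuousOn
  have hca : HasCompactSupport a := hB.of_isClosed_subset (isClosed_tsupport a) haB
  have hexp : ContinuousOn (fun v => cexp (I * (M * φ v : ℝ))) U := by
    refine Complex.continuous_exp.comp_continuousOn (continuousOn_const.mul ?_)
    exact Complex.continuous_ofReal.comp_continuousOn (continuousOn_const.mul hφ)
  have hsq := norm_integral_sq_le_integral_correlation μ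
    (continuous_mul_of_tsupport_subset hU hexp hac haU)
    (hca.mul_left (f := fun v => cexp (I * (M * φ v : ℝ))))
    (b := fun z => K₂ * 16 * (1 + ‖M • z‖) ^ (-(4 : ℝ)))
    ((hint.comp_smul hM).const_mul _) ?_
  · rw [integral_const_mul, Measure.integral_comp_smul μ (fun z => (1 + ‖z‖) ^ (-(4 : ℝ))) M, hE,
      ← hS, smul_eq_mul] at hsq
    refine le_of_sq_le_sq ?_ (by positivity)
    refine hsq.trans_eq ?_
    rw [mul_pow, Real.sq_sqrt (by positivity), ← Real.rpow_natCast (|M| ^ _), ← Real.rpow_mul hM0.le,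
      abs_inv, abs_pow]
    have : |M| ^ (-(3 / 2) * ((2 : ℕ) : ℝ)) = (|M| ^ 3)⁻¹ := by
      rw [show (-(3 / 2) * ((2 : ℕ) : ℝ) : ℝ) = -((3 : ℕ) : ℝ) by norm_num, Real.rpow_neg hM0.le,
        Real.rpow_natCast]
    rw [this]; ring
  · intro z hz0
    obtain ⟨ν, f, hf1, hf2, hf3, hf4⟩ := hz z hz0
    have hzn : 0 < ‖z‖ := norm_pos_iff.mpr hz0
    set V := U ∩ {v | v + z ∈ U} with hV
    have hVo : IsOpen V := hU.inter (hU.preimage (by fun_prop))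
    set b : E → ℂ := fun v => a (v + z) * (starRingEnd ℂ) (a v) with hb
    have hbz : ∀ v, v ∉ tsupport a ∩ {v | v + z ∈ tsupport a} → b v = 0 := by
      intro v hv
      simp only [Set.mem_inter_iff, Set.mem_ofPred_eq, not_and_or] at hv
      rcases hv with hv | hv <;> simp [hb, image_eq_zero_of_notMem_tsupport hv]
    have hbs : tsupport b ⊆ tsupport a ∩ {v | v + z ∈ tsupport a} := by
      refine closure_minimal (fun v hv => ?_) ((isClosed_tsupport a).inter
        ((isClosed_tsupport a).preimage (by fun_prop)))
      by_contra h
      exact hv (hbz v h)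
    have hbU : tsupport b ⊆ V := fun v hv => ⟨haU (hbs hv).1, haU (hbs hv).2⟩
    have hbB : tsupport b ⊆ B := fun v hv => haB (hbs hv).1
    have haa : LineBounded U ν 4 |C| a := hf4.mono (le_abs_self C)
    have hbb : LineBounded V ν 4 C' b := by
      refine (LineBounded.mul (abs_nonneg C) (abs_nonneg C)
        (haa.comp_add (W := V) z fun v hv => hv.2) (haa.star.mono_set fun v hv => hv.1)).mono ?_
      exact le_max_right _ _
    have eG : ∀ v, cexp (I * (M * φ (v + z) : ℝ)) * a (v + z) *
        (starRingEnd ℂ) (cexp (I * (M * φ v : ℝ)) * a v)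
        = cexp (I * (M * (φ (v + z) - φ v) : ℝ)) * b v := by
      intro v
      rw [map_mul, ← Complex.exp_conj, map_mul, conj_I, conj_ofReal, hb]
      simp only
      rw [show (I * ((M * (φ (v + z) - φ v) : ℝ) : ℂ)) = I * (M * φ (v + z) : ℝ) + -I * (M * φ v : ℝ)
        by push_cast; ring, Complex.exp_add]
      ring
    have hsg : |((SignType.sign M : ℤ) : ℝ)| = 1 := by
      rcases lt_or_gt_of_ne hM with h | h <;> simp [h]
    have hsC : ‖(((SignType.sign M : ℤ) : ℝ) : ℂ)‖ = 1 := by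
      rw [Complex.norm_real, Real.norm_eq_abs, hsg]
    have hJ0 : ‖∫ v, cexp (I * (M * (φ (v + z) - φ v) : ℝ)) * b v ∂μ‖
        ≤ |C| * |C| * R := by
      refine (norm_integral_le_of_tsupport_subset μ (C := |C| * |C|) hB.measure_ne_top
        (fun v => ?_) fun v hv => ?_).trans (by gcongr)
      · rw [norm_mul, norm_cexp_I_mul, one_mul, hb]
        simp only [norm_mul, RCLike.norm_conj]
        exact mul_le_mul (hab _) (hab _) (norm_nonneg _) (abs_nonneg _)
      · rw [image_eq_zero_of_notMem_tsupport fun h => hv (hbB h), mul_zero]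
    have hJ1 : ‖∫ v, cexp (I * (M * (φ (v + z) - φ v) : ℝ)) * b v ∂μ‖
        ≤ K₁ * (|M| * ‖z‖)⁻¹ ^ 4 := by
      refine h1 V B ν (fun v => cexp (I * (M * (φ (v + z) - φ v) : ℝ)))
        (fun v => (((SignType.sign M : ℤ) : ℝ) : ℂ) * f v) b (|M| * ‖z‖) (by positivity) hVo ?_ ?_ ?_ ?_ ?_ hbb
        hB hbU hbB hBR
      · refine Complex.continuous_exp.comp_continuousOn (continuousOn_const.mul ?_)
        refine Complex.continuous_ofReal.comp_continuousOn (continuousOn_const.mul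
          (ContinuousOn.sub (hφ.comp (by fun_prop) fun v hv => hv.2)
            (hφ.mono fun v hv => hv.1)))
      · intro v _
        rw [norm_cexp_I_mul]
      · intro v hv
        convert hasLineDerivAt_cexp M (hf1 v hv.1 hv.2) using 2
        have : (M : ℂ) = |M| * ((SignType.sign M : ℤ) : ℝ) := by
          rcases lt_or_gt_of_ne hM with h | h
          · simp [h, abs_of_neg h]
          · simp [h, abs_of_pos h]
        push_cast
        rw [this]
        push_cast
        ring
      · have := hf2.const_mul (((SignType.sign M : ℤ) : ℝ) : ℂ)
        rw [hsC, one_mul] at this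
        exact this.mono (le_max_left _ _)
      · intro v hv
        rw [norm_mul, hsC, one_mul, Complex.norm_real]
        exact hf3 v hv.1 hv.2
    simp only [eG]
    rw [norm_smul, Real.norm_eq_abs, mul_assoc]
    refine le_trans ?_ (mul_le_mul_of_nonneg_left (min_one_inv_pow_le (x := |M| * ‖z‖) (by positivity)) hK₂0)
    rw [mul_min_of_nonneg _ _ hK₂0, mul_one]
    refine le_min (hJ0.trans (le_max_right _ _)) (hJ1.trans ?_)
    gcongr
    exact le_max_left _ _

end SecondOrder

section CubicGaussian

open scoped Topology

/-- The moments `∫₀^∞ s ^ n exp (-b s ^ 3 - d s ^ 2) ds`. -/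
noncomputable def cubicMoment (n : ℕ) (b d : ℂ) : ℂ :=
  ∫ s in Set.Ioi (0 : ℝ), (s : ℂ) ^ n * cexp (-b * s ^ 3 - d * s ^ 2)

theorem norm_cubic_integrand (n : ℕ) (b d : ℂ) {s : ℝ} (hs : 0 ≤ s) :
    ‖(s : ℂ) ^ n * cexp (-b * s ^ 3 - d * s ^ 2)‖ = s ^ n * rexp (-b.re * s ^ 3 - d.re * s ^ 2) := by
  rw [norm_mul, norm_pow, Complex.norm_real, Real.norm_of_nonneg hs, Complex.norm_exp]
  congr 2
  rw [← Complex.ofReal_pow, ← Complex.ofReal_pow, Complex.sub_re, Complex.re_mul_ofReal,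
    Complex.re_mul_ofReal, Complex.neg_re]

theorem cubic_isBigO (n : ℕ) {β : ℝ} (hβ : 0 < β) (δ : ℝ) :
    (fun s : ℝ => s ^ n * rexp (-β * s ^ 3 - δ * s ^ 2)) =O[atTop] fun s => rexp (-1 * s) := by
  have h1 : (fun s : ℝ => s ^ n) =O[atTop] fun s => rexp s := (isLittleO_pow_exp_atTop).isBigO
  have h2 : (fun s : ℝ => rexp (-β * s ^ 3 - δ * s ^ 2)) =O[atTop] fun s => rexp (-2 * s) := by
    refine Asymptotics.IsBigO.of_bound 1 ?_
    filter_upwards [eventually_ge_atTop (1 : ℝ), eventually_ge_atTop ((|δ| + 2) / β)] with s hs1 hs2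
    rw [Real.norm_of_nonneg (by positivity), Real.norm_of_nonneg (by positivity), one_mul]
    refine Real.exp_le_exp.mpr ?_
    rw [div_le_iff₀ hβ] at hs2
    have h3 : (|δ| + 2) * s ^ 2 ≤ s * β * s ^ 2 := by gcongr
    have h4 : -δ * s ^ 2 ≤ |δ| * s ^ 2 := by gcongr; exact neg_le_abs δ
    nlinarith
  refine (h1.mul h2).congr_right fun s => ?_
  rw [← Real.exp_add]; ring_nf

theorem integrableOn_cubic_real (n : ℕ) {β : ℝ} (hβ : 0 < β) (δ : ℝ) :
    IntegrableOn (fun s : ℝ => s ^ n * rexp (-β * s ^ 3 - δ * s ^ 2)) (Set.Ioi 0) :=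
  integrable_of_isBigO_exp_neg one_pos (by fun_prop) (cubic_isBigO n hβ δ)

theorem integrableOn_cubic (n : ℕ) {b : ℂ} (hb : 0 < b.re) (d : ℂ) :
    IntegrableOn (fun s : ℝ => (s : ℂ) ^ n * cexp (-b * s ^ 3 - d * s ^ 2)) (Set.Ioi 0) := by
  refine Integrable.mono' (integrableOn_cubic_real n hb d.re)
    (by apply Continuous.aestronglyMeasurable; fun_prop) ?_
  filter_upwards [ae_restrict_mem measurableSet_Ioi] with s hs
  rw [norm_cubic_integrand n b d (le_of_lt hs)]

theorem tendsto_cubic (n : ℕ) {b : ℂ} (hb : 0 < b.re) (d : ℂ) :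
    Tendsto (fun s : ℝ => (s : ℂ) ^ n * cexp (-b * s ^ 3 - d * s ^ 2)) atTop (𝓝 0) := by
  rw [tendsto_zero_iff_norm_tendsto_zero]
  have h1 : Tendsto (fun s : ℝ => rexp (-1 * s)) atTop (𝓝 0) := by
    simpa using Real.tendsto_exp_neg_atTop_nhds_zero
  refine ((cubic_isBigO n hb d.re).trans_tendsto h1).congr' ?_
  filter_upwards [eventually_ge_atTop (0 : ℝ)] with s hs
  rw [norm_cubic_integrand n b d hs]

theorem hasDerivAt_cubic_exp (b d : ℂ) (s : ℝ) :
    HasDerivAt (fun s : ℝ => cexp (-b * s ^ 3 - d * s ^ 2))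
      ((-3 * b * s ^ 2 - 2 * d * s) * cexp (-b * s ^ 3 - d * s ^ 2)) s := by
  have h1 : HasDerivAt (fun s : ℂ => cexp (-b * s ^ 3 - d * s ^ 2))
      ((-3 * b * s ^ 2 - 2 * d * s) * cexp (-b * s ^ 3 - d * s ^ 2)) (s : ℂ) := by
    have := (((hasDerivAt_pow 3 (s : ℂ)).const_mul (-b)).fun_sub
      ((hasDerivAt_pow 2 (s : ℂ)).const_mul d)).cexp
    refine this.congr_deriv ?_
    push_cast; ring
  exact h1.comp_ofReal

theorem cubicMoment_relation_zero {b : ℂ} (hb : 0 < b.re) (d : ℂ) :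
    3 * b * cubicMoment 2 b d + 2 * d * cubicMoment 1 b d = 1 := by
  have i2 := (integrableOn_cubic 2 hb d).const_mul (-3 * b)
  have i1 := (integrableOn_cubic 1 hb d).const_mul (-2 * d)
  have i21 := i2.add i1
  have h := integral_Ioi_of_hasDerivAt_of_tendsto (a := (0 : ℝ)) (m := (0 : ℂ))
    (f := fun s : ℝ => cexp (-b * s ^ 3 - d * s ^ 2))
    (f' := fun s : ℝ => (-3 * b) * ((s : ℂ) ^ 2 * cexp (-b * s ^ 3 - d * s ^ 2))
      + (-2 * d) * ((s : ℂ) ^ 1 * cexp (-b * s ^ 3 - d * s ^ 2)))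
    (by apply Continuous.continuousWithinAt; fun_prop)
    (fun s _ => (hasDerivAt_cubic_exp b d s).congr_deriv (by ring))
    (by exact i21) (by simpa using tendsto_cubic 0 hb d)
  rw [integral_add i2 i1, integral_const_mul, integral_const_mul] at h
  change -3 * b * cubicMoment 2 b d + -2 * d * cubicMoment 1 b d = _ at h
  simp only [Complex.ofReal_zero] at h
  norm_num at h
  linear_combination -h

theorem cubicMoment_relation_succ (n : ℕ) {b : ℂ} (hb : 0 < b.re) (d : ℂ) :
    3 * b * cubicMoment (n + 3) b d + 2 * d * cubicMoment (n + 2) b d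
      = (n + 1) * cubicMoment n b d := by
  have i0 := (integrableOn_cubic n hb d).const_mul ((n : ℂ) + 1)
  have i3 := (integrableOn_cubic (n + 3) hb d).const_mul (-3 * b)
  have i2 := (integrableOn_cubic (n + 2) hb d).const_mul (-2 * d)
  have i32 := i3.add i2
  have i := i0.add i32
  have h := integral_Ioi_of_hasDerivAt_of_tendsto (a := (0 : ℝ)) (m := (0 : ℂ))
    (f := fun s : ℝ => (s : ℂ) ^ (n + 1) * cexp (-b * s ^ 3 - d * s ^ 2))
    (f' := fun s : ℝ => ((n : ℂ) + 1) * ((s : ℂ) ^ n * cexp (-b * s ^ 3 - d * s ^ 2)) +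
      ((-3 * b) * ((s : ℂ) ^ (n + 3) * cexp (-b * s ^ 3 - d * s ^ 2))
      + (-2 * d) * ((s : ℂ) ^ (n + 2) * cexp (-b * s ^ 3 - d * s ^ 2))))
    (by apply Continuous.continuousWithinAt; fun_prop)
    (fun s _ => by
      refine ((hasDerivAt_pow (n + 1) (s : ℂ)).comp_ofReal.fun_mul
        (hasDerivAt_cubic_exp b d s)).congr_deriv ?_
      simp; ring)
    i (tendsto_cubic (n + 1) hb d)
  have e := integral_add i0 i32
  have e' := integral_add i3 i2
  simp only [Pi.add_apply] at e e'
  rw [e, e', integral_const_mul, integral_const_mul, integral_const_mul] at h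
  change (n + 1) * cubicMoment n b d + (-3 * b * cubicMoment (n + 3) b d
    + -2 * d * cubicMoment (n + 2) b d) = _ at h
  simp only [Complex.ofReal_zero] at h
  rw [zero_pow (Nat.succ_ne_zero n)] at h
  linear_combination -h

theorem hasDerivAt_cubicMoment (n : ℕ) {b : ℂ} (hb : 0 < b.re) (d : ℂ) :
    HasDerivAt (cubicMoment n b) (-cubicMoment (n + 2) b d) d := by
  have h := (hasDerivAt_integral_of_dominated_loc_of_deriv_le (μ := volume.restrict (Set.Ioi (0 : ℝ)))
    (F := fun (d : ℂ) (s : ℝ) => (s : ℂ) ^ n * cexp (-b * s ^ 3 - d * s ^ 2))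
    (F' := fun (d : ℂ) (s : ℝ) => -((s : ℂ) ^ (n + 2) * cexp (-b * s ^ 3 - d * s ^ 2)))
    (x₀ := d) (s := Metric.ball d 1)
    (bound := fun s => s ^ (n + 2) * rexp (-b.re * s ^ 3 - (d.re - 1) * s ^ 2))
    (Metric.ball_mem_nhds d one_pos) (Eventually.of_forall fun d => by
      apply Continuous.aestronglyMeasurable; fun_prop)
    (integrableOn_cubic n hb d) (by apply Continuous.aestronglyMeasurable; fun_prop) ?_
    (integrableOn_cubic_real (n + 2) hb (d.re - 1)) ?_).2
  · rw [integral_neg] at h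
    exact h
  · filter_upwards [ae_restrict_mem measurableSet_Ioi] with s hs d' hd'
    rw [norm_neg, norm_cubic_integrand _ b d' (le_of_lt hs)]
    have hs' : 0 ≤ s := le_of_lt hs
    have : d.re - 1 ≤ d'.re := by
      have h1 : |(d' - d).re| ≤ ‖d' - d‖ := Complex.abs_re_le_norm _
      rw [Metric.mem_ball, dist_eq_norm] at hd'
      rw [Complex.sub_re] at h1
      linarith [(abs_le.mp (h1.trans hd'.le)).1]
    gcongr
  · filter_upwards with s d' _
    have := ((((hasDerivAt_id d').mul_const ((s : ℂ) ^ 2)).const_sub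
      (-b * s ^ 3)).cexp).const_mul ((s : ℂ) ^ n)
    refine this.congr_deriv ?_
    simp; ring

theorem hasDerivAt_cubicMoment_left (n : ℕ) {b : ℂ} (hb : 0 < b.re) (d : ℂ) :
    HasDerivAt (fun b => cubicMoment n b d) (-cubicMoment (n + 3) b d) b := by
  have h := (hasDerivAt_integral_of_dominated_loc_of_deriv_le (μ := volume.restrict (Set.Ioi (0 : ℝ)))
    (F := fun (b : ℂ) (s : ℝ) => (s : ℂ) ^ n * cexp (-b * s ^ 3 - d * s ^ 2))
    (F' := fun (b : ℂ) (s : ℝ) => -((s : ℂ) ^ (n + 3) * cexp (-b * s ^ 3 - d * s ^ 2)))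
    (x₀ := b) (s := Metric.ball b (b.re / 2))
    (bound := fun s => s ^ (n + 3) * rexp (-(b.re / 2) * s ^ 3 - d.re * s ^ 2))
    (Metric.ball_mem_nhds b (half_pos hb)) (Eventually.of_forall fun d => by
      apply Continuous.aestronglyMeasurable; fun_prop)
    (integrableOn_cubic n hb d) (by apply Continuous.aestronglyMeasurable; fun_prop) ?_
    (integrableOn_cubic_real (n + 3) (half_pos hb) d.re) ?_).2
  · rw [integral_neg] at h
    exact h
  · filter_upwards [ae_restrict_mem measurableSet_Ioi] with s hs b' hb'
    rw [norm_neg, norm_cubic_integrand _ b' d (le_of_lt hs)]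
    have hs' : 0 ≤ s := le_of_lt hs
    have : b.re / 2 ≤ b'.re := by
      have h1 : |(b' - b).re| ≤ ‖b' - b‖ := Complex.abs_re_le_norm _
      rw [Metric.mem_ball, dist_eq_norm] at hb'
      rw [Complex.sub_re] at h1
      linarith [(abs_le.mp (h1.trans hb'.le)).1]
    gcongr
  · filter_upwards with s b' _
    have := ((((hasDerivAt_id b').fun_neg.mul_const ((s : ℂ) ^ 3)).sub_const
      (d * s ^ 2)).cexp).const_mul ((s : ℂ) ^ n)
    refine this.congr_deriv ?_
    simp; ring

theorem cubicMoment_one_zero (n : ℕ) :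
    cubicMoment n 1 0 = (1 / 3) * Complex.Gamma ((n + 1) / 3) := by
  have hre : 0 < (((n : ℂ) + 1) / 3).re := by
    rw [show (((n : ℂ) + 1) / 3) = ((n + 1) / 3 : ℝ) by push_cast; rfl, Complex.ofReal_re]
    positivity
  rw [Complex.Gamma_eq_integral hre, Complex.GammaIntegral,
    ← integral_comp_rpow_Ioi_of_pos (p := 3) (by norm_num), cubicMoment, ← integral_const_mul]
  refine setIntegral_congr_fun measurableSet_Ioi fun s hs => ?_
  have hs0 : (0 : ℝ) < s := hs
  have hsc : (s : ℂ) ≠ 0 := by exact_mod_cast hs0.ne'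
  have e1 : s ^ (3 : ℝ) = s ^ 3 := by exact_mod_cast Real.rpow_natCast s 3
  have e2 : s ^ ((3 : ℝ) - 1) = s ^ 2 := by
    rw [show (3 : ℝ) - 1 = (2 : ℕ) by norm_num, Real.rpow_natCast]
  have e3 : ((s ^ 3 : ℝ) : ℂ) ^ (((n : ℂ) + 1) / 3 - 1) = (s : ℂ) ^ n / s ^ 2 := by
    have h0 : (s : ℂ).arg = 0 := Complex.arg_ofReal_of_nonneg hs0.le
    have := Complex.cpow_nat_mul' (x := (s : ℂ)) (n := 3) (by rw [h0]; simpa using Real.pi_pos)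
      (by rw [h0]; simpa using Real.pi_pos.le) (((n : ℂ) + 1) / 3 - 1)
    rw [Complex.ofReal_pow, ← this, show ((3 : ℕ) : ℂ) * (((n : ℂ) + 1) / 3 - 1)
      = (n : ℂ) - (2 : ℕ) by push_cast; ring, Complex.cpow_sub _ _ hsc, Complex.cpow_natCast,
      Complex.cpow_natCast]
  simp only [e1, e2]
  rw [e3]
  simp
  field_simp

theorem cubicMoment_zero_right (n : ℕ) {b : ℂ} (hb : 0 < b.re) :
    cubicMoment n b 0 * b ^ (((n : ℂ) + 1) / 3) = (1 / 3) * Complex.Gamma ((n + 1) / 3) := by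
  have ho : IsOpen {z : ℂ | 0 < z.re} := isOpen_lt continuous_const Complex.continuous_re
  have hd : ∀ z ∈ {z : ℂ | 0 < z.re},
      HasDerivAt (fun b => cubicMoment n b 0 * b ^ (((n : ℂ) + 1) / 3)) 0 z := by
    intro z hz
    have hz0 : z ≠ 0 := by rintro rfl; simp at hz
    have h2 := (hasDerivAt_id z).cpow_const (c := ((n : ℂ) + 1) / 3) (Or.inl hz)
    refine ((hasDerivAt_cubicMoment_left n hz 0).fun_mul h2).congr_deriv ?_
    have h3 := cubicMoment_relation_succ n hz 0
    simp only [id, mul_one]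
    rw [Complex.cpow_sub _ _ hz0, Complex.cpow_one]
    field_simp
    linear_combination -z ^ (((n : ℂ) + 1) / 3) * h3
  have := ho.is_const_of_deriv_eq_zero (𝕜 := ℂ) (convex_halfSpace_re_gt 0).isPreconnected
    (fun z hz => (hd z hz).differentiableAt.differentiableWithinAt) (fun z hz => (hd z hz).deriv)
    hb (show (1 : ℂ) ∈ {z : ℂ | 0 < z.re} by simp)
  rw [this, cubicMoment_one_zero, Complex.one_cpow, mul_one]
end CubicGaussian

section AiryRepresentation

/-- The unit complex number with argument `θ * π / 12`. -/
noncomputable def unitRot (θ : ℝ) : ℂ := cexp ((θ * (π / 12) : ℝ) * I)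

theorem unitRot_add (θ φ : ℝ) : unitRot (θ + φ) = unitRot θ * unitRot φ := by
  rw [unitRot, unitRot, unitRot, ← Complex.exp_add]; push_cast; ring_nf

theorem unitRot_zero : unitRot 0 = 1 := by simp [unitRot]

theorem unitRot_six : unitRot 6 = I := by
  rw [unitRot, show (6 * (π / 12) : ℝ) = π / 2 by ring]
  push_cast; exact Complex.exp_pi_div_two_mul_I

theorem unitRot_pow (θ : ℝ) (n : ℕ) : unitRot θ ^ n = unitRot (n * θ) := by
  rw [unitRot, ← Complex.exp_nat_mul, unitRot]; push_cast; ring_nf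

theorem unitRot_re (θ : ℝ) : (unitRot θ).re = Real.cos (θ * (π / 12)) := by
  rw [unitRot, Complex.exp_ofReal_mul_I_re]

theorem norm_unitRot (θ : ℝ) : ‖unitRot θ‖ = 1 := Complex.norm_exp_ofReal_mul_I _

theorem unitRot_three_re_pos : 0 < (1 / 3 * unitRot 3).re := by
  have : (1 / 3 * unitRot 3 : ℂ).re = 1 / 3 * (unitRot 3).re := by simp
  rw [this, unitRot_re]
  have : 0 < Real.cos (3 * (π / 12)) := Real.cos_pos_of_mem_Ioo ⟨by linarith [pi_pos], by linarith [pi_pos]⟩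
  positivity

theorem unitRot_neg_three_re_pos : 0 < (1 / 3 * unitRot (-3)).re := by
  have : (1 / 3 * unitRot (-3) : ℂ).re = 1 / 3 * (unitRot (-3)).re := by simp
  rw [this, unitRot_re]
  have : 0 < Real.cos (-3 * (π / 12)) := Real.cos_pos_of_mem_Ioo ⟨by linarith [pi_pos], by linarith [pi_pos]⟩
  positivity

/-- The moments `∫ τ ^ n exp (-i τ ^ 3 / 3 - r τ ^ 2) dτ` along a contour from
`-∞ e^{iπ/12}` to `∞ e^{-iπ/12}`. -/
noncomputable def airyMoment (n : ℕ) (r : ℂ) : ℂ :=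
  unitRot (-1) ^ (n + 1) * cubicMoment n (1 / 3 * unitRot 3) (r * unitRot (-2))
    + (-1) ^ n * unitRot 1 ^ (n + 1) * cubicMoment n (1 / 3 * unitRot (-3)) (r * unitRot 2)

theorem hasDerivAt_airyMoment (n : ℕ) (r : ℂ) :
    HasDerivAt (airyMoment n) (-airyMoment (n + 2) r) r := by
  have h1 := (hasDerivAt_cubicMoment n unitRot_three_re_pos (r * unitRot (-2))).comp r
    ((hasDerivAt_id r).mul_const (unitRot (-2)))
  have h2 := (hasDerivAt_cubicMoment n unitRot_neg_three_re_pos (r * unitRot 2)).comp r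
    ((hasDerivAt_id r).mul_const (unitRot 2))
  have e1 : unitRot (-2) = unitRot (-1) ^ 2 := by rw [unitRot_pow]; norm_num
  have e2 : unitRot 2 = unitRot 1 ^ 2 := by rw [unitRot_pow]; norm_num
  refine ((h1.const_mul (unitRot (-1) ^ (n + 1))).fun_add
    (h2.const_mul ((-1) ^ n * unitRot 1 ^ (n + 1)))).congr_deriv ?_
  rw [airyMoment, e1, e2]
  ring

theorem I_mul_airyMoment_two (r : ℂ) : I * airyMoment 2 r = -2 * r * airyMoment 1 r := by
  have h1 := cubicMoment_relation_zero unitRot_three_re_pos (r * unitRot (-2))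
  have h2 := cubicMoment_relation_zero unitRot_neg_three_re_pos (r * unitRot 2)
  have e1 : unitRot 3 = I * unitRot (-1) ^ 3 := by
    rw [← unitRot_six, unitRot_pow, ← unitRot_add]; norm_num
  have e2 : unitRot (-3) = -I * unitRot 1 ^ 3 := by
    have : unitRot (-3) * unitRot 6 = unitRot 1 ^ 3 := by
      rw [unitRot_pow, ← unitRot_add]; norm_num
    rw [unitRot_six] at this
    rw [← this]; ring_nf; simp
  have e3 : unitRot (-2) = unitRot (-1) ^ 2 := by rw [unitRot_pow]; norm_num
  have e4 : unitRot 2 = unitRot 1 ^ 2 := by rw [unitRot_pow]; norm_num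
  rw [airyMoment, airyMoment]
  have e1' : 3 * (1 / 3 * unitRot 3) = I * unitRot (-1) ^ 3 := by rw [← e1]; ring
  have e2' : 3 * (1 / 3 * unitRot (-3)) = -I * unitRot 1 ^ 3 := by rw [← e2]; ring
  rw [e1'] at h1
  rw [e2'] at h2
  generalize cubicMoment 2 (1 / 3 * unitRot 3) (r * unitRot (-2)) = x at *
  generalize cubicMoment 1 (1 / 3 * unitRot 3) (r * unitRot (-2)) = y at *
  generalize cubicMoment 2 (1 / 3 * unitRot (-3)) (r * unitRot 2) = z at *
  generalize cubicMoment 1 (1 / 3 * unitRot (-3)) (r * unitRot 2) = w at *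
  rw [e3] at h1
  rw [e4] at h2
  linear_combination h1 - h2

theorem I_mul_airyMoment_three (r : ℂ) :
    I * airyMoment 3 r = airyMoment 0 r - 2 * r * airyMoment 2 r := by
  have h1 := cubicMoment_relation_succ 0 unitRot_three_re_pos (r * unitRot (-2))
  have h2 := cubicMoment_relation_succ 0 unitRot_neg_three_re_pos (r * unitRot 2)
  have e1 : unitRot 3 = I * unitRot (-1) ^ 3 := by
    rw [← unitRot_six, unitRot_pow, ← unitRot_add]; norm_num
  have e2 : unitRot (-3) = -I * unitRot 1 ^ 3 := by
    have : unitRot (-3) * unitRot 6 = unitRot 1 ^ 3 := by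
      rw [unitRot_pow, ← unitRot_add]; norm_num
    rw [unitRot_six] at this
    rw [← this]; ring_nf; simp
  have e3 : unitRot (-2) = unitRot (-1) ^ 2 := by rw [unitRot_pow]; norm_num
  have e4 : unitRot 2 = unitRot 1 ^ 2 := by rw [unitRot_pow]; norm_num
  rw [airyMoment, airyMoment, airyMoment]
  have e1' : 3 * (1 / 3 * unitRot 3) = I * unitRot (-1) ^ 3 := by rw [← e1]; ring
  have e2' : 3 * (1 / 3 * unitRot (-3)) = -I * unitRot 1 ^ 3 := by rw [← e2]; ring
  rw [e1'] at h1
  rw [e2'] at h2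
  norm_num at h1 h2 ⊢
  generalize cubicMoment 3 (1 / 3 * unitRot 3) (r * unitRot (-2)) = x at *
  generalize cubicMoment 2 (1 / 3 * unitRot 3) (r * unitRot (-2)) = y at *
  generalize cubicMoment 0 (1 / 3 * unitRot 3) (r * unitRot (-2)) = y' at *
  generalize cubicMoment 3 (1 / 3 * unitRot (-3)) (r * unitRot 2) = z at *
  generalize cubicMoment 2 (1 / 3 * unitRot (-3)) (r * unitRot 2) = w at *
  generalize cubicMoment 0 (1 / 3 * unitRot (-3)) (r * unitRot 2) = w' at *
  rw [e3] at h1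
  rw [e4] at h2
  linear_combination unitRot (-1) * h1 + unitRot 1 * h2

theorem cpow_unitRot_div_three {θ : ℝ} (hθ : |θ| ≤ 3) (w : ℂ) :
    (1 / 3 * unitRot θ) ^ w = cexp (-(Real.log 3 : ℂ) * w) * cexp (w * ((θ * (π / 12) : ℝ) * I)) := by
  have h : (1 / 3 * unitRot θ) = cexp (-(Real.log 3 : ℂ) + (θ * (π / 12) : ℝ) * I) := by
    rw [Complex.exp_add, unitRot, ← Complex.ofReal_neg, ← Complex.ofReal_exp, Real.exp_neg,
      Real.exp_log (by norm_num)]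
    push_cast; ring
  obtain ⟨h1, h2⟩ := abs_le.mp hθ
  have hp := pi_pos
  have him : (-(Real.log 3 : ℂ) + (θ * (π / 12) : ℝ) * I).im = θ * (π / 12) := by
    simp only [Complex.add_im, Complex.neg_im, Complex.ofReal_im, Complex.im_ofReal_mul,
      Complex.I_im]
    ring
  rw [h, Complex.cpow_def_of_ne_zero (Complex.exp_ne_zero _), Complex.log_exp, ← Complex.exp_add]
  · congr 1; ring
  · rw [him]; nlinarith
  · rw [him]; nlinarith

theorem three_cpow (w : ℂ) : (3 : ℂ) ^ w = cexp ((Real.log 3 : ℂ) * w) := by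
  rw [Complex.cpow_def_of_ne_zero (by norm_num), Complex.ofReal_log (by norm_num)]
  norm_num

theorem unitRot_add_unitRot_neg (θ : ℝ) :
    unitRot θ + unitRot (-θ) = 2 * (Real.cos (θ * (π / 12)) : ℂ) := by
  rw [unitRot, unitRot, Complex.ofReal_cos, Complex.two_cos]
  push_cast; ring_nf

theorem unitRot_sub_unitRot_neg (θ : ℝ) :
    unitRot θ - unitRot (-θ) = 2 * I * (Real.sin (θ * (π / 12)) : ℂ) := by
  have h := Complex.two_sin ((θ * (π / 12) : ℝ) : ℂ)
  have e : unitRot (-θ) = cexp (-((θ * (π / 12) : ℝ) : ℂ) * I) := by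
    rw [unitRot]; push_cast; ring_nf
  rw [e, unitRot, Complex.ofReal_sin]
  linear_combination (-I) * h + (cexp (((θ * (π / 12) : ℝ) : ℂ) * I)
    - cexp (-((θ * (π / 12) : ℝ) : ℂ) * I)) * Complex.I_sq

theorem cubicMoment_unitRot_zero (n : ℕ) {θ : ℝ} (hθ : |θ| ≤ 3) (h : 0 < (1 / 3 * unitRot θ).re) :
    cubicMoment n (1 / 3 * unitRot θ) 0
      = 1 / 3 * Complex.Gamma ((n + 1) / 3) * cexp ((Real.log 3 : ℂ) * ((n + 1) / 3))
        * unitRot (-(n + 1) * θ / 3) := by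
  have h1 := cubicMoment_zero_right n h
  rw [cpow_unitRot_div_three hθ] at h1
  have h2 : cexp (-(Real.log 3 : ℂ) * (((n : ℂ) + 1) / 3))
      * cexp (((n : ℂ) + 1) / 3 * ((θ * (π / 12) : ℝ) * I))
      * (cexp ((Real.log 3 : ℂ) * ((n + 1) / 3)) * unitRot (-(n + 1) * θ / 3)) = 1 := by
    rw [unitRot, ← Complex.exp_add, ← Complex.exp_add, ← Complex.exp_add]
    conv_rhs => rw [← Complex.exp_zero]
    congr 1
    push_cast; ring
  linear_combination (cexp ((Real.log 3 : ℂ) * ((n + 1) / 3)) * unitRot (-(n + 1) * θ / 3)) * h1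
    - cubicMoment n (1 / 3 * unitRot θ) 0 * h2

theorem exp_log_three_mul (w : ℂ) : cexp ((Real.log 3 : ℂ) * (w + 1)) = 3 * (3 : ℂ) ^ w := by
  rw [three_cpow, mul_add, Complex.exp_add, mul_one, ← Complex.ofReal_exp,
    Real.exp_log (by norm_num)]
  push_cast; ring

theorem airyMoment_zero_zero :
    airyMoment 0 0 = √3 * (3 : ℂ) ^ (-(2 : ℂ) / 3) * Complex.Gamma (1 / 3) := by
  have hs := unitRot_add_unitRot_neg 2
  rw [show (2 * (π / 12) : ℝ) = π / 6 by ring, Real.cos_pi_div_six] at hs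
  have hu : unitRot 2 = unitRot 1 * unitRot 1 := by rw [← unitRot_add]; norm_num
  have hu' : unitRot (-2) = unitRot (-1) * unitRot (-1) := by rw [← unitRot_add]; norm_num
  have he := exp_log_three_mul (-(2 : ℂ) / 3)
  rw [airyMoment, zero_mul, zero_mul, cubicMoment_unitRot_zero 0 (by norm_num) unitRot_three_re_pos,
    cubicMoment_unitRot_zero 0 (by norm_num) unitRot_neg_three_re_pos,
    show (((0 : ℕ) : ℂ) + 1) / 3 = -(2 : ℂ) / 3 + 1 by norm_num, he,
    show (-(2 : ℂ) / 3 + 1) = 1 / 3 by norm_num,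
    show (-(((0 : ℕ) : ℝ) + 1) * 3 / 3) = -1 by norm_num,
    show (-(((0 : ℕ) : ℝ) + 1) * (-3) / 3) = 1 by norm_num]
  generalize (3 : ℂ) ^ (-(2 : ℂ) / 3) = p
  push_cast at hs ⊢
  linear_combination (p * Complex.Gamma (1 / 3)) * (hs - hu - hu')

theorem airyMoment_one_zero :
    airyMoment 1 0 = -I * √3 * (3 : ℂ) ^ (-(1 : ℂ) / 3) * Complex.Gamma (2 / 3) := by
  have hs := unitRot_sub_unitRot_neg 4
  rw [show (4 * (π / 12) : ℝ) = π / 3 by ring, Real.sin_pi_div_three] at hs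
  have hu : unitRot 4 = unitRot 1 ^ 2 * unitRot 2 := by
    rw [unitRot_pow, ← unitRot_add]; norm_num
  have hu' : unitRot (-4) = unitRot (-1) ^ 2 * unitRot (-2) := by
    rw [unitRot_pow, ← unitRot_add]; norm_num
  have he := exp_log_three_mul (-(1 : ℂ) / 3)
  rw [airyMoment, zero_mul, zero_mul, cubicMoment_unitRot_zero 1 (by norm_num) unitRot_three_re_pos,
    cubicMoment_unitRot_zero 1 (by norm_num) unitRot_neg_three_re_pos,
    show (((1 : ℕ) : ℂ) + 1) / 3 = -(1 : ℂ) / 3 + 1 by norm_num, he,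
    show (-(1 : ℂ) / 3 + 1) = 2 / 3 by norm_num,
    show (-(((1 : ℕ) : ℝ) + 1) * 3 / 3) = -2 by norm_num,
    show (-(((1 : ℕ) : ℝ) + 1) * (-3) / 3) = 2 by norm_num]
  generalize (3 : ℂ) ^ (-(1 : ℂ) / 3) = p
  push_cast at hs ⊢
  linear_combination (p * Complex.Gamma (2 / 3)) * (-hs + hu - hu')
end AiryRepresentation

section AiryIdentification

theorem hasDerivAt_exp_cube (r : ℂ) :
    HasDerivAt (fun r : ℂ => cexp (-2 / 3 * r ^ 3)) (-2 * r ^ 2 * cexp (-2 / 3 * r ^ 3)) r := by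
  refine (((hasDerivAt_pow 3 r).const_mul (-2 / 3 : ℂ)).cexp).congr_deriv ?_
  push_cast; ring

/-- The Airy function pulled back by `r ↦ r ^ 2`, up to a constant. -/
noncomputable def airySq (r : ℂ) : ℂ := cexp (-2 / 3 * r ^ 3) * airyMoment 0 r

/-- The derivative of the Airy function pulled back by `r ↦ r ^ 2`, up to a constant. -/
noncomputable def airySqDeriv (r : ℂ) : ℂ :=
  -(cexp (-2 / 3 * r ^ 3) * (r * airyMoment 0 r + I * airyMoment 1 r))

theorem hasDerivAt_airySq (r : ℂ) : HasDerivAt airySq (2 * r * airySqDeriv r) r := by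
  refine ((hasDerivAt_exp_cube r).fun_mul (hasDerivAt_airyMoment 0 r)).congr_deriv ?_
  have := I_mul_airyMoment_two r
  have h2 := Complex.I_sq
  rw [airySqDeriv]
  linear_combination (cexp (-2 / 3 * r ^ 3) * I) * this - cexp (-2 / 3 * r ^ 3) * airyMoment 2 r * h2

theorem hasDerivAt_airySqDeriv (r : ℂ) : HasDerivAt airySqDeriv (2 * r ^ 3 * airySq r) r := by
  refine ((hasDerivAt_exp_cube r).fun_mul (((hasDerivAt_id' r).fun_mul
    (hasDerivAt_airyMoment 0 r)).fun_add
      ((hasDerivAt_airyMoment 1 r).const_mul I))).fun_neg.congr_deriv ?_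
  have h1 := I_mul_airyMoment_two r
  have h3 := I_mul_airyMoment_three r
  have h2 := Complex.I_sq
  rw [airySq]
  linear_combination cexp (-2 / 3 * r ^ 3) * h3
    + r * cexp (-2 / 3 * r ^ 3) * I * h1 - r * cexp (-2 / 3 * r ^ 3) * airyMoment 2 r * h2

theorem eq_zero_of_linear_system {D₁ D₂ : ℂ → ℂ}
    (h₁ : ∀ r, HasDerivAt D₁ (2 * r * D₂ r) r) (h₂ : ∀ r, HasDerivAt D₂ (2 * r ^ 3 * D₁ r) r)
    (h₁0 : D₁ 0 = 0) (h₂0 : D₂ 0 = 0) (r : ℂ) : D₁ r = 0 := by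
  have hmul : ∀ t : ℝ, HasDerivAt (fun t : ℝ => (t : ℂ) * r) r t := fun t => by
    simpa using (Complex.ofRealCLM.hasDerivAt (x := t)).mul_const r
  have hd : ∀ t : ℝ, HasDerivAt (fun t : ℝ => (D₁ (t * r), D₂ (t * r)))
      (2 * (t * r) * D₂ (t * r) * r, 2 * (t * r) ^ 3 * D₁ (t * r) * r) t := fun t =>
    ((h₁ (t * r)).comp t (hmul t)).prodMk ((h₂ (t * r)).comp t (hmul t))
  have key := norm_le_gronwallBound_of_norm_deriv_right_le
    (f := fun t : ℝ => (D₁ (t * r), D₂ (t * r))) (δ := 0) (ε := 0) (a := 0) (b := 1)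
    (K := 2 * ‖r‖ ^ 2 + 2 * ‖r‖ ^ 4)
    (fun t _ => (hd t).continuousAt.continuousWithinAt)
    (fun t _ => (hd t).hasDerivWithinAt) (by simp [h₁0, h₂0]) (fun t ht => by
      have h0 : 0 ≤ t := ht.1
      have h1 : t ≤ 1 := ht.2.le
      have hn : ‖(t : ℂ)‖ = t := by simp [abs_of_nonneg h0]
      have ha := norm_fst_le (D₁ (t * r), D₂ (t * r))
      have hb := norm_snd_le (D₁ (t * r), D₂ (t * r))
      simp only at ha hb
      generalize ‖(D₁ (t * r), D₂ (t * r))‖ = M at *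
      have hM : 0 ≤ M := (norm_nonneg _).trans ha
      have ht3 : t ^ 3 ≤ 1 := pow_le_one₀ h0 h1
      rw [add_zero]
      refine (norm_prod_le_iff).2 ⟨?_, ?_⟩
      · simp only [norm_mul, hn, Complex.norm_ofNat]
        calc 2 * (t * ‖r‖) * ‖D₂ (t * r)‖ * ‖r‖ = 2 * ‖r‖ ^ 2 * (t * ‖D₂ (t * r)‖) := by ring
          _ ≤ 2 * ‖r‖ ^ 2 * (1 * M) := by gcongr
          _ ≤ _ := by nlinarith [mul_nonneg (pow_nonneg (norm_nonneg r) 4) hM]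
      · simp only [norm_mul, norm_pow, hn, Complex.norm_ofNat]
        calc 2 * (t * ‖r‖) ^ 3 * ‖D₁ (t * r)‖ * ‖r‖ = 2 * ‖r‖ ^ 4 * (t ^ 3 * ‖D₁ (t * r)‖) := by
              ring
          _ ≤ 2 * ‖r‖ ^ 4 * (1 * M) := by gcongr
          _ ≤ _ := by nlinarith [mul_nonneg (pow_nonneg (norm_nonneg r) 2) hM])
    1 ⟨zero_le_one, le_rfl⟩
  rw [gronwallBound_ε0_δ0, norm_le_zero_iff] at key
  simpa using congrArg Prod.fst key

/-- Every function with the Airy equation and initial data is given by the contour integral. -/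
theorem exists_mul_airy_sq_eq {Ai : ℂ → ℂ} (hAi_diff : Differentiable ℂ Ai)
    (hAi_diff' : Differentiable ℂ (deriv Ai)) (hAi_ode : ∀ z : ℂ, deriv (deriv Ai) z = z * Ai z)
    (hAi_zero : Ai 0 = (3 : ℂ) ^ (-(2 : ℂ) / 3) / Complex.Gamma (2 / 3))
    (hAi_zero' : deriv Ai 0 = -((3 : ℂ) ^ (-(1 : ℂ) / 3)) / Complex.Gamma (1 / 3)) :
    ∃ c : ℂ, c ≠ 0 ∧ ∀ r, c * Ai (r ^ 2) = cexp (-2 / 3 * r ^ 3) * airyMoment 0 r := by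
  have g1 : Complex.Gamma (1 / 3) ≠ 0 :=
    Complex.Gamma_ne_zero_of_re_pos (by norm_num)
  have g2 : Complex.Gamma (2 / 3) ≠ 0 :=
    Complex.Gamma_ne_zero_of_re_pos (by norm_num)
  have g3 : (√3 : ℂ) ≠ 0 := by simp
  refine ⟨√3 * Complex.Gamma (1 / 3) * Complex.Gamma (2 / 3),
    mul_ne_zero (mul_ne_zero g3 g1) g2, fun r => ?_⟩
  set c : ℂ := √3 * Complex.Gamma (1 / 3) * Complex.Gamma (2 / 3) with hc
  have hsq : ∀ r : ℂ, HasDerivAt (fun r : ℂ => r ^ 2) (2 * r) r := fun r => by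
    simpa using hasDerivAt_pow 2 r
  have hd : ∀ r : ℂ, HasDerivAt (fun r => c * deriv Ai (r ^ 2)) (c * (r ^ 2 * Ai (r ^ 2) * (2 * r))) r :=
    fun r => by
      have h := (hAi_diff' (r ^ 2)).hasDerivAt
      rw [hAi_ode] at h
      exact (h.comp r (hsq r)).const_mul c
  have := eq_zero_of_linear_system (D₁ := fun r => airySq r - c * Ai (r ^ 2))
    (D₂ := fun r => airySqDeriv r - c * deriv Ai (r ^ 2))
    (fun r => ((hasDerivAt_airySq r).fun_sub
      (((hAi_diff (r ^ 2)).hasDerivAt.comp r (hsq r)).const_mul c)).congr_deriv (by ring))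
    (fun r => ((hasDerivAt_airySqDeriv r).fun_sub (hd r)).congr_deriv (by ring))
    (by
      simp only [airySq, airyMoment_zero_zero, hc]
      rw [show (0 : ℂ) ^ 2 = 0 by norm_num, hAi_zero]
      field_simp
      simp)
    (by
      simp only [airySqDeriv, airyMoment_one_zero, hc]
      rw [show (0 : ℂ) ^ 2 = 0 by norm_num, hAi_zero']
      field_simp
      simp) r
  rw [← airySq]
  exact (sub_eq_zero.1 this).symm

end AiryIdentification

section ReflectionSymbol

theorem exp_I_mul_Bfun {Ai : ℂ → ℂ} {L : ℝ → ℝ} {c : ℂ} (hc : c ≠ 0)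
    (hAi : ∀ r, c * Ai (r ^ 2) = cexp (-2 / 3 * r ^ 3) * airyMoment 0 r)
    (hL : ∀ w : ℝ, cexp (-(L w : ℂ) * I) = -(Aminus Ai w) / (Aplus Ai w)) {q : ℝ} (hq : 0 < q) :
    cexp (I * (Bfun L (q ^ 3) : ℝ))
      = -I * unitRot 8 * (airyMoment 0 (q * unitRot 2) / airyMoment 0 (q * unitRot (-2))) := by
  have hp := hAi (q * unitRot (-2))
  have hm := hAi (q * unitRot 2)
  have e6 : unitRot (-6) = -I := by
    have : unitRot (-6) * unitRot 6 = 1 := by rw [← unitRot_add, ← unitRot_zero]; norm_num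
    rw [unitRot_six] at this
    linear_combination (-I) * this + unitRot (-6) * Complex.I_sq
  have p2 : ((q : ℂ) * unitRot 2) ^ 2 = unitRot 4 * q ^ 2 := by
    rw [mul_pow, unitRot_pow]; norm_num; ring
  have m2 : ((q : ℂ) * unitRot (-2)) ^ 2 = unitRot (-4) * q ^ 2 := by
    rw [mul_pow, unitRot_pow]; norm_num; ring
  have p3 : ((q : ℂ) * unitRot 2) ^ 3 = I * q ^ 3 := by
    rw [mul_pow, unitRot_pow, ← unitRot_six]; norm_num; ring
  have m3 : ((q : ℂ) * unitRot (-2)) ^ 3 = -I * q ^ 3 := by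
    rw [mul_pow, unitRot_pow, ← e6]; norm_num; ring
  have h4 : cexp ((π / 3 : ℂ) * I) = unitRot 4 := by
    rw [unitRot]; push_cast; ring_nf
  have h4' : cexp (-(π / 3 : ℂ) * I) = unitRot (-4) := by
    rw [unitRot]; push_cast; ring_nf
  have hu : (q ^ 3) ^ ((2 : ℝ) / 3) = q ^ 2 := by
    rw [← Real.rpow_natCast, ← Real.rpow_mul hq.le, ← Real.rpow_natCast]; norm_num
  have hB : cexp (I * (Bfun L (q ^ 3) : ℝ))
      = cexp (2 / 3 * I * q ^ 3) ^ 2 * I * cexp (-(L (q ^ 2) : ℂ) * I) := by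
    rw [Bfun, hu, ← Complex.exp_nat_mul]
    nth_rw 3 [← Complex.exp_pi_div_two_mul_I]
    rw [← Complex.exp_add, ← Complex.exp_add]
    push_cast; ring_nf
  have hcancel : unitRot 4 * unitRot (-4) = 1 := by rw [← unitRot_add, ← unitRot_zero]; norm_num
  have h8 : unitRot 8 = unitRot 4 * unitRot 4 := by rw [← unitRot_add]; norm_num
  rw [m2, m3] at hp
  rw [p2, p3] at hm
  have hAp : c * Aplus Ai (q ^ 2 : ℝ)
      = unitRot (-4) * (cexp (2 / 3 * I * q ^ 3) * airyMoment 0 (q * unitRot (-2))) := by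
    rw [Aplus, h4']; push_cast
    rw [mul_left_comm, hp]; ring_nf
  have hAm : c * Aminus Ai (q ^ 2 : ℝ)
      = unitRot 4 * (cexp (-(2 / 3 * I * q ^ 3)) * airyMoment 0 (q * unitRot 2)) := by
    rw [Aminus, h4]; push_cast
    rw [mul_left_comm, hm]; ring_nf
  rw [hB, hL, ← mul_div_mul_left (-Aminus Ai (q ^ 2 : ℝ)) _ hc, mul_neg, hAp, hAm, h8,
    Complex.exp_neg]
  have h0 := Complex.exp_ne_zero (2 / 3 * I * q ^ 3)
  have hv : unitRot (-4) = (unitRot 4)⁻¹ := (inv_eq_of_mul_eq_one_right hcancel).symm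
  have h40 : unitRot 4 ≠ 0 := left_ne_zero_of_mul_eq_one hcancel
  generalize cexp (2 / 3 * I * q ^ 3) = e at *
  generalize airyMoment 0 (q * unitRot (-2)) = J at *
  generalize airyMoment 0 (q * unitRot 2) = J' at *
  rw [hv]
  by_cases hJ : J = 0
  · simp [hJ]
  field_simp

/-- The Gaussian moment dominating `cubicMoment n b d` for `Re b > 0` and `Re d ≥ 1 / 4`. -/
noncomputable def gaussMoment (n : ℕ) : ℝ := ∫ s in Set.Ioi (0 : ℝ), s ^ n * rexp (-(1 / 4) * s ^ 2)

theorem integrableOn_gauss (n : ℕ) :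
    IntegrableOn (fun s : ℝ => s ^ n * rexp (-(1 / 4) * s ^ 2)) (Set.Ioi 0) := by
  have := integrableOn_rpow_mul_exp_neg_mul_sq (b := 1 / 4) (by norm_num)
    (s := n) (by linarith [Nat.cast_nonneg (α := ℝ) n])
  simpa [Real.rpow_natCast] using this

theorem gaussMoment_nonneg (n : ℕ) : 0 ≤ gaussMoment n :=
  setIntegral_nonneg measurableSet_Ioi fun s hs => by
    have : (0 : ℝ) < s := hs
    positivity

theorem norm_cubicMoment_le (n : ℕ) {b d : ℂ} (hb : 0 ≤ b.re) (hd : 1 / 4 ≤ d.re) :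
    ‖cubicMoment n b d‖ ≤ gaussMoment n := by
  refine norm_integral_le_of_norm_le (integrableOn_gauss n) ?_
  filter_upwards [ae_restrict_mem measurableSet_Ioi] with s hs
  have hs0 : (0 : ℝ) ≤ s := le_of_lt hs
  rw [norm_cubic_integrand n b d hs0]
  gcongr
  nlinarith [pow_nonneg hs0 3, pow_nonneg hs0 2, mul_nonneg hb (pow_nonneg hs0 3)]

theorem norm_exp_sub_one_le_of_re_nonpos {w : ℂ} (hw : w.re ≤ 0) : ‖cexp w - 1‖ ≤ 2 * ‖w‖ := by
  rcases le_total ‖w‖ 1 with h | h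
  · exact Complex.norm_exp_sub_one_le h
  · have : ‖cexp w‖ ≤ 1 := by rw [Complex.norm_exp]; exact Real.exp_le_one_iff.2 hw
    calc ‖cexp w - 1‖ ≤ ‖cexp w‖ + ‖(1 : ℂ)‖ := norm_sub_le _ _
      _ ≤ 2 * ‖w‖ := by rw [norm_one]; linarith

theorem norm_cubicMoment_zero_sub_le {b d : ℂ} (hb : 0 < b.re) (hd : 1 / 4 ≤ d.re) :
    ‖cubicMoment 0 b d - (π / d) ^ (1 / 2 : ℂ) / 2‖ ≤ 2 * ‖b‖ * gaussMoment 3 := by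
  have hd0 : 0 < d.re := by linarith
  have hg := integrableOn_cubic 0 hb d
  have hi : IntegrableOn (fun s : ℝ => cexp (-d * (s : ℂ) ^ 2)) (Set.Ioi 0) :=
    (integrable_cexp_neg_mul_sq hd0).integrableOn
  rw [← integral_gaussian_complex_Ioi hd0, cubicMoment, ← integral_sub hg hi, gaussMoment,
    ← integral_const_mul]
  refine norm_integral_le_of_norm_le ((integrableOn_gauss 3).const_mul _) ?_
  filter_upwards [ae_restrict_mem measurableSet_Ioi] with s hs
  have hs0 : (0 : ℝ) ≤ s := le_of_lt hs
  have e : (s : ℂ) ^ 0 * cexp (-b * s ^ 3 - d * s ^ 2) - cexp (-d * (s : ℂ) ^ 2)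
      = (cexp (-b * (s ^ 3 : ℝ)) - 1) * cexp (-d * (s ^ 2 : ℝ)) := by
    rw [sub_mul, ← Complex.exp_add]; push_cast; ring_nf
  have h1 : ‖cexp (-b * (s ^ 3 : ℝ)) - 1‖ ≤ 2 * ‖-b * ((s ^ 3 : ℝ) : ℂ)‖ :=
    norm_exp_sub_one_le_of_re_nonpos (by
      rw [Complex.re_mul_ofReal, Complex.neg_re]
      nlinarith [mul_nonneg hb.le (pow_nonneg hs0 3)])
  have h2 : ‖cexp (-d * (s ^ 2 : ℝ))‖ ≤ rexp (-(1 / 4) * s ^ 2) := by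
    rw [Complex.norm_exp, Complex.re_mul_ofReal, Complex.neg_re]
    gcongr
  rw [norm_mul, norm_neg, Complex.norm_real, Real.norm_of_nonneg (pow_nonneg hs0 3)] at h1
  rw [e, norm_mul]
  calc _ ≤ 2 * (‖b‖ * s ^ 3) * rexp (-(1 / 4) * s ^ 2) := by gcongr
    _ = _ := by ring

theorem cubicMoment_scale (b d : ℂ) {m : ℝ} (hm : 0 < m) :
    cubicMoment 0 b (d / m ^ 2) = m * cubicMoment 0 (b * m ^ 3) d := by
  have hm' : (m : ℂ) ≠ 0 := by exact_mod_cast hm.ne'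
  have := integral_comp_mul_left_Ioi (fun s : ℝ => (s : ℂ) ^ 0 * cexp (-b * s ^ 3 - d / m ^ 2 * s ^ 2))
    0 hm
  rw [mul_zero] at this
  have e : cubicMoment 0 (b * m ^ 3) d = ∫ s in Set.Ioi (0 : ℝ),
      ((m * s : ℝ) : ℂ) ^ 0 * cexp (-b * (m * s : ℝ) ^ 3 - d / m ^ 2 * (m * s : ℝ) ^ 2) := by
    rw [cubicMoment]
    congr 1; ext s
    rw [pow_zero, pow_zero]; congr 2; push_cast; field_simp
  rw [e, this, Complex.real_smul, cubicMoment, Complex.ofReal_inv, mul_inv_cancel_left₀ hm']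

theorem unifLineBounded_cubicMoment {b e : ℂ} (hb : 0 < b.re) (he : 1 / 2 ≤ e.re) (n k : ℕ) :
    UnifLineBounded (Set.Ioi (0 : ℝ)) (fun _ => Set.Ioo (1 / 2 : ℝ) 3) (fun _ => (1 : ℝ)) k
      fun μ y => cubicMoment n (b * μ) (y * e) := by
  have hre : ∀ μ ∈ Set.Ioi (0 : ℝ), 0 < (b * μ).re := fun μ hμ => by
    rw [Complex.re_mul_ofReal]; exact mul_pos hb hμ
  have hd : ∀ n, ∀ μ ∈ Set.Ioi (0 : ℝ), ∀ y : ℝ, HasDerivAt (fun y : ℝ => cubicMoment n (b * μ) (y * e))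
      (-(e * cubicMoment (n + 2) (b * μ) (y * e))) y := fun n μ hμ y => by
    have h := (hasDerivAt_cubicMoment n (hre μ hμ) (y * e)).comp y
      (((Complex.ofRealCLM.hasDerivAt (x := y)).mul_const e))
    refine h.congr_deriv ?_
    simp only [Complex.ofRealCLM_apply, Complex.ofReal_one]; ring
  have hbd : ∀ n, ∀ μ ∈ Set.Ioi (0 : ℝ), ∀ y ∈ Set.Ioo (1 / 2 : ℝ) 3,
      ‖cubicMoment n (b * μ) (y * e)‖ ≤ gaussMoment n := fun n μ hμ y hy =>
    norm_cubicMoment_le n (hre μ hμ).le (by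
      rw [Complex.re_ofReal_mul]; nlinarith [hy.1])
  have hc : ∀ n, ∀ μ ∈ Set.Ioi (0 : ℝ), ContinuousOn (fun y : ℝ => cubicMoment n (b * μ) (y * e))
      (Set.Ioo (1 / 2) 3) := fun n μ hμ y _ => (hd n μ hμ y).continuousAt.continuousWithinAt
  induction k generalizing n with
  | zero => exact UnifLineBounded.of_zero (hc n) (hbd n)
  | succ k ih =>
    exact UnifLineBounded.of_deriv (hc n) (hbd n)
      (fun μ hμ y _ => hasLineDerivAt_one_iff.2 (hd n μ hμ y))
      ((ih (n + 2)).const_mul (M := ‖e‖) (fun _ => e) (fun _ _ => le_rfl)).neg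

/-- The rescaled contour integral in the denominator of the reflection factor. -/
noncomputable def airyDen (μ y : ℝ) : ℂ :=
  unitRot (-1) * cubicMoment 0 (1 / 3 * unitRot 3 * μ) (y * unitRot (-4))
    + unitRot 1 * cubicMoment 0 (1 / 3 * unitRot (-3) * μ) (y * 1)

/-- The rescaled contour integral in the numerator of the reflection factor. -/
noncomputable def airyNum (μ y : ℝ) : ℂ :=
  unitRot (-1) * cubicMoment 0 (1 / 3 * unitRot 3 * μ) (y * 1)
    + unitRot 1 * cubicMoment 0 (1 / 3 * unitRot (-3) * μ) (y * unitRot 4)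

theorem airyMoment_eq_airyDen {m : ℝ} (hm : 0 < m) (y : ℝ) :
    airyMoment 0 ((y / m ^ 2 : ℝ) * unitRot (-2)) = m * airyDen (m ^ 3) y := by
  have h1 : (y / m ^ 2 : ℝ) * unitRot (-2) * unitRot (-2) = y * unitRot (-4) / m ^ 2 := by
    rw [mul_assoc, ← unitRot_add]; norm_num; ring
  have h2 : (y / m ^ 2 : ℝ) * unitRot (-2) * unitRot 2 = y * 1 / m ^ 2 := by
    rw [mul_assoc, ← unitRot_add]; norm_num [unitRot_zero]
  rw [airyMoment, h1, h2, cubicMoment_scale _ _ hm, cubicMoment_scale _ _ hm, airyDen]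
  push_cast; ring

theorem airyMoment_eq_airyNum {m : ℝ} (hm : 0 < m) (y : ℝ) :
    airyMoment 0 ((y / m ^ 2 : ℝ) * unitRot 2) = m * airyNum (m ^ 3) y := by
  have h1 : (y / m ^ 2 : ℝ) * unitRot 2 * unitRot (-2) = y * 1 / m ^ 2 := by
    rw [mul_assoc, ← unitRot_add]; norm_num [unitRot_zero]
  have h2 : (y / m ^ 2 : ℝ) * unitRot 2 * unitRot 2 = y * unitRot 4 / m ^ 2 := by
    rw [mul_assoc, ← unitRot_add]; norm_num; ring
  rw [airyMoment, h1, h2, cubicMoment_scale _ _ hm, cubicMoment_scale _ _ hm, airyNum]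
  push_cast; ring

theorem unitRot_four_re : (unitRot 4).re = 1 / 2 := by
  rw [unitRot_re, show 4 * (π / 12) = π / 3 by ring, Real.cos_pi_div_three]

theorem unitRot_neg_four_re : (unitRot (-4)).re = 1 / 2 := by
  rw [unitRot_re, show -4 * (π / 12) = -(π / 3) by ring, Real.cos_neg, Real.cos_pi_div_three]

theorem pi_div_mul_unitRot_cpow {y : ℝ} (hy : 0 < y) :
    ((π : ℂ) / (y * unitRot (-4))) ^ (1 / 2 : ℂ) = ((π : ℂ) / (y * 1)) ^ (1 / 2 : ℂ) * unitRot 2 := by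
  have hcancel : unitRot 4 * unitRot (-4) = 1 := by rw [← unitRot_add, ← unitRot_zero]; norm_num
  have h40 : unitRot (-4) ≠ 0 := right_ne_zero_of_mul_eq_one hcancel
  have hy' : (y : ℂ) ≠ 0 := by exact_mod_cast hy.ne'
  have e : (π : ℂ) / (y * unitRot (-4)) = ((π / y : ℝ) : ℂ) * unitRot 4 := by
    push_cast; field_simp; linear_combination -hcancel
  have hp := pi_pos
  have hr : unitRot 4 ^ (1 / 2 : ℂ) = unitRot 2 := by
    rw [Complex.cpow_def_of_ne_zero (left_ne_zero_of_mul_eq_one hcancel), unitRot, Complex.log_exp,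
      unitRot]
    · congr 1; push_cast; ring
    · rw [Complex.im_ofReal_mul, Complex.I_im]; linarith
    · rw [Complex.im_ofReal_mul, Complex.I_im]; linarith
  have h := Complex.mul_cpow_ofReal_nonneg (a := π / y) (b := 0)
  rw [e, mul_one, show ((π : ℂ) / y) = ((π / y : ℝ) : ℂ) by push_cast; rfl]
  rw [Complex.cpow_def_of_ne_zero (mul_ne_zero (by exact_mod_cast (by positivity : π / y ≠ 0))
    (left_ne_zero_of_mul_eq_one hcancel)), Complex.log_ofReal_mul (by positivity)
    (left_ne_zero_of_mul_eq_one hcancel), add_mul, Complex.exp_add, ← hr,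
    Complex.cpow_def_of_ne_zero (left_ne_zero_of_mul_eq_one hcancel),
    Complex.cpow_def_of_ne_zero (by exact_mod_cast (by positivity : π / y ≠ 0)),
    Complex.ofReal_log (by positivity)]

theorem exists_le_norm_airyDen : ∃ μ₀ > 0, ∀ μ : ℝ, 0 < μ → μ ≤ μ₀ → ∀ y ∈ Set.Ioo (1 / 2 : ℝ) 3,
    1 / 2 ≤ ‖airyDen μ y‖ := by
  have hG := gaussMoment_nonneg 3
  refine ⟨1 / (4 * (gaussMoment 3 + 1)), by positivity, fun μ h0 hμ y hy => ?_⟩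
  have hy0 : 0 < y := by linarith [hy.1]
  have hμ' : μ * gaussMoment 3 ≤ 1 / 4 := by
    rw [le_div_iff₀ (by positivity)] at hμ
    nlinarith
  have hn : ∀ θ, ‖1 / 3 * unitRot θ * (μ : ℂ)‖ = 1 / 3 * μ := fun θ => by
    rw [norm_mul, norm_mul, norm_unitRot, Complex.norm_real, Real.norm_of_nonneg h0.le]; norm_num
  have h1 := norm_cubicMoment_zero_sub_le (b := 1 / 3 * unitRot 3 * μ) (d := y * unitRot (-4))
    (by rw [Complex.re_mul_ofReal]; exact mul_pos unitRot_three_re_pos h0)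
    (by rw [Complex.re_ofReal_mul, unitRot_neg_four_re]; linarith [hy.1])
  have h2 := norm_cubicMoment_zero_sub_le (b := 1 / 3 * unitRot (-3) * μ) (d := y * 1)
    (by rw [Complex.re_mul_ofReal]; exact mul_pos unitRot_neg_three_re_pos h0)
    (by rw [Complex.re_ofReal_mul, Complex.one_re]; linarith [hy.1])
  rw [hn, pi_div_mul_unitRot_cpow hy0] at h1
  rw [hn] at h2
  have hP : 1 ≤ ‖((π : ℂ) / (y * 1)) ^ (1 / 2 : ℂ)‖ := by
    rw [mul_one, show ((π : ℂ) / y) = ((π / y : ℝ) : ℂ) by push_cast; rfl,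
      Complex.norm_cpow_eq_rpow_re_of_pos (by positivity)]
    refine Real.one_le_rpow ?_ (by norm_num)
    rw [le_div_iff₀ hy0]
    linarith [hy.2, Real.pi_gt_three]
  have hu : unitRot (-1) * unitRot 2 = unitRot 1 := by rw [← unitRot_add]; norm_num
  rw [airyDen]
  generalize cubicMoment 0 (1 / 3 * unitRot 3 * μ) (y * unitRot (-4)) = k₁ at *
  generalize cubicMoment 0 (1 / 3 * unitRot (-3) * μ) (y * 1) = k₂ at *
  generalize ((π : ℂ) / (y * 1)) ^ (1 / 2 : ℂ) = p at *
  have e : unitRot 1 * p = (unitRot (-1) * k₁ + unitRot 1 * k₂)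
      - (unitRot (-1) * (k₁ - p * unitRot 2 / 2) + unitRot 1 * (k₂ - p / 2)) := by
    linear_combination -(p / 2) * hu
  have h3 := norm_sub_le (unitRot (-1) * k₁ + unitRot 1 * k₂)
    (unitRot (-1) * (k₁ - p * unitRot 2 / 2) + unitRot 1 * (k₂ - p / 2))
  have h4 := norm_add_le (unitRot (-1) * (k₁ - p * unitRot 2 / 2)) (unitRot 1 * (k₂ - p / 2))
  rw [← e, norm_mul, norm_unitRot, one_mul] at h3
  rw [norm_mul, norm_mul, norm_unitRot, norm_unitRot, one_mul, one_mul] at h4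
  linarith

end ReflectionSymbol

section ReflectionFactor

theorem unifLineBounded_airyDen (k : ℕ) :
    UnifLineBounded (Set.Ioi (0 : ℝ)) (fun _ => Set.Ioo (1 / 2 : ℝ) 3) (fun _ => (1 : ℝ)) k airyDen :=
  ((unifLineBounded_cubicMoment unitRot_three_re_pos unitRot_neg_four_re.ge 0 k).const_mul (M := 1)
    (fun _ => unitRot (-1)) (fun _ _ => (norm_unitRot _).le)).add
  ((unifLineBounded_cubicMoment unitRot_neg_three_re_pos (by norm_num) 0 k).const_mul (M := 1)
    (fun _ => unitRot 1) (fun _ _ => (norm_unitRot _).le))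

theorem unifLineBounded_airyNum (k : ℕ) :
    UnifLineBounded (Set.Ioi (0 : ℝ)) (fun _ => Set.Ioo (1 / 2 : ℝ) 3) (fun _ => (1 : ℝ)) k airyNum :=
  ((unifLineBounded_cubicMoment unitRot_three_re_pos (by norm_num) 0 k).const_mul (M := 1)
    (fun _ => unitRot (-1)) (fun _ _ => (norm_unitRot _).le)).add
  ((unifLineBounded_cubicMoment unitRot_neg_three_re_pos unitRot_four_re.ge 0 k).const_mul (M := 1)
    (fun _ => unitRot 1) (fun _ _ => (norm_unitRot _).le))

theorem exp_I_mul_Bfun_eq_airyNum_div {Ai : ℂ → ℂ} {L : ℝ → ℝ} {c : ℂ} (hc : c ≠ 0)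
    (hAi : ∀ r, c * Ai (r ^ 2) = cexp (-2 / 3 * r ^ 3) * airyMoment 0 r)
    (hL : ∀ w : ℝ, cexp (-(L w : ℂ) * I) = -(Aminus Ai w) / (Aplus Ai w)) {m A : ℝ} (hm : 0 < m)
    (hA : 0 < A) :
    cexp (I * (Bfun L ((m ^ 6)⁻¹ * A ^ ((3 : ℝ) / 2)) : ℝ))
      = -I * unitRot 8 * airyNum (m ^ 3) √A * (airyDen (m ^ 3) √A)⁻¹ := by
  have hA3 : A ^ ((3 : ℝ) / 2) = √A ^ 3 := by
    rw [Real.sqrt_eq_rpow, ← Real.rpow_natCast, ← Real.rpow_mul hA.le]; norm_num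
  have hm' : (m : ℂ) ≠ 0 := by exact_mod_cast hm.ne'
  have e : (m ^ 6)⁻¹ * A ^ ((3 : ℝ) / 2) = (√A / m ^ 2) ^ 3 := by
    rw [hA3]; field_simp
  rw [e, exp_I_mul_Bfun hc hAi hL (by positivity), airyMoment_eq_airyDen hm,
    airyMoment_eq_airyNum hm, mul_div_mul_left _ _ hm', div_eq_mul_inv]
  ring

theorem exists_unifLineBounded_reflection {Ai : ℂ → ℂ} {L : ℝ → ℝ}
    (hAi_diff : Differentiable ℂ Ai)
    (hAi_diff' : Differentiable ℂ (deriv Ai)) (hAi_ode : ∀ z : ℂ, deriv (deriv Ai) z = z * Ai z)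
    (hAi_zero : Ai 0 = (3 : ℂ) ^ (-(2 : ℂ) / 3) / Complex.Gamma (2 / 3))
    (hAi_zero' : deriv Ai 0 = -((3 : ℂ) ^ (-(1 : ℂ) / 3)) / Complex.Gamma (1 / 3))
    (hL : ∀ w : ℝ, cexp (-(L w : ℂ) * I) = -(Aminus Ai w) / (Aplus Ai w)) (k : ℕ) :
    ∃ Λ₁ : ℝ, 1 ≤ Λ₁ ∧ UnifLineBounded (Set.Ici Λ₁) (fun _ => Set.Ioo (4 / 5 : ℝ) 7)
      (fun _ => (1 : ℝ)) k
      fun Λ A => cexp (I * (Bfun L (Λ * A ^ ((3 : ℝ) / 2)) : ℝ)) := by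
  obtain ⟨c, hc, hAi⟩ := exists_mul_airy_sq_eq hAi_diff hAi_diff' hAi_ode hAi_zero hAi_zero'
  obtain ⟨μ₀, hμ₀, hden⟩ := exists_le_norm_airyDen
  obtain ⟨Λ₀, hΛ₀⟩ := eventually_atTop.1
    ((tendsto_rpow_neg_atTop (y := 1 / 2) (by norm_num)).eventually (ge_mem_nhds hμ₀))
  refine ⟨max Λ₀ 1, le_max_right _ _, ?_⟩
  set r : ℝ → ℝ := fun Λ => (Λ ^ (-(1 / 6) : ℝ)) ^ 3 with hr
  have hr0 : ∀ Λ ∈ Set.Ici (max Λ₀ 1), 0 < r Λ := fun Λ hΛ => by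
    have : (0 : ℝ) < Λ := zero_lt_one.trans_le ((le_max_right _ _).trans hΛ)
    positivity
  have hr1 : ∀ Λ ∈ Set.Ici (max Λ₀ 1), r Λ ≤ μ₀ := fun Λ hΛ => by
    have h0 : (0 : ℝ) < Λ := zero_lt_one.trans_le ((le_max_right _ _).trans hΛ)
    have := hΛ₀ Λ ((le_max_left _ _).trans hΛ)
    rw [hr]; simp only
    rw [← Real.rpow_natCast, ← Real.rpow_mul h0.le]
    norm_num at this ⊢
    exact this
  have hN := (unifLineBounded_airyNum k).reparam (P' := Set.Ici (max Λ₀ 1)) r hr0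
  have hD := ((unifLineBounded_airyDen k).reparam (P' := Set.Ici (max Λ₀ 1)) r hr0).inv
    (c := 1 / 2) (by norm_num) fun Λ hΛ y hy => hden _ (hr0 Λ hΛ) (hr1 Λ hΛ) y hy
  have hs : UnifLineBounded (Set.Ici (max Λ₀ 1)) (fun _ => Set.Ioo (4 / 5 : ℝ) 7)
      (fun _ => (1 : ℝ)) k fun _ A => (√A : ℂ) :=
    UnifLineBounded.sqrt (c := 4 / 5) (by norm_num)
      (UnifLineBounded.clm (M := 7) (fun _ => ContinuousLinearMap.id ℝ ℝ)
        (fun _ _ x hx => by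
          simp only [ContinuousLinearMap.id_apply, abs_le]
          constructor <;> linarith [hx.1, hx.2])
        (fun _ _ => by norm_num))
      (fun _ _ x hx => hx.1)
  have hP := (((hN.mul hD).const_mul (M := ‖-I * unitRot 8‖) (fun _ => -I * unitRot 8)
    (fun _ _ => le_rfl))).comp (s := fun _ A => √A) hs (fun _ _ A hA => by
      constructor
      · exact Real.lt_sqrt_of_sq_lt (by norm_num; linarith [hA.1])
      · rw [Real.sqrt_lt' (by norm_num)]; linarith [hA.2])
  refine hP.congr (fun _ _ => isOpen_Ioo) fun Λ hΛ A hA => ?_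
  have h0 : (0 : ℝ) < Λ := zero_lt_one.trans_le ((le_max_right _ _).trans hΛ)
  have hA0 : 0 < A := by linarith [hA.1]
  have hm : (((Λ ^ (-(1 / 6) : ℝ)) ^ 6)⁻¹ : ℝ) = Λ := by
    rw [← Real.rpow_natCast, ← Real.rpow_mul h0.le, ← Real.rpow_neg h0.le]
    norm_num
  have := exp_I_mul_Bfun_eq_airyNum_div hc hAi hL (m := Λ ^ (-(1 / 6) : ℝ)) (by positivity) hA0
  rw [hm] at this
  simp only [this, hr]
  ring

end ReflectionFactor

namespace UnifLineBounded

variable {ι κ E : Type*} [NormedAddCommGroup E] [NormedSpace ℝ E]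
  {P : Set ι} {U W : ι → Set E} {ν : ι → E} {k : ℕ} {f g : ι → E → ℂ}

theorem affine {M : ℝ} (l : ι → E →L[ℝ] ℝ) (b : ι → ℝ) (h : ∀ i ∈ P, ∀ x ∈ U i, |l i x + b i| ≤ M)
    (hν : ∀ i ∈ P, |l i (ν i)| ≤ M) : UnifLineBounded P U ν k fun i x => ((l i x + b i : ℝ) : ℂ) := by
  have hc : ∀ i, Continuous fun x => ((l i x + b i : ℝ) : ℂ) := fun i => by fun_prop
  cases k with
  | zero =>
    exact of_zero (M := M) (fun i _ => (hc i).continuousOn) fun i hi x hx => by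
      rw [Complex.norm_real]; exact h i hi x hx
  | succ k =>
    refine of_deriv (M := M) (fun i _ => (hc i).continuousOn)
      (fun i hi x hx => by rw [Complex.norm_real]; exact h i hi x hx)
      (f' := fun i _ => (l i (ν i) : ℂ)) (fun i _ x _ => ?_)
      (const (M := M) _ fun i hi => by rw [Complex.norm_real]; exact hν i hi)
    rw [hasLineDerivAt_ofReal_iff]
    refine ⟨by simp, ?_⟩
    rw [Complex.ofReal_re]
    exact ((l i).hasFDerivAt.add_const (b i)).hasLineDerivAt (ν i)

theorem diffQuot_of_convex {V : ι → Set ℝ} {F : ι → ℝ → ℂ} (hV : ∀ i ∈ P, Convex ℝ (V i))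
    (hF : UnifLineBounded P V (fun _ => 1) (k + 1) F) :
    UnifLineBounded {q : ι × ℝ | q.1 ∈ P}
      (fun q => V q.1 ∩ {t | t + q.2 ∈ V q.1}) (fun _ => 1) k
      (fun q t => ((q.2 : ℂ))⁻¹ * (F q.1 (t + q.2) - F q.1 t)) := by
  obtain ⟨C, hC, h⟩ := diffQuot hV hF
  refine ⟨C, hC, fun q hq => ?_⟩
  by_cases hq2 : q.2 = 0
  · have : (fun t => ((q.2 : ℂ))⁻¹ * (F q.1 (t + q.2) - F q.1 t)) = fun _ => 0 := by
      simp [hq2]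
    change LineBounded _ _ k C (fun t => ((q.2 : ℂ))⁻¹ * (F q.1 (t + q.2) - F q.1 t))
    rw [this]
    exact LineBounded.const 0 (by simpa using hC)
  · exact h q ⟨hq, hq2⟩

/-- A function of a bounded real coordinate. -/
theorem comp_coord {M : ℝ} {V : ι → Set ℝ} {F : ι → ℝ → ℂ}
    (hF : UnifLineBounded P V (fun _ => 1) k F)
    (l : E →L[ℝ] ℝ) (h : ∀ i ∈ P, ∀ x ∈ U i, |l x| ≤ M) (hν : ∀ i ∈ P, |l (ν i)| ≤ M)
    (hUV : ∀ i ∈ P, Set.MapsTo l (U i) (V i)) :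
    UnifLineBounded P U ν k fun i x => F i (l x) :=
  hF.comp (clm (fun _ => l) h hν) hUV

end UnifLineBounded

section Slowness

/-- The function `g` multiplying `T` in the tangential phase. -/
noncomputable def slow (a A : ℝ) : ℝ := √(1 + a) * (A - 1) / (√(1 + a * A) + √(1 + a))

/-- The derivative of `slow a`. -/
noncomputable def slowDeriv (a A : ℝ) : ℝ := √(1 + a) * (2 * √(1 + a * A))⁻¹

theorem hasDerivAt_slow {a A : ℝ} (ha : 0 < a) (hA : 0 < A) :
    HasDerivAt (slow a) (slowDeriv a A) A := by
  have h1 : HasDerivAt (fun A => √(1 + a) * (√(1 + a * A) - √(1 + a)) / a) (slowDeriv a A) A := by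
    have h2 : HasDerivAt (fun A => 1 + a * A) a A := by
      simpa using ((hasDerivAt_id' A).const_mul a).const_add 1
    refine ((((h2.sqrt (by positivity)).sub_const (√(1 + a))).const_mul
      (√(1 + a))).div_const a).congr_deriv ?_
    rw [slowDeriv]
    field_simp
  refine h1.congr_of_eventuallyEq ?_
  filter_upwards [lt_mem_nhds hA] with x hx
  have s1 : √(1 + a) ^ 2 = 1 + a := Real.sq_sqrt (by positivity)
  have s2 : √(1 + a * x) ^ 2 = 1 + a * x := Real.sq_sqrt (by positivity)
  have s3 : 0 < √(1 + a * x) + √(1 + a) := by positivity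
  rw [slow, div_eq_div_iff s3.ne' ha.ne']
  linear_combination √(1 + a) * s1 - √(1 + a) * s2

theorem one_le_sqrt_add {a A : ℝ} (ha : 0 ≤ a) (hA : 0 ≤ A) : 1 ≤ √(1 + a * A) :=
  Real.one_le_sqrt.2 (by nlinarith [mul_nonneg ha hA])

theorem sqrt_one_add_le {a : ℝ} (ha : 0 ≤ a) : √(1 + a) ≤ 1 + a / 2 := by
  rw [Real.sqrt_le_left (by positivity)]
  nlinarith

theorem abs_slowDeriv_sub_le {a A B : ℝ} (ha : 0 < a) (ha1 : a ≤ 1) (hA : 0 ≤ A) (hB : 0 ≤ B) :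
    |slowDeriv a B - slowDeriv a A| ≤ a * |B - A| := by
  have h0 := sqrt_one_add_le ha.le
  have h0' : 0 ≤ √(1 + a) := Real.sqrt_nonneg _
  have hA1 := one_le_sqrt_add ha.le hA
  have hB1 := one_le_sqrt_add ha.le hB
  have sA : √(1 + a * A) ^ 2 = 1 + a * A := Real.sq_sqrt (by positivity)
  have sB : √(1 + a * B) ^ 2 = 1 + a * B := Real.sq_sqrt (by positivity)
  have e : slowDeriv a B - slowDeriv a A = √(1 + a) * (a * (A - B)) /
      (2 * √(1 + a * A) * √(1 + a * B) * (√(1 + a * A) + √(1 + a * B))) := by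
    rw [slowDeriv, slowDeriv]
    have : √(1 + a * A) + √(1 + a * B) ≠ 0 := by positivity
    field_simp
    linear_combination sA - sB
  have hpos : 0 < 2 * √(1 + a * A) * √(1 + a * B) * (√(1 + a * A) + √(1 + a * B)) := by positivity
  rw [e, abs_div, abs_mul, abs_mul, abs_of_nonneg h0', abs_of_pos ha, abs_sub_comm A B,
    abs_of_pos hpos, div_le_iff₀ hpos]
  have h2 : 2 ≤ 2 * √(1 + a * A) * √(1 + a * B) * (√(1 + a * A) + √(1 + a * B)) := by
    have : 1 ≤ √(1 + a * A) * √(1 + a * B) := by nlinarith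
    nlinarith
  have h3 : 0 ≤ a * |B - A| := by positivity
  nlinarith [mul_le_mul_of_nonneg_left h2 h3, mul_nonneg h3 h0']

theorem slowDeriv_one {a : ℝ} (ha : 0 < a) : slowDeriv a 1 = 1 / 2 := by
  have : √(1 + a) ≠ 0 := by positivity
  rw [slowDeriv, mul_one]; field_simp

theorem abs_slowDeriv_sub_half_le {a A : ℝ} (ha : 0 < a) (ha1 : a ≤ 1) (hA : 0 < A) (hA' : A < 7) :
    |slowDeriv a A - 1 / 2| ≤ 6 * a := by
  rw [← slowDeriv_one ha]
  refine (abs_slowDeriv_sub_le ha ha1 zero_le_one hA.le).trans ?_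
  have : |A - 1| ≤ 6 := abs_le.2 ⟨by linarith, by linarith⟩
  nlinarith

theorem unifLineBounded_slowDeriv (k : ℕ) :
    UnifLineBounded (Set.Ioc (0 : ℝ) 1) (fun _ => Set.Ioo (4 / 5 : ℝ) 7) (fun _ => (1 : ℝ)) k
      fun a A => (slowDeriv a A : ℂ) := by
  have h1 : UnifLineBounded (Set.Ioc (0 : ℝ) 1) (fun _ => Set.Ioo (4 / 5 : ℝ) 7)
      (fun _ => (1 : ℝ)) k fun a A => ((1 + a * A : ℝ) : ℂ) := by
    have := UnifLineBounded.affine (k := k) (P := Set.Ioc (0 : ℝ) 1)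
      (U := fun _ => Set.Ioo (4 / 5 : ℝ) 7) (ν := fun _ => (1 : ℝ)) (M := 8)
      (fun a : ℝ => a • ContinuousLinearMap.id ℝ ℝ) (fun _ => 1)
      (fun a ha x hx => by
        simp only [smul_apply, ContinuousLinearMap.id_apply, smul_eq_mul, abs_le]
        constructor <;> nlinarith [ha.1, ha.2, hx.1, hx.2])
      (fun a ha => by
        simp only [smul_apply, ContinuousLinearMap.id_apply, smul_eq_mul, abs_le]
        constructor <;> linarith [ha.1, ha.2])
    refine this.congr (fun _ _ => isOpen_Ioo) fun a _ x _ => ?_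
    simp [add_comm]
  have h2 := h1.sqrt (c := 1 / 2) (by norm_num) fun a ha x hx => by nlinarith [ha.1, hx.1]
  have h3 := ((h2.const_mul (M := 2) (fun _ => 2) (by simp)).inv (c := 1) one_pos
    fun a ha x hx => by
      have h0 : 0 ≤ √(1 + a * x) := Real.sqrt_nonneg _
      have := one_le_sqrt_add ha.1.le (A := x) (by linarith [hx.1])
      rw [norm_mul, Complex.norm_real, Real.norm_of_nonneg h0]; norm_num; linarith).const_mul
    (M := 2) (fun a => (√(1 + a) : ℂ)) fun a ha => by
      rw [Complex.norm_real, Real.norm_of_nonneg (Real.sqrt_nonneg _)]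
      linarith [sqrt_one_add_le ha.1.le, ha.2]
  refine h3.congr (fun _ _ => isOpen_Ioo) fun a _ x _ => ?_
  simp [slowDeriv]

theorem unifLineBounded_sqrt (k : ℕ) {ι : Type*} (P : Set ι) :
    UnifLineBounded P (fun _ => Set.Ioo (4 / 5 : ℝ) 7) (fun _ => (1 : ℝ)) k fun _ A => (√A : ℂ) :=
  UnifLineBounded.sqrt (c := 4 / 5) (by norm_num)
    (UnifLineBounded.clm (M := 7) (fun _ => ContinuousLinearMap.id ℝ ℝ)
      (fun _ _ x hx => by
        simp only [ContinuousLinearMap.id_apply, abs_le]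
        constructor <;> linarith [hx.1, hx.2])
      (fun _ _ => by norm_num))
    (fun _ _ x hx => hx.1)

end Slowness

section TangentialPhase

instance : (volume : Measure (ℝ × ℝ)).IsAddHaarMeasure :=
  inferInstanceAs ((volume : Measure ℝ).prod (volume : Measure ℝ)).IsAddHaarMeasure

instance : (volume : Measure (ℝ × ℝ × ℝ)).IsAddHaarMeasure :=
  inferInstanceAs ((volume : Measure ℝ).prod (volume : Measure (ℝ × ℝ))).IsAddHaarMeasure

/-- The parameters of the inner oscillatory integrals. -/
structure WaveParam where
  eta : ℝ
  lam : ℝ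
  a : ℝ
  T : ℝ
  X : ℝ
  Y : ℝ
  N : ℤ

/-- The admissible parameters, with `a ≤ a₀` and `λ ≥ Λ`. -/
def WaveParam.Admissible (a₀ Λ : ℝ) : Set WaveParam :=
  {p | p.eta ∈ Set.Icc (1 / 2 : ℝ) (3 / 2) ∧ Λ ≤ p.lam ∧ 0 < p.a ∧ p.a ≤ a₀ ∧ |p.T| ≤ 5 / 2 ∧
    0 ≤ p.X}

theorem WaveParam.Admissible.mono {a₀ a₁ Λ Λ' : ℝ} (ha : a₀ ≤ a₁) (hΛ : Λ' ≤ Λ) :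
    Admissible a₀ Λ ⊆ Admissible a₁ Λ' :=
  fun _ hp => ⟨hp.1, hΛ.trans hp.2.1, hp.2.2.1, hp.2.2.2.1.trans ha, hp.2.2.2.2⟩

/-- The phase of the tangential waves in the variables `v = (S, Υ, A)`, apart from the reflection
factor. -/
noncomputable def tangPhase (p : WaveParam) (v : ℝ × ℝ × ℝ) : ℝ :=
  p.Y + v.2.1 ^ 3 / 3 + v.2.1 * (p.X - v.2.2) + v.1 ^ 3 / 3 + v.1 * (1 - v.2.2)
    + p.T * slow p.a v.2.2 - 4 / 3 * p.N * v.2.2 ^ ((3 : ℝ) / 2)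

/-- The derivative of `tangPhase p` in the variable `A`. -/
noncomputable def tangSlope (p : WaveParam) (v : ℝ × ℝ × ℝ) : ℝ :=
  -v.1 - v.2.1 + p.T * slowDeriv p.a v.2.2 - 2 * p.N * √v.2.2

/-- The derivative of `tangPhase p` at `v` in the direction `ν`. -/
noncomputable def tangDeriv (p : WaveParam) (v ν : ℝ × ℝ × ℝ) : ℝ :=
  (v.1 ^ 2 + 1 - v.2.2) * ν.1 + (v.2.1 ^ 2 + p.X - v.2.2) * ν.2.1 + tangSlope p v * ν.2.2

theorem hasDerivAt_coord (l : ℝ × ℝ × ℝ →L[ℝ] ℝ) (v ν : ℝ × ℝ × ℝ) :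
    HasDerivAt (fun t : ℝ => l (v + t • ν)) (l ν) 0 := by
  have := l.hasFDerivAt (x := v) |>.hasLineDerivAt ν
  exact this

theorem hasLineDerivAt_tangPhase {p : WaveParam} {v : ℝ × ℝ × ℝ} (ha : 0 < p.a) (hv : 0 < v.2.2)
    (ν : ℝ × ℝ × ℝ) : HasLineDerivAt ℝ (tangPhase p) (tangDeriv p v ν) v ν := by
  have h1 : HasDerivAt (fun t : ℝ => (v + t • ν).1) ν.1 0 :=
    hasDerivAt_coord (ContinuousLinearMap.fst ℝ ℝ (ℝ × ℝ)) v ν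
  have h2 : HasDerivAt (fun t : ℝ => (v + t • ν).2.1) ν.2.1 0 :=
    hasDerivAt_coord ((ContinuousLinearMap.fst ℝ ℝ ℝ).comp (ContinuousLinearMap.snd ℝ ℝ (ℝ × ℝ))) v ν
  have h3 : HasDerivAt (fun t : ℝ => (v + t • ν).2.2) ν.2.2 0 :=
    hasDerivAt_coord ((ContinuousLinearMap.snd ℝ ℝ ℝ).comp (ContinuousLinearMap.snd ℝ ℝ (ℝ × ℝ))) v ν
  have h4 : HasDerivAt (fun t : ℝ => slow p.a (v + t • ν).2.2) (slowDeriv p.a v.2.2 * ν.2.2) 0 := by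
    have := hasDerivAt_slow ha hv
    rw [show v.2.2 = (v + (0 : ℝ) • ν).2.2 by simp] at this
    simpa [Function.comp_def] using this.comp (0 : ℝ) h3
  have h5 : HasDerivAt (fun t : ℝ => (v + t • ν).2.2 ^ ((3 : ℝ) / 2))
      (3 / 2 * √v.2.2 * ν.2.2) 0 := by
    refine (h3.rpow_const (p := (3 : ℝ) / 2) (Or.inr (by norm_num))).congr_deriv ?_
    rw [Real.sqrt_eq_rpow]
    norm_num
    ring
  unfold HasLineDerivAt tangPhase
  refine ((((((h2.pow 3).div_const 3).const_add p.Y).fun_add (h2.fun_mul (h3.const_sub p.X))).fun_add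
    ((h1.pow 3).div_const 3)).fun_add (h1.fun_mul (h3.const_sub 1))).fun_add (h4.const_mul p.T)
    |>.fun_sub (h5.const_mul (4 / 3 * (p.N : ℝ))) |>.congr_deriv ?_
  simp [tangDeriv, tangSlope]
  ring

theorem HasLineDerivAt.comp_add_right {E F : Type*} [NormedAddCommGroup E] [NormedSpace ℝ E]
    [NormedAddCommGroup F] [NormedSpace ℝ F] {f : E → F} {d : F} {v z ν : E}
    (h : HasLineDerivAt ℝ f d (v + z) ν) : HasLineDerivAt ℝ (fun v => f (v + z)) d v ν := by
  unfold HasLineDerivAt at *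
  simpa [add_right_comm] using h

theorem continuousOn_tangPhase {p : WaveParam} (ha : 0 < p.a) :
    ContinuousOn (tangPhase p) {v | 0 < v.2.2} := by
  have h1 : ContinuousOn (fun v : ℝ × ℝ × ℝ => slow p.a v.2.2) {v | 0 < v.2.2} := by
    have : ContinuousOn (slow p.a) (Set.Ioi 0) := fun x hx =>
      (hasDerivAt_slow ha hx).continuousAt.continuousWithinAt
    exact this.comp (by fun_prop) fun v hv => hv
  have h2 : Continuous fun v : ℝ × ℝ × ℝ => v.2.2 ^ ((3 : ℝ) / 2) :=
    (continuous_snd.comp continuous_snd).rpow_const fun _ => Or.inr (by norm_num)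
  have h0 : Continuous fun v : ℝ × ℝ × ℝ => p.Y + v.2.1 ^ 3 / 3 + v.2.1 * (p.X - v.2.2)
    + v.1 ^ 3 / 3 + v.1 * (1 - v.2.2) := by fun_prop
  exact (h0.continuousOn.add (continuousOn_const.mul h1)).sub
    (continuousOn_const.mul h2.continuousOn)

/-- The open box containing the support of the amplitudes. -/
def tangBox : Set (ℝ × ℝ × ℝ) :=
  Set.Ioo (-(31 / 10)) (31 / 10) ×ˢ Set.Ioo (-(31 / 10)) (31 / 10) ×ˢ Set.Ioo (4 / 5) 7

/-- A compact box containing the support of the amplitudes. -/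
def tangCore : Set (ℝ × ℝ × ℝ) := Set.Icc (-3) 3 ×ˢ Set.Icc (-3) 3 ×ˢ Set.Icc (9 / 10) 6

theorem isOpen_tangBox : IsOpen tangBox := isOpen_Ioo.prod (isOpen_Ioo.prod isOpen_Ioo)

theorem isCompact_tangCore : IsCompact tangCore := isCompact_Icc.prod (isCompact_Icc.prod isCompact_Icc)

theorem mem_tangBox {v : ℝ × ℝ × ℝ} :
    v ∈ tangBox ↔ |v.1| < 31 / 10 ∧ |v.2.1| < 31 / 10 ∧ v.2.2 ∈ Set.Ioo (4 / 5 : ℝ) 7 := by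
  simp only [tangBox, Set.mem_prod, abs_lt]; rfl

theorem tangCore_subset_tangBox : tangCore ⊆ tangBox := by
  rintro v ⟨⟨h1, h2⟩, ⟨h3, h4⟩, h5, h6⟩
  exact mem_tangBox.2 ⟨abs_lt.2 ⟨by linarith, by linarith⟩, abs_lt.2 ⟨by linarith, by linarith⟩,
    by linarith, by linarith⟩

/-- The smooth amplitudes in `(S, Υ, A)`. -/
structure IsTangCutoff (χ : ℝ × ℝ × ℝ → ℝ) : Prop where
  contDiff : ContDiff ℝ (⊤ : ℕ∞) χ
  tsupport_subset_core : tsupport χ ⊆ tangCore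

namespace IsTangCutoff

variable {χ : ℝ × ℝ × ℝ → ℝ}

theorem tsupport_subset_box (h : IsTangCutoff χ) : tsupport χ ⊆ tangBox :=
  h.tsupport_subset_core.trans tangCore_subset_tangBox

theorem hasCompactSupport (h : IsTangCutoff χ) : HasCompactSupport χ :=
  isCompact_tangCore.of_isClosed_subset (isClosed_tsupport χ) h.tsupport_subset_core

theorem exists_lineBounded (h : IsTangCutoff χ) (ν : ℝ × ℝ × ℝ) (k : ℕ) :
    ∃ C, LineBounded Set.univ ν k C fun v => (χ v : ℂ) :=
  exists_lineBounded_of_contDiff h.contDiff h.hasCompactSupport ν k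

theorem tsupport_mul_subset (f : ℝ × ℝ × ℝ → ℂ) :
    tsupport (fun v => f v * (χ v : ℂ)) ⊆ tsupport χ :=
  closure_mono fun v hv => by
    simp only [Function.mem_support, ne_eq, mul_eq_zero, not_or, Complex.ofReal_eq_zero] at hv
    exact hv.2

theorem tsupport_ofReal_subset : tsupport (fun v => (χ v : ℂ)) ⊆ tsupport χ := by
  simpa using tsupport_mul_subset (χ := χ) fun _ => 1

theorem of_prod {χ₂ : ℝ × ℝ → ℝ} {ψ₃ : ℝ → ℝ} (hχ₂ : ContDiff ℝ (⊤ : ℕ∞) χ₂)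
    (hχ₂s : tsupport χ₂ ⊆ {p : ℝ × ℝ | |p.1| < 3 ∧ |p.2| < 3})
    (hψ₃ : ContDiff ℝ (⊤ : ℕ∞) ψ₃) (hψ₃s : tsupport ψ₃ ⊆ Set.Icc (9 / 10 : ℝ) 6) :
    IsTangCutoff fun v => χ₂ (v.1, v.2.1) * ψ₃ v.2.2 := by
  have key : tsupport (fun v : ℝ × ℝ × ℝ => χ₂ (v.1, v.2.1) * ψ₃ v.2.2) ⊆
      {v | |v.1| < 3 ∧ |v.2.1| < 3 ∧ v.2.2 ∈ Set.Icc (9 / 10 : ℝ) 6} := by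
    have h1 : tsupport (fun v : ℝ × ℝ × ℝ => χ₂ (v.1, v.2.1) * ψ₃ v.2.2) ⊆
        (fun v => (v.1, v.2.1)) ⁻¹' tsupport χ₂ ∩ (fun v => v.2.2) ⁻¹' tsupport ψ₃ := by
      refine closure_minimal (fun v hv => ?_) (((isClosed_tsupport χ₂).preimage (by fun_prop)).inter
        ((isClosed_tsupport ψ₃).preimage (by fun_prop)))
      simp only [Function.mem_support, ne_eq, mul_eq_zero, not_or] at hv
      exact ⟨subset_tsupport _ hv.1, subset_tsupport _ hv.2⟩
    intro v hv
    have := h1 hv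
    exact ⟨(hχ₂s this.1).1, (hχ₂s this.1).2, hψ₃s this.2⟩
  refine ⟨?_, fun v hv => ?_⟩
  · exact (hχ₂.comp (contDiff_fst.prodMk (contDiff_fst.comp contDiff_snd))).mul
      (hψ₃.comp (contDiff_snd.comp contDiff_snd))
  · obtain ⟨h1, h2, h3⟩ := key hv
    exact ⟨abs_le.1 h1.le, abs_le.1 h2.le, h3⟩

end IsTangCutoff

end TangentialPhase

section LargeIndex

/-- The oscillatory factor `e^{iληφ}` of the tangential waves. -/
noncomputable def tangOsc (p : WaveParam) (v : ℝ × ℝ × ℝ) : ℂ :=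
  cexp (I * (p.lam * p.eta * tangPhase p v : ℝ))

theorem norm_tangOsc (p : WaveParam) (v : ℝ × ℝ × ℝ) : ‖tangOsc p v‖ = 1 := norm_cexp_I_mul _

theorem continuousOn_tangOsc {p : WaveParam} (ha : 0 < p.a) :
    ContinuousOn (tangOsc p) {v | 0 < v.2.2} := by
  have := continuousOn_tangPhase ha
  unfold tangOsc
  fun_prop

theorem hasLineDerivAt_tangOsc {p : WaveParam} {v : ℝ × ℝ × ℝ} (ha : 0 < p.a) (hv : 0 < v.2.2)
    (ν : ℝ × ℝ × ℝ) :
    HasLineDerivAt ℝ (tangOsc p) (I * (p.lam * p.eta * tangDeriv p v ν : ℝ) * tangOsc p v) v ν :=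
  hasLineDerivAt_cexp _ (hasLineDerivAt_tangPhase ha hv ν)

theorem hasLineDerivAt_tangOsc_mul_zpow {p : WaveParam} {v : ℝ × ℝ × ℝ} (ha : 0 < p.a)
    (hv : 0 < v.2.2) {f : ℝ → ℂ} {f' : ℂ} (hf : HasDerivAt f f' v.2.2) (h0 : f v.2.2 ≠ 0) (n : ℤ) :
    HasLineDerivAt ℝ (fun v => tangOsc p v * f v.2.2 ^ n)
      ((I * (p.lam * p.eta * tangSlope p v : ℝ) + n * (f' * (f v.2.2)⁻¹)) *
        (tangOsc p v * f v.2.2 ^ n)) v (0, 0, 1) := by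
  have h1 := hasLineDerivAt_tangOsc ha hv (0, 0, 1)
  have h3 : HasDerivAt (fun t : ℝ => (v + t • ((0, 0, 1) : ℝ × ℝ × ℝ)).2.2) 1 0 :=
    hasDerivAt_coord ((ContinuousLinearMap.snd ℝ ℝ ℝ).comp (ContinuousLinearMap.snd ℝ ℝ (ℝ × ℝ)))
      v (0, 0, 1)
  have e0 : v.2.2 = (v + (0 : ℝ) • ((0, 0, 1) : ℝ × ℝ × ℝ)).2.2 := by simp
  have h4 : HasDerivAt (fun t : ℝ => f (v + t • ((0, 0, 1) : ℝ × ℝ × ℝ)).2.2) f' 0 := by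
    rw [e0] at hf
    simpa [Function.comp_def] using hf.scomp (0 : ℝ) h3
  have h5 : HasDerivAt (fun t : ℝ => f (v + t • ((0, 0, 1) : ℝ × ℝ × ℝ)).2.2 ^ n)
      (n * f v.2.2 ^ (n - 1) * f') 0 := by
    have := (hasDerivAt_zpow n (f v.2.2) (Or.inl h0))
    rw [e0] at this
    simpa [Function.comp_def] using HasDerivAt.comp (0 : ℝ) this h4
  unfold HasLineDerivAt at *
  refine (h1.fun_mul h5).congr_deriv ?_
  have : tangDeriv p v (0, 0, 1) = tangSlope p v := by simp [tangDeriv]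
  rw [this, zpow_sub_one₀ h0]
  simp only [zero_smul, add_zero]
  ring

theorem UnifLineBounded.comp_third {ι : Type*} {P : Set ι} {U : ι → Set (ℝ × ℝ × ℝ)}
    {ν : ι → ℝ × ℝ × ℝ} {k : ℕ} {F : ι → ℝ → ℂ}
    (hF : UnifLineBounded P (fun _ => Set.Ioo (4 / 5 : ℝ) 7) (fun _ => 1) k F)
    (hν : ∀ i ∈ P, |(ν i).2.2| ≤ 1) (hU : ∀ i ∈ P, ∀ v ∈ U i, v.2.2 ∈ Set.Ioo (4 / 5 : ℝ) 7) :
    UnifLineBounded P U ν k fun i v => F i v.2.2 :=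
  hF.comp_coord (M := 7)
    ((ContinuousLinearMap.snd ℝ ℝ ℝ).comp (ContinuousLinearMap.snd ℝ ℝ (ℝ × ℝ)))
    (fun i hi v hv => abs_le.2 ⟨by have := (hU i hi v hv).1; simp; linarith, (hU i hi v hv).2.le⟩)
    (fun i hi => (hν i hi).trans (by norm_num)) fun i hi v hv => hU i hi v hv

theorem abs_slope_ge {σ T g N q : ℝ} (hσ : |σ| ≤ 31 / 5) (hT : |T| ≤ 5 / 2) (hg : |g - 1 / 2| ≤ 6 / 100)
    (hq : 8 / 9 ≤ q) (hN : 5 ≤ |N|) : |N| * (1 / 4) ≤ |-σ + T * g - 2 * N * q| := by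
  have h1 : |T * g| ≤ 5 / 2 * (56 / 100) := by
    rw [abs_mul]
    have : |g| ≤ 56 / 100 := by
      rw [abs_le] at *
      constructor <;> linarith
    gcongr
  have h2 : |2 * N * q| = 2 * |N| * q := by
    rw [abs_mul, abs_mul, abs_of_pos (by linarith : 0 < q)]; norm_num
  have h3 := abs_sub_abs_le_abs_sub (2 * N * q) (-σ + T * g)
  have h4 := abs_add_le (-σ) (T * g)
  rw [abs_neg] at h4
  rw [abs_sub_comm] at h3
  nlinarith

/-- Decay in `N` of the waves with many reflections. -/
theorem exists_bound_of_five_le {R : ℝ → ℝ → ℂ}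
    (hR : ∃ Λ₁ : ℝ, 1 ≤ Λ₁ ∧ UnifLineBounded (Set.Ici Λ₁) (fun _ => Set.Ioo (4 / 5 : ℝ) 7)
      (fun _ => (1 : ℝ)) 3 R) (hR1 : ∀ Λ A, ‖R Λ A‖ = 1)
    {χ : ℝ × ℝ × ℝ → ℝ} (hχ : IsTangCutoff χ) :
    ∃ Λ K : ℝ, 1 ≤ Λ ∧ 0 ≤ K ∧ ∀ p ∈ WaveParam.Admissible (1 / 100) Λ, 5 ≤ |(p.N : ℝ)| →
      ‖∫ v, tangOsc p v * R (p.eta * p.lam) v.2.2 ^ p.N * χ v‖ ≤ K * ((p.lam * |(p.N : ℝ)|)⁻¹) ^ 2 := by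
  obtain ⟨Λ₁, hΛ₁, hR⟩ := hR
  obtain ⟨R', hR', hR'b⟩ := hR.exists_deriv
  have hQ : UnifLineBounded (Set.Ici Λ₁) (fun _ => Set.Ioo (4 / 5 : ℝ) 7) (fun _ => (1 : ℝ)) 2
      fun Λ A => R' Λ A * (R Λ A)⁻¹ :=
    hR'b.mul ((hR.of_le (by norm_num)).inv one_pos fun Λ _ A _ => (hR1 Λ A).ge)
  obtain ⟨M, hM, hQM⟩ := hQ.exists_bound
  set Λ : ℝ := max (2 * Λ₁) (20 * M) with hΛ
  set P : Set WaveParam := {p | p ∈ WaveParam.Admissible (1 / 100) Λ ∧ 5 ≤ |(p.N : ℝ)|} with hP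
  have hΛ1 : 1 ≤ Λ := by rw [hΛ]; exact le_max_of_le_left (by linarith)
  have hmem : ∀ p ∈ P, p.eta * p.lam ∈ Set.Ici Λ₁ := by
    intro p hp
    have h1 : 2 * Λ₁ ≤ p.lam := (le_max_left _ _).trans hp.1.2.1
    have := hp.1.1.1
    rw [Set.mem_Ici]; nlinarith
  set f : WaveParam → ℝ × ℝ × ℝ → ℂ := fun p v =>
    ((p.eta * tangSlope p v / |(p.N : ℝ)| : ℝ) : ℂ) +
      ((-I * (p.N / |(p.N : ℝ)| : ℝ) * (p.lam : ℂ)⁻¹ : ℂ) *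
        (R' (p.eta * p.lam) v.2.2 * (R (p.eta * p.lam) v.2.2)⁻¹)) with hf
  have hNp : ∀ p ∈ P, 0 < |(p.N : ℝ)| := fun p hp => by linarith [hp.2]
  have hη : ∀ p ∈ P, abs (p.eta / |(p.N : ℝ)|) ≤ 1 := by
    intro p hp
    rw [abs_div, abs_abs, div_le_one (hNp p hp), abs_of_pos (by linarith [hp.1.1.1])]
    linarith [hp.1.1.2, hp.2]
  have hsgn : ∀ p ∈ P, ‖((p.N / |(p.N : ℝ)| : ℝ) : ℂ)‖ = 1 := by
    intro p hp
    rw [Complex.norm_real, norm_div, Real.norm_eq_abs, Real.norm_eq_abs, abs_abs,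
      div_self (hNp p hp).ne']
  have hbox : ∀ p ∈ P, ∀ v ∈ (fun _ : WaveParam => tangBox) p, v.2.2 ∈ Set.Ioo (4 / 5 : ℝ) 7 :=
    fun p _ v hv => (mem_tangBox.1 hv).2.2
  have hfb : UnifLineBounded P (fun _ => tangBox) (fun _ => ((0, 0, 1) : ℝ × ℝ × ℝ)) 2 f := by
    have t1 : UnifLineBounded P (fun _ => tangBox) (fun _ => ((0, 0, 1) : ℝ × ℝ × ℝ)) 2
        fun p v => (((-(p.eta / |(p.N : ℝ)|)) • (ContinuousLinearMap.fst ℝ ℝ (ℝ × ℝ) +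
          (ContinuousLinearMap.fst ℝ ℝ ℝ).comp (ContinuousLinearMap.snd ℝ ℝ (ℝ × ℝ))) :
            ℝ × ℝ × ℝ →L[ℝ] ℝ) v : ℂ) := by
      refine UnifLineBounded.clm (M := 31 / 5) _ (fun p hp v hv => ?_) fun p hp => by norm_num
      have := mem_tangBox.1 hv
      have h2 : |v.1 + v.2.1| ≤ 31 / 5 := (abs_add_le _ _).trans (by linarith [this.1, this.2.1])
      simp only [smul_apply, smul_eq_mul, abs_mul, abs_neg]
      calc abs (p.eta / |(p.N : ℝ)|) * |v.1 + v.2.1| ≤ 1 * (31 / 5) :=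
            mul_le_mul (hη p hp) h2 (abs_nonneg _) zero_le_one
        _ = 31 / 5 := one_mul _
    have t2 := (((unifLineBounded_slowDeriv 2).reparam (P' := P) (fun p => p.a)
      fun p hp => ⟨hp.1.2.2.1, hp.1.2.2.2.1.trans (by norm_num)⟩).comp_third
        (U := fun _ => tangBox) (ν := fun _ => ((0, 0, 1) : ℝ × ℝ × ℝ)) (by simp) hbox).const_mul
          (M := 5 / 2) (fun p => ((p.eta / |(p.N : ℝ)| * p.T : ℝ) : ℂ)) fun p hp => by
            rw [Complex.norm_real, norm_mul, Real.norm_eq_abs, Real.norm_eq_abs]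
            calc _ ≤ 1 * (5 / 2) := mul_le_mul (hη p hp) hp.1.2.2.2.2.1 (abs_nonneg _) zero_le_one
              _ = 5 / 2 := one_mul _
    have t3 := ((unifLineBounded_sqrt 2 P).comp_third
        (U := fun _ => tangBox) (ν := fun _ => ((0, 0, 1) : ℝ × ℝ × ℝ)) (by simp) hbox).const_mul
          (M := 3) (fun p => ((2 * p.eta * (p.N / |(p.N : ℝ)|) : ℝ) : ℂ)) fun p hp => by
            rw [Complex.ofReal_mul, norm_mul, hsgn p hp, mul_one, Complex.norm_real, norm_mul,
              Real.norm_of_nonneg (by linarith [hp.1.1.1] : 0 ≤ p.eta)]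
            norm_num; linarith [hp.1.1.2]
    have t4 := ((hQ.reparam (P' := P) (fun p => p.eta * p.lam) hmem).comp_third
        (U := fun _ => tangBox) (ν := fun _ => ((0, 0, 1) : ℝ × ℝ × ℝ)) (by simp) hbox).const_mul
          (M := 1) (fun p => (-I * (p.N / |(p.N : ℝ)| : ℝ) * (p.lam : ℂ)⁻¹ : ℂ)) fun p hp => by
            rw [norm_mul, norm_mul, hsgn p hp, norm_neg, Complex.norm_I, norm_inv,
              Complex.norm_real, one_mul, one_mul]
            refine inv_le_one_of_one_le₀ ?_
            rw [Real.norm_eq_abs]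
            exact (hΛ1.trans hp.1.2.1).trans (le_abs_self _)
    refine (((t1.add t2).sub t3).add t4).congr (fun _ _ => isOpen_tangBox) fun p hp v hv => ?_
    simp only [hf, tangSlope, smul_apply, add_apply, ContinuousLinearMap.comp_apply,
      ContinuousLinearMap.coe_fst', ContinuousLinearMap.coe_snd', smul_eq_mul]
    push_cast
    ring
  obtain ⟨C₁, hC₁, hfC⟩ := hfb
  obtain ⟨C₂, hC₂⟩ := hχ.exists_lineBounded (0, 0, 1) 2
  obtain ⟨K, hK, hKb⟩ := exists_nonstationary_bound (volume : Measure (ℝ × ℝ × ℝ)) 2 (max C₁ C₂)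
    (volume.real tangCore) (c := 1 / 20) (by norm_num) measureReal_nonneg
  refine ⟨Λ, K, hΛ1, hK, fun p hp hN => ?_⟩
  have hpP : p ∈ P := ⟨hp, hN⟩
  have hN0 := hNp p hpP
  have hl : 0 < p.lam := by linarith [hp.2.1]
  refine hKb tangBox tangCore (0, 0, 1) (fun v => tangOsc p v * R (p.eta * p.lam) v.2.2 ^ p.N) (f p)
    (fun v => χ v) (p.lam * |(p.N : ℝ)|) (by positivity) isOpen_tangBox ?_ ?_ ?_
    ((hfC p hpP).mono (le_max_left _ _)) ?_
    ((hC₂.mono_set (Set.subset_univ _)).mono (le_max_right _ _)) isCompact_tangCore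
    (IsTangCutoff.tsupport_ofReal_subset.trans hχ.tsupport_subset_box)
    (IsTangCutoff.tsupport_ofReal_subset.trans hχ.tsupport_subset_core) le_rfl
  · refine ((continuousOn_tangOsc hp.2.2.1).mono fun v hv => ?_).mul (ContinuousOn.zpow₀ ?_ _ ?_)
    · have := (mem_tangBox.1 hv).2.2.1
      simp only [Set.mem_ofPred_eq]; linarith
    · exact (hR.continuousOn (hmem p hpP)).comp (by fun_prop) fun v hv => (mem_tangBox.1 hv).2.2
    · intro v _
      refine Or.inl fun h => ?_
      have := hR1 (p.eta * p.lam) v.2.2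
      rw [h, norm_zero] at this
      exact zero_ne_one this
  · intro v _
    rw [norm_mul, norm_tangOsc, norm_zpow, hR1]; simp
  · intro v hv
    have hv' := (mem_tangBox.1 hv).2.2
    have h0 : R (p.eta * p.lam) v.2.2 ≠ 0 := fun h => by
      have := hR1 (p.eta * p.lam) v.2.2
      rw [h, norm_zero] at this
      exact zero_ne_one this
    have := hasLineDerivAt_tangOsc_mul_zpow hp.2.2.1 (by linarith [hv'.1] : 0 < v.2.2)
      (hasLineDerivAt_one_iff.1 (hR' _ (hmem p hpP) _ hv')) h0 p.N
    have e : I * ((p.lam * |(p.N : ℝ)| : ℝ) : ℂ) * f p v =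
        I * (p.lam * p.eta * tangSlope p v : ℝ) +
          p.N * (R' (p.eta * p.lam) v.2.2 * (R (p.eta * p.lam) v.2.2)⁻¹) := by
      have e1 : (p.lam : ℂ) ≠ 0 := by exact_mod_cast hl.ne'
      have e2 : ((|(p.N : ℝ)| : ℝ) : ℂ) ≠ 0 := by exact_mod_cast hN0.ne'
      simp only [hf]
      push_cast
      field_simp
      linear_combination (-(p.N : ℂ) * R' (p.eta * p.lam) v.2.2) * Complex.I_sq
    rw [e]
    exact this
  · intro v hv
    have hv' := mem_tangBox.1 hv
    have hA := hv'.2.2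
    have hq : 8 / 9 ≤ √v.2.2 := Real.le_sqrt_of_sq_le (by linarith [hA.1])
    have hg := abs_slowDeriv_sub_half_le hp.2.2.1 (hp.2.2.2.1.trans (by norm_num))
      (by linarith [hA.1]) hA.2
    have h1 := abs_slope_ge (σ := v.1 + v.2.1) (T := p.T) (g := slowDeriv p.a v.2.2) (N := p.N)
      ((abs_add_le _ _).trans (by linarith [hv'.1, hv'.2.1])) hp.2.2.2.2.1
      (hg.trans (by linarith [hp.2.2.2.1])) hq hN
    have e1 : tangSlope p v = -(v.1 + v.2.1) + p.T * slowDeriv p.a v.2.2 - 2 * p.N * √v.2.2 := by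
      rw [tangSlope]; ring
    rw [← e1] at h1
    have h2 : 1 / 8 ≤ ‖((p.eta * tangSlope p v / |(p.N : ℝ)| : ℝ) : ℂ)‖ := by
      rw [Complex.norm_real, Real.norm_eq_abs, abs_div, abs_abs, abs_mul, le_div_iff₀ hN0,
        abs_of_pos (by linarith [hp.1.1] : 0 < p.eta)]
      nlinarith [hp.1.1]
    have h3 : ‖(-I * (p.N / |(p.N : ℝ)| : ℝ) * (p.lam : ℂ)⁻¹ : ℂ) *
        (R' (p.eta * p.lam) v.2.2 * (R (p.eta * p.lam) v.2.2)⁻¹)‖ ≤ 1 / 20 := by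
      rw [norm_mul, norm_mul, norm_mul, hsgn p hpP, norm_neg, Complex.norm_I, norm_inv,
        Complex.norm_real, one_mul, one_mul, Real.norm_of_nonneg hl.le]
      have h4 := hQM _ (hmem p hpP) _ hA
      have h5 : 20 * M ≤ p.lam := (le_max_right _ _).trans hp.2.1
      rw [inv_mul_le_iff₀ hl]
      linarith
    have h4 := norm_sub_le_norm_add ((p.eta * tangSlope p v / |(p.N : ℝ)| : ℝ) : ℂ)
      ((-I * (p.N / |(p.N : ℝ)| : ℝ) * (p.lam : ℂ)⁻¹ : ℂ) *
        (R' (p.eta * p.lam) v.2.2 * (R (p.eta * p.lam) v.2.2)⁻¹))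
    simp only [hf]
    linarith

end LargeIndex

section Nondegeneracy

theorem false_of_reflected_critical {N : ℤ} (hN : N ≠ 0) {S Y X q τ : ℝ} (hX : 0 ≤ X) (hq : 0 < q)
    (hτ : |τ| ≤ 3 / 2) (h1 : S ^ 2 + 1 - q ^ 2 = 0) (h2 : Y ^ 2 + X - q ^ 2 = 0)
    (h3 : τ - S - Y - 2 * N * q = 0) (h4 : 4 * N * S * Y + 2 * (S + Y) * q = 0) : False := by
  obtain ⟨hτ1, hτ2⟩ := abs_le.1 hτ
  have hq1 : 1 ≤ q := by nlinarith [sq_nonneg S]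
  have hS : |S| < q := abs_lt_of_sq_lt_sq (by linarith) hq.le
  have hY : |Y| ≤ q := abs_le_of_sq_le_sq (by linarith) hq.le
  obtain ⟨hS1, hS2⟩ := abs_lt.1 hS
  obtain ⟨hY1, hY2⟩ := abs_le.1 hY
  have key : ∀ s u : ℝ, s < q → -q < s → u ≤ q → -q ≤ u → 2 * s * u + (s + u) * q = 0 →
      0 ≤ s + u := by
    intro s u hs hs' hu hu' h
    by_contra! hc
    have h5 : 0 < s * u := by nlinarith
    rcases lt_or_ge s 0 with h6 | h6
    · have h7 : u < 0 := by by_contra! h8; nlinarith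
      nlinarith
    · nlinarith
  rcases lt_trichotomy N 0 with h | h | h
  · rcases (by omega : N = -1 ∨ N ≤ -2) with h5 | h5
    · subst h5
      push_cast at *
      have := key (-S) (-Y) (by linarith) (by linarith) (by linarith) (by linarith) (by linarith)
      linarith
    · have : (N : ℝ) ≤ -2 := by exact_mod_cast h5
      nlinarith
  · exact hN h
  · rcases (by omega : N = 1 ∨ 2 ≤ N) with h5 | h5
    · subst h5
      push_cast at *
      have := key S Y (by linarith) (by linarith) (by linarith) (by linarith) (by linarith)
      linarith
    · have : (2 : ℝ) ≤ N := by exact_mod_cast h5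
      nlinarith

theorem exists_reflected_lower_bound {N : ℤ} (hN : N ≠ 0) : ∃ c : ℝ, 0 < c ∧ c ≤ 1 ∧
    ∀ S Y A X τ : ℝ, |S| ≤ 31 / 10 → |Y| ≤ 31 / 10 → A ∈ Set.Icc (4 / 5 : ℝ) 7 → 0 ≤ X →
      |τ| ≤ 3 / 2 → c ≤ |S ^ 2 + 1 - A| ∨ c ≤ |Y ^ 2 + X - A| ∨ c ≤ |τ - S - Y - 2 * N * √A| ∨
        c ≤ |4 * N * S * Y + 2 * (S + Y) * √A| := by
  set K : Set (ℝ × ℝ × ℝ × ℝ × ℝ) := Set.Icc (-(31 / 10)) (31 / 10) ×ˢ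
    Set.Icc (-(31 / 10)) (31 / 10) ×ˢ Set.Icc (4 / 5) 7 ×ˢ Set.Icc 0 25 ×ˢ Set.Icc (-(3 / 2)) (3 / 2)
    with hK
  have hKc : IsCompact K := isCompact_Icc.prod
    (isCompact_Icc.prod (isCompact_Icc.prod (isCompact_Icc.prod isCompact_Icc)))
  set F : ℝ × ℝ × ℝ × ℝ × ℝ → ℝ := fun v => |v.1 ^ 2 + 1 - v.2.2.1| +
    |v.2.1 ^ 2 + v.2.2.2.1 - v.2.2.1| + |v.2.2.2.2 - v.1 - v.2.1 - 2 * N * √v.2.2.1| +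
    |4 * N * v.1 * v.2.1 + 2 * (v.1 + v.2.1) * √v.2.2.1| with hF
  have hFc : Continuous F := by fun_prop
  have hne : K.Nonempty := ⟨(0, 0, 1, 0, 0), by norm_num [hK]⟩
  obtain ⟨v₀, hv₀, hmin⟩ := hKc.exists_isMinOn hne hFc.continuousOn
  have hpos : 0 < F v₀ := by
    obtain ⟨h1, h2, h3, h4, h5⟩ := hv₀
    by_contra! hle
    have n1 := abs_nonneg (v₀.1 ^ 2 + 1 - v₀.2.2.1)
    have n2 := abs_nonneg (v₀.2.1 ^ 2 + v₀.2.2.2.1 - v₀.2.2.1)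
    have n3 := abs_nonneg (v₀.2.2.2.2 - v₀.1 - v₀.2.1 - 2 * N * √v₀.2.2.1)
    have n4 := abs_nonneg (4 * N * v₀.1 * v₀.2.1 + 2 * (v₀.1 + v₀.2.1) * √v₀.2.2.1)
    simp only [hF] at hle
    have hA : 0 < v₀.2.2.1 := by linarith [h3.1]
    have hs := Real.sq_sqrt hA.le
    refine false_of_reflected_critical hN (S := v₀.1) (Y := v₀.2.1) (X := v₀.2.2.2.1)
      (q := √v₀.2.2.1) (τ := v₀.2.2.2.2) h4.1 (Real.sqrt_pos.2 hA) (abs_le.2 h5) ?_ ?_ ?_ ?_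
    · rw [hs]; exact abs_eq_zero.1 (by linarith)
    · rw [hs]; exact abs_eq_zero.1 (by linarith)
    · exact abs_eq_zero.1 (by linarith)
    · exact abs_eq_zero.1 (by linarith)
  refine ⟨min 1 (F v₀ / 4), by positivity, min_le_left _ _, fun S Y A X τ hS hY hA hX hτ => ?_⟩
  rcases le_or_gt X 25 with h | h
  · have := hmin (show (S, Y, A, X, τ) ∈ K from ⟨abs_le.1 hS, abs_le.1 hY, hA, ⟨hX, h⟩, abs_le.1 hτ⟩)
    simp only [Set.mem_ofPred_eq] at this
    have h1 : F (S, Y, A, X, τ) = |S ^ 2 + 1 - A| + |Y ^ 2 + X - A| + |τ - S - Y - 2 * N * √A| +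
      |4 * N * S * Y + 2 * (S + Y) * √A| := rfl
    have h2 : min 1 (F v₀ / 4) ≤ F v₀ / 4 := min_le_right _ _
    by_contra! hcon
    obtain ⟨c1, c2, c3, c4⟩ := hcon
    linarith
  · right; left
    refine (min_le_left _ _).trans ?_
    rw [abs_of_pos] <;> nlinarith [hA.2, sq_nonneg Y]

/-- A quantitative form of the invertibility of the Hessian of the reflected phases. -/
theorem exists_le_abs_hessian {S Y h c M x ζ y : ℝ} (hS : |S| ≤ 31 / 10) (hY : |Y| ≤ 31 / 10)
    (hh : |h| ≤ M) (hM : 1 ≤ M) (hc : c ≤ |4 * S * Y * h - 2 * S - 2 * Y|) {r : ℝ} (hr : 0 ≤ r)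
    (h1 : |2 * S * x - y| ≤ r) (h2 : |2 * Y * ζ - y| ≤ r) (h3 : |-x - ζ + h * y| ≤ r) :
    c * max |x| (max |ζ| |y|) ≤ 60 * M * r := by
  set α := 4 * S * Y * h - 2 * S - 2 * Y with hα
  have hMr : r ≤ M * r := le_mul_of_one_le_left hr hM
  have ey : α * y = 4 * (S * (Y * (-x - ζ + h * y))) + 2 * (Y * (2 * S * x - y))
      + 2 * (S * (2 * Y * ζ - y)) := by rw [hα]; ring
  have ex : α * x = 2 * (Y * (h * (2 * S * x - y))) - (2 * S * x - y) + (2 * Y * ζ - y)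
      + 2 * (Y * (-x - ζ + h * y)) := by rw [hα]; ring
  have eζ : α * ζ = (2 * S * x - y) + 2 * (S * (h * (2 * Y * ζ - y))) - (2 * Y * ζ - y)
      + 2 * (S * (-x - ζ + h * y)) := by rw [hα]; ring
  set e1 := 2 * S * x - y
  set e2 := 2 * Y * ζ - y
  set e3 := -x - ζ + h * y
  have B : ∀ {s e t : ℝ}, |s| ≤ 31 / 10 → |e| ≤ t → |s * e| ≤ 31 / 10 * t := by
    intro s e t hs he
    rw [abs_mul]
    exact mul_le_mul hs he (abs_nonneg _) (by norm_num)
  have Bh : ∀ {e : ℝ}, |e| ≤ r → |h * e| ≤ M * r := by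
    intro e he
    rw [abs_mul]
    exact mul_le_mul hh he (abs_nonneg _) (by linarith)
  have by1 := abs_le.1 (B hS (B hY h3))
  have by2 := abs_le.1 (B hY h1)
  have by3 := abs_le.1 (B hS h2)
  have bx1 := abs_le.1 (B hY (Bh h1))
  have bx2 := abs_le.1 (B hY h3)
  have bz1 := abs_le.1 (B hS (Bh h2))
  have bz2 := abs_le.1 (B hS h3)
  have a1 := abs_le.1 h1
  have a2 := abs_le.1 h2
  have hy : |α * y| ≤ 60 * M * r := abs_le.2 ⟨by rw [ey]; linarith, by rw [ey]; linarith⟩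
  have hx : |α * x| ≤ 60 * M * r := abs_le.2 ⟨by rw [ex]; linarith, by rw [ex]; linarith⟩
  have hζ : |α * ζ| ≤ 60 * M * r := abs_le.2 ⟨by rw [eζ]; linarith, by rw [eζ]; linarith⟩
  rw [abs_mul] at hx hy hζ
  have hm : 0 ≤ max |x| (max |ζ| |y|) := (abs_nonneg x).trans (le_max_left _ _)
  refine (mul_le_mul_of_nonneg_right hc hm).trans ?_
  rcases max_choice |x| (max |ζ| |y|) with h | h
  · rwa [h]
  · rw [h]
    rcases max_choice |ζ| |y| with h | h
    · rwa [h]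
    · rwa [h]

end Nondegeneracy

section Localization

variable {E : Type*} [NormedAddCommGroup E] [NormedSpace ℝ E] [FiniteDimensional ℝ E]
  [MeasurableSpace E] [BorelSpace E]

/-- Integrals of functions supported in `B` are controlled by their localizations at scale `δ`. -/
theorem exists_localization (μ : Measure E) [μ.IsAddHaarMeasure] {δ : ℝ} (hδ : 0 < δ) {B W : Set E}
    (hBW : ∀ v ∈ B, Metric.ball v δ ⊆ W) (hW : μ W ≠ ⊤) :
    ∃ ρ : E → ℝ, ContDiff ℝ (⊤ : ℕ∞) ρ ∧ HasCompactSupport ρ ∧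
      (∀ w, tsupport (fun v => ρ (v - w)) ⊆ Metric.closedBall w δ) ∧
      ∀ (G : E → ℂ) (M : ℝ), 0 ≤ M → Integrable G μ → (∀ v, v ∉ B → G v = 0) →
        (∀ w ∈ W, ‖∫ v, G v * ρ (v - w) ∂μ‖ ≤ M) → ‖∫ v, G v ∂μ‖ ≤ M * μ.real W := by
  let b : ContDiffBump (0 : E) := ⟨δ / 2, δ, by positivity, by linarith⟩
  have hsupp : ∀ w v, b.normed μ (v - w) ≠ 0 → v ∈ Metric.ball w δ := by
    intro w v h
    have h1 : v - w ∈ Function.support (b.normed μ) := h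
    rw [b.support_normed_eq, Metric.mem_ball, dist_zero_right] at h1
    rwa [Metric.mem_ball, dist_eq_norm]
  refine ⟨b.normed μ, b.contDiff_normed, b.hasCompactSupport_normed, fun w => ?_, ?_⟩
  · exact closure_minimal (fun v hv => Metric.ball_subset_closedBall (hsupp w v hv))
      Metric.isClosed_closedBall
  · intro G M hM hG hGB hloc
    have hρ : Integrable (fun v => (b.normed μ v : ℂ)) μ := (b.integrable_normed (μ := μ)).ofReal
    have h1 := integral_convolution (𝕜 := ℝ) (ContinuousLinearMap.mul ℝ ℂ) hG hρ
    rw [integral_complex_ofReal, b.integral_normed, ContinuousLinearMap.mul_apply',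
      Complex.ofReal_one, mul_one] at h1
    rw [← h1]
    have h2 : ∀ w, convolution G (fun v => (b.normed μ v : ℂ)) (ContinuousLinearMap.mul ℝ ℂ) μ w
        = ∫ v, G v * (b.normed μ (v - w) : ℝ) ∂μ := by
      intro w
      rw [convolution_def]
      simp only [ContinuousLinearMap.mul_apply']
      congr with v
      rw [← b.normed_neg, neg_sub]
    have h3 : ∀ w, w ∉ W → ∫ v, G v * (b.normed μ (v - w) : ℝ) ∂μ = 0 := by
      intro w hw
      refine integral_eq_zero_of_ae (Filter.Eventually.of_forall fun v => ?_)
      by_cases hv : v ∈ B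
      · have : b.normed μ (v - w) = 0 := by
          by_contra h
          exact hw (hBW v hv (Metric.mem_ball_comm.1 (hsupp w v h)))
        simp [this]
      · simp [hGB v hv]
    refine norm_integral_le_of_tsupport_subset μ hW (fun w => ?_) fun w hw => ?_
    · rw [h2]
      by_cases hw : w ∈ W
      · exact hloc w hw
      · rw [h3 w hw, norm_zero]; exact hM
    · rw [h2, h3 w hw]

end Localization

section TangentialDerivatives

/-- The coordinate `S`. -/
noncomputable def coordS : ℝ × ℝ × ℝ →L[ℝ] ℝ := ContinuousLinearMap.fst ℝ ℝ (ℝ × ℝ)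

/-- The coordinate `Υ`. -/
noncomputable def coordU : ℝ × ℝ × ℝ →L[ℝ] ℝ :=
  (ContinuousLinearMap.fst ℝ ℝ ℝ).comp (ContinuousLinearMap.snd ℝ ℝ (ℝ × ℝ))

/-- The coordinate `A`. -/
noncomputable def coordA : ℝ × ℝ × ℝ →L[ℝ] ℝ :=
  (ContinuousLinearMap.snd ℝ ℝ ℝ).comp (ContinuousLinearMap.snd ℝ ℝ (ℝ × ℝ))

@[simp] theorem coordS_apply (v : ℝ × ℝ × ℝ) : coordS v = v.1 := rfl
@[simp] theorem coordU_apply (v : ℝ × ℝ × ℝ) : coordU v = v.2.1 := rfl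
@[simp] theorem coordA_apply (v : ℝ × ℝ × ℝ) : coordA v = v.2.2 := rfl

/-- The coordinate directions. -/
def tangDirs : Set (ℝ × ℝ × ℝ) := {(1, 0, 0), (0, 1, 0), (0, 0, 1)}

theorem finite_tangDirs : tangDirs.Finite := by simp [tangDirs]

theorem abs_le_one_of_mem_tangDirs {ν : ℝ × ℝ × ℝ} (h : ν ∈ tangDirs) :
    |ν.1| ≤ 1 ∧ |ν.2.1| ≤ 1 ∧ |ν.2.2| ≤ 1 := by
  rcases h with rfl | rfl | rfl <;> simp

theorem Set.Finite.exists_uniform_bound {α : Type*} {s : Set α} (hs : s.Finite) {Q : α → ℝ → Prop}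
    (hQ : ∀ i ∈ s, ∀ C D, C ≤ D → Q i C → Q i D) (h : ∀ i ∈ s, ∃ C, Q i C) :
    ∃ C, 0 ≤ C ∧ ∀ i ∈ s, Q i C := by
  induction s, hs using Set.Finite.induction_on with
  | empty => exact ⟨0, le_rfl, by simp⟩
  | @insert i s _ _ ih =>
    obtain ⟨C, hC, hCs⟩ := ih (fun i hi => hQ i (Set.mem_insert_of_mem _ hi))
      fun i hi => h i (Set.mem_insert_of_mem _ hi)
    obtain ⟨D, hD⟩ := h i (Set.mem_insert _ _)
    refine ⟨max C D, le_max_of_le_left hC, fun j hj => ?_⟩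
    have hQ' := hQ j hj
    rcases hj with rfl | hj
    · exact hQ' _ _ (le_max_right _ _) hD
    · exact hQ' _ _ (le_max_left _ _) (hCs j hj)

theorem abs_coord_le_norm (z : ℝ × ℝ × ℝ) : |z.1| ≤ ‖z‖ ∧ |z.2.1| ≤ ‖z‖ ∧ |z.2.2| ≤ ‖z‖ :=
  ⟨norm_fst_le z, (norm_fst_le z.2).trans (norm_snd_le z), (norm_snd_le z.2).trans (norm_snd_le z)⟩

theorem norm_eq_max_coord (z : ℝ × ℝ × ℝ) : ‖z‖ = max |z.1| (max |z.2.1| |z.2.2|) := rfl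

theorem abs_sub_le_of_abs_le {x y M M' : ℝ} (hx : |x| ≤ M) (hy : |y| ≤ M') : |x - y| ≤ M + M' :=
  (abs_sub x y).trans (add_le_add hx hy)

theorem tangDeriv_add_sub (p : WaveParam) (v z ν : ℝ × ℝ × ℝ) :
    tangDeriv p (v + z) ν - tangDeriv p v ν =
      (z.1 * (v.1 + (v + z).1) - z.2.2) * ν.1 + (z.2.1 * (v.2.1 + (v + z).2.1) - z.2.2) * ν.2.1
      + (-z.1 - z.2.1 + p.T * (slowDeriv p.a (v.2.2 + z.2.2) - slowDeriv p.a v.2.2)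
        - 2 * p.N * (√(v.2.2 + z.2.2) - √v.2.2)) * ν.2.2 := by
  simp only [tangDeriv, tangSlope, Prod.fst_add, Prod.snd_add]
  ring

theorem abs_sqrt_sub_sqrt_le {A B : ℝ} (hA : 4 / 5 ≤ A) (hB : 4 / 5 ≤ B) : |√A - √B| ≤ |A - B| := by
  have hA1 : 4 / 5 ≤ √A := Real.le_sqrt_of_sq_le (by linarith)
  have hB1 : 4 / 5 ≤ √B := Real.le_sqrt_of_sq_le (by linarith)
  have h : A - B = (√A - √B) * (√A + √B) := by
    linear_combination -(Real.sq_sqrt (by linarith : (0:ℝ) ≤ A)) + Real.sq_sqrt (by linarith : (0:ℝ) ≤ B)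
  rw [h, abs_mul, abs_of_pos (by linarith : 0 < √A + √B)]
  exact le_mul_of_one_le_right (abs_nonneg _) (by linarith)

/-- The derivatives of the tangential phase are Lipschitz, uniformly for bounded `N`. -/
theorem abs_tangDeriv_add_sub_le {p : WaveParam} (ha : 0 < p.a) (ha1 : p.a ≤ 1) (hT : |p.T| ≤ 5 / 2)
    {v z ν : ℝ × ℝ × ℝ} (hv : v ∈ tangBox) (hvz : v + z ∈ tangBox) (hν : ν ∈ tangDirs) :
    |tangDeriv p (v + z) ν - tangDeriv p v ν| ≤ (10 + 2 * |(p.N : ℝ)|) * ‖z‖ := by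
  obtain ⟨h1, h2, h3⟩ := abs_coord_le_norm z
  obtain ⟨a1, a2, a3⟩ := mem_tangBox.1 hv
  obtain ⟨b1, b2, b3⟩ := mem_tangBox.1 hvz
  have hz := norm_nonneg z
  have hN := abs_nonneg (p.N : ℝ)
  have key : ∀ x s s' : ℝ, |x| ≤ ‖z‖ → |s| < 31 / 10 → |s'| < 31 / 10 →
      |x * (s + s') - z.2.2| ≤ (10 + 2 * |(p.N : ℝ)|) * ‖z‖ := by
    intro x s s' hx hs hs'
    have : |x * (s + s')| ≤ ‖z‖ * (31 / 5) := by
      rw [abs_mul]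
      exact mul_le_mul hx ((abs_add_le _ _).trans (by linarith)) (abs_nonneg _) hz
    have := abs_sub (x * (s + s')) z.2.2
    nlinarith [mul_nonneg hN hz]
  rw [tangDeriv_add_sub]
  rcases hν with rfl | rfl | rfl
  · simpa using key z.1 v.1 (v + z).1 h1 a1 b1
  · simpa using key z.2.1 v.2.1 (v + z).2.1 h2 a2 b2
  · have hA := a3.1
    have hB : 4 / 5 < v.2.2 + z.2.2 := b3.1
    have g1 := abs_slowDeriv_sub_le ha ha1 (by linarith : 0 ≤ v.2.2) (by linarith : 0 ≤ v.2.2 + z.2.2)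
    have g2 := abs_sqrt_sub_sqrt_le hB.le hA.le
    rw [add_sub_cancel_left] at g1 g2
    have g3 : |p.T * (slowDeriv p.a (v.2.2 + z.2.2) - slowDeriv p.a v.2.2)| ≤ 5 / 2 * ‖z‖ := by
      rw [abs_mul]
      refine mul_le_mul hT (g1.trans ?_) (abs_nonneg _) (by norm_num)
      nlinarith [abs_nonneg z.2.2]
    have g4 : |2 * (p.N : ℝ) * (√(v.2.2 + z.2.2) - √v.2.2)| ≤ 2 * |(p.N : ℝ)| * ‖z‖ := by
      rw [abs_mul, abs_mul, abs_of_pos (by norm_num : (0 : ℝ) < 2)]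
      exact mul_le_mul_of_nonneg_left (g2.trans h3) (by positivity)
    simp only [mul_zero, zero_add, mul_one]
    rw [abs_le] at *
    constructor <;> linarith

theorem exists_lineBounded_tangDeriv_sub (k : ℕ) (N : ℤ) :
    ∃ C, ∀ p ∈ WaveParam.Admissible 1 0, p.N = N → ∀ w ∈ tangBox, ∀ ν ∈ tangDirs,
      LineBounded tangBox ν k C fun v => ((tangDeriv p v ν - tangDeriv p w ν : ℝ) : ℂ) := by
  set P : Set (WaveParam × (ℝ × ℝ × ℝ) × (ℝ × ℝ × ℝ)) :=
    {q | q.1 ∈ WaveParam.Admissible 1 0 ∧ q.1.N = N ∧ q.2.1 ∈ tangBox ∧ q.2.2 ∈ tangDirs}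
  have hν : ∀ q ∈ P, |q.2.2.1| ≤ 1 ∧ |q.2.2.2.1| ≤ 1 ∧ |q.2.2.2.2| ≤ 1 :=
    fun q hq => abs_le_one_of_mem_tangDirs hq.2.2.2
  have hbox : ∀ q ∈ P, ∀ v ∈ (fun _ : WaveParam × (ℝ × ℝ × ℝ) × (ℝ × ℝ × ℝ) => tangBox) q,
      v.2.2 ∈ Set.Ioo (4 / 5 : ℝ) 7 := fun _ _ v hv => (mem_tangBox.1 hv).2.2
  have cS : UnifLineBounded P (fun _ => tangBox) (fun q => q.2.2) k fun _ v => ((coordS v : ℝ) : ℂ) :=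
    UnifLineBounded.clm (M := 4) (fun _ => coordS)
      (fun q hq v hv => by simpa using (mem_tangBox.1 hv).1.le.trans (by norm_num))
      fun q hq => (hν q hq).1.trans (by norm_num)
  have cU : UnifLineBounded P (fun _ => tangBox) (fun q => q.2.2) k fun _ v => ((coordU v : ℝ) : ℂ) :=
    UnifLineBounded.clm (M := 4) (fun _ => coordU)
      (fun q hq v hv => by simpa using (mem_tangBox.1 hv).2.1.le.trans (by norm_num))
      fun q hq => (hν q hq).2.1.trans (by norm_num)
  have cA : UnifLineBounded P (fun _ => tangBox) (fun q => q.2.2) k fun _ v => ((coordA v : ℝ) : ℂ) :=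
    UnifLineBounded.clm (M := 7) (fun _ => coordA)
      (fun q hq v hv => abs_le.2 ⟨by have := (hbox q hq v hv).1; simp; linarith, (hbox q hq v hv).2.le⟩)
      fun q hq => (hν q hq).2.2.trans (by norm_num)
  have cg := ((unifLineBounded_slowDeriv k).reparam (P' := P) (fun q => q.1.a)
      fun q hq => ⟨hq.1.2.2.1, hq.1.2.2.2.1⟩).comp_third
        (U := fun _ => tangBox) (ν := fun q => q.2.2) (fun q hq => (hν q hq).2.2) hbox
  have cq := (unifLineBounded_sqrt k P).comp_third
        (U := fun _ => tangBox) (ν := fun q => q.2.2) (fun q hq => (hν q hq).2.2) hbox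
  have n1 : ∀ q ∈ P, ‖(q.2.2.1 : ℂ)‖ ≤ 1 := fun q hq => by rw [Complex.norm_real]; exact (hν q hq).1
  have n2 : ∀ q ∈ P, ‖(q.2.2.2.1 : ℂ)‖ ≤ 1 := fun q hq => by
    rw [Complex.norm_real]; exact (hν q hq).2.1
  have n3 : ∀ q ∈ P, ‖(q.2.2.2.2 : ℂ)‖ ≤ 1 := fun q hq => by
    rw [Complex.norm_real]; exact (hν q hq).2.2
  have nT : ∀ q ∈ P, ‖(q.1.T : ℂ)‖ ≤ 5 / 2 := fun q hq => by
    rw [Complex.norm_real]; exact hq.1.2.2.2.2.1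
  have nN : ∀ q ∈ P, ‖(2 * q.1.N : ℂ)‖ ≤ 2 * |(N : ℝ)| := fun q hq => by
    rw [norm_mul, hq.2.1]; simp
  have main : UnifLineBounded P (fun _ => tangBox) (fun q => q.2.2) k fun q v =>
      (q.2.2.1 : ℂ) * (coordS v ^ 2 - coordA v) + (q.2.2.2.1 : ℂ) * (coordU v ^ 2 - coordA v)
        + (q.2.2.2.2 : ℂ) * (q.1.T * (slowDeriv q.1.a v.2.2 : ℂ) - coordS v - coordU v
          - 2 * q.1.N * (√v.2.2 : ℂ)) :=
    ((((cS.pow 2).sub cA).const_mul _ n1).add (((cU.pow 2).sub cA).const_mul _ n2)).add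
      (((((cg.const_mul _ nT).sub cS).sub cU).sub (cq.const_mul _ nN)).const_mul _ n3)
  obtain ⟨M, -, hM⟩ := main.exists_bound
  obtain ⟨C, -, hC⟩ := (main.sub (UnifLineBounded.const _ fun q hq => hM q hq _ hq.2.2.1)).congr
    (g := fun q v => ((tangDeriv q.1 v q.2.2 - tangDeriv q.1 q.2.1 q.2.2 : ℝ) : ℂ))
    (fun _ _ => isOpen_tangBox) fun q hq v hv => by
      simp only [tangDeriv, tangSlope, coordS_apply, coordU_apply, coordA_apply]
      push_cast
      ring
  exact ⟨C, fun p hp hpN w hw ν hν => hC (p, w, ν) ⟨hp, hpN, hw, hν⟩⟩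

theorem exists_lineBounded_tangDeriv_diffQuot (k : ℕ) (N : ℤ) :
    ∃ C, ∀ p ∈ WaveParam.Admissible 1 0, p.N = N → ∀ z : ℝ × ℝ × ℝ, z ≠ 0 → ∀ ν ∈ tangDirs,
      LineBounded (tangBox ∩ {v | v + z ∈ tangBox}) ν k C
        fun v => ((p.eta * (tangDeriv p (v + z) ν - tangDeriv p v ν) / ‖z‖ : ℝ) : ℂ) := by
  set P : Set (WaveParam × (ℝ × ℝ × ℝ) × (ℝ × ℝ × ℝ)) :=
    {q | q.1 ∈ WaveParam.Admissible 1 0 ∧ q.1.N = N ∧ q.2.1 ≠ 0 ∧ q.2.2 ∈ tangDirs}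
  set U : WaveParam × (ℝ × ℝ × ℝ) × (ℝ × ℝ × ℝ) → Set (ℝ × ℝ × ℝ) :=
    fun q => tangBox ∩ {v | v + q.2.1 ∈ tangBox} with hU
  have hν : ∀ q ∈ P, |q.2.2.1| ≤ 1 ∧ |q.2.2.2.1| ≤ 1 ∧ |q.2.2.2.2| ≤ 1 :=
    fun q hq => abs_le_one_of_mem_tangDirs hq.2.2.2
  have hz0 : ∀ q ∈ P, 0 < ‖q.2.1‖ := fun q hq => norm_pos_iff.2 hq.2.2.1
  have hx : ∀ q ∈ P, |q.2.1.1 / ‖q.2.1‖| ≤ 1 ∧ |q.2.1.2.1 / ‖q.2.1‖| ≤ 1 ∧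
      |q.2.1.2.2 / ‖q.2.1‖| ≤ 1 := by
    intro q hq
    obtain ⟨h1, h2, h3⟩ := abs_coord_le_norm q.2.1
    simp only [abs_div, abs_norm, div_le_one (hz0 q hq)]
    exact ⟨h1, h2, h3⟩
  have hη : ∀ q ∈ P, |q.1.eta| ≤ 3 / 2 := fun q hq => by
    rw [abs_of_nonneg (by linarith [hq.1.1.1])]; exact hq.1.1.2
  have cA : ∀ q ∈ P, ∀ v ∈ U q, coordA v ∈ Set.Ioo (4 / 5 : ℝ) 7 ∩
      {t | t + q.2.1.2.2 ∈ Set.Ioo (4 / 5 : ℝ) 7} := fun q hq v hv =>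
    ⟨(mem_tangBox.1 hv.1).2.2, (mem_tangBox.1 hv.2).2.2⟩
  have cA7 : ∀ q ∈ P, ∀ v ∈ U q, |coordA v| ≤ 7 := fun q hq v hv =>
    abs_le.2 ⟨by linarith [(cA q hq v hv).1.1], (cA q hq v hv).1.2.le⟩
  have cg := ((((unifLineBounded_slowDeriv (k + 1)).diffQuot_of_convex
    fun _ _ => convex_Ioo _ _).reparam (P' := P) (fun q => (q.1.a, q.2.1.2.2))
      fun q hq => ⟨hq.1.2.2.1, hq.1.2.2.2.1⟩).comp_coord (M := 7) (U := U) (ν := fun q => q.2.2)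
        coordA cA7 fun q hq => (hν q hq).2.2.trans (by norm_num)) cA
  have cq := ((((unifLineBounded_sqrt (k + 1) (Set.univ : Set Unit)).diffQuot_of_convex
    fun _ _ => convex_Ioo _ _).reparam (P' := P) (fun q => ((), q.2.1.2.2))
      fun q hq => Set.mem_univ _).comp_coord (M := 7) (U := U) (ν := fun q => q.2.2)
        coordA cA7 fun q hq => (hν q hq).2.2.trans (by norm_num)) cA
  have hS : ∀ q ∈ P, ∀ v ∈ U q, |v.1 + (v + q.2.1).1| ≤ 31 / 5 ∧
      |v.2.1 + (v + q.2.1).2.1| ≤ 31 / 5 := by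
    intro q hq v hv
    obtain ⟨a1, a2, -⟩ := mem_tangBox.1 hv.1
    obtain ⟨b1, b2, -⟩ := mem_tangBox.1 hv.2
    exact ⟨(abs_add_le _ _).trans (by linarith), (abs_add_le _ _).trans (by linarith)⟩
  have m2 : ∀ {x y M M' : ℝ}, |x| ≤ M → |y| ≤ M' → |x * y| ≤ M * M' := fun h1 h2 => by
    rw [abs_mul]; exact mul_le_mul h1 h2 (abs_nonneg _) ((abs_nonneg _).trans h1)
  have ca := UnifLineBounded.affine (P := P) (U := U) (ν := fun q => q.2.2) (k := k) (M := 50)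
    (fun q => (2 * (q.1.eta * (q.2.1.1 / ‖q.2.1‖) * q.2.2.1)) • coordS +
      (2 * (q.1.eta * (q.2.1.2.1 / ‖q.2.1‖) * q.2.2.2.1)) • coordU)
    (fun q => q.1.eta * (((q.2.1.1 / ‖q.2.1‖) * q.2.1.1 - q.2.1.2.2 / ‖q.2.1‖) * q.2.2.1 +
      ((q.2.1.2.1 / ‖q.2.1‖) * q.2.1.2.1 - q.2.1.2.2 / ‖q.2.1‖) * q.2.2.2.1 +
      (-(q.2.1.1 / ‖q.2.1‖) - q.2.1.2.1 / ‖q.2.1‖) * q.2.2.2.2))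
    (fun q hq v hv => by
      obtain ⟨h1, h2⟩ := hS q hq v hv
      obtain ⟨n1, n2, n3⟩ := hν q hq
      obtain ⟨x1, x2, x3⟩ := hx q hq
      have : (((2 * (q.1.eta * (q.2.1.1 / ‖q.2.1‖) * q.2.2.1)) • coordS +
          (2 * (q.1.eta * (q.2.1.2.1 / ‖q.2.1‖) * q.2.2.2.1)) • coordU : ℝ × ℝ × ℝ →L[ℝ] ℝ) v) +
          q.1.eta * (((q.2.1.1 / ‖q.2.1‖) * q.2.1.1 - q.2.1.2.2 / ‖q.2.1‖) * q.2.2.1 +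
            ((q.2.1.2.1 / ‖q.2.1‖) * q.2.1.2.1 - q.2.1.2.2 / ‖q.2.1‖) * q.2.2.2.1 +
            (-(q.2.1.1 / ‖q.2.1‖) - q.2.1.2.1 / ‖q.2.1‖) * q.2.2.2.2) =
          q.1.eta * (((q.2.1.1 / ‖q.2.1‖) * (v.1 + (v + q.2.1).1) - q.2.1.2.2 / ‖q.2.1‖) * q.2.2.1 +
            ((q.2.1.2.1 / ‖q.2.1‖) * (v.2.1 + (v + q.2.1).2.1) - q.2.1.2.2 / ‖q.2.1‖) * q.2.2.2.1 +
            (-(q.2.1.1 / ‖q.2.1‖) - q.2.1.2.1 / ‖q.2.1‖) * q.2.2.2.2) := by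
        simp only [add_apply, smul_apply, coordS_apply, coordU_apply, smul_eq_mul, Prod.fst_add,
          Prod.snd_add]
        ring
      rw [this]
      have e1 := m2 (abs_sub_le_of_abs_le (m2 x1 h1) x3) n1
      have e2 := m2 (abs_sub_le_of_abs_le (m2 x2 h2) x3) n2
      have e3 := m2 (abs_sub_le_of_abs_le ((abs_neg _).trans_le x1) x2) n3
      refine (m2 (hη q hq) ((abs_add_three _ _ _).trans (add_le_add_three e1 e2 e3))).trans ?_
      norm_num)
    (fun q hq => by
      obtain ⟨n1, n2, n3⟩ := hν q hq
      obtain ⟨x1, x2, x3⟩ := hx q hq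
      simp only [add_apply, smul_apply, coordS_apply, coordU_apply, smul_eq_mul]
      have h2 : |(2 : ℝ)| ≤ 2 := by norm_num
      refine (abs_add_le _ _).trans ((add_le_add (m2 (m2 h2 (m2 (m2 (hη q hq) x1) n1)) n1)
        (m2 (m2 h2 (m2 (m2 (hη q hq) x2) n2)) n2)).trans ?_)
      norm_num)
  have n4 : ∀ q ∈ P, ‖((q.1.eta * q.1.T * (q.2.1.2.2 / ‖q.2.1‖) * q.2.2.2.2 : ℝ) : ℂ)‖ ≤
      3 / 2 * (5 / 2) * 1 * 1 := fun q hq => by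
    rw [Complex.norm_real]
    exact m2 (m2 (m2 (hη q hq) hq.1.2.2.2.2.1) (hx q hq).2.2) (hν q hq).2.2
  have n5 : ∀ q ∈ P, ‖((2 * q.1.eta * q.1.N * (q.2.1.2.2 / ‖q.2.1‖) * q.2.2.2.2 : ℝ) : ℂ)‖ ≤
      2 * (3 / 2) * |(N : ℝ)| * 1 * 1 := fun q hq => by
    rw [Complex.norm_real]
    have h2 : |(2 : ℝ)| ≤ 2 := by norm_num
    exact m2 (m2 (m2 (m2 h2 (hη q hq)) (by rw [hq.2.1])) (hx q hq).2.2) (hν q hq).2.2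
  obtain ⟨C, -, hC⟩ := ((ca.add (cg.const_mul _ n4)).sub (cq.const_mul _ n5)).congr
    (g := fun q v => ((q.1.eta * (tangDeriv q.1 (v + q.2.1) q.2.2 - tangDeriv q.1 v q.2.2) /
      ‖q.2.1‖ : ℝ) : ℂ))
    (fun q _ => isOpen_tangBox.inter (isOpen_tangBox.preimage (by fun_prop))) fun q hq v hv => by
      have h0 : ((‖q.2.1‖ : ℝ) : ℂ) ≠ 0 := by exact_mod_cast (hz0 q hq).ne'
      simp only [tangDeriv_add_sub, coordS_apply, coordU_apply, coordA_apply, add_apply, smul_apply,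
        smul_eq_mul, Prod.fst_add, Prod.snd_add]
      by_cases hy : q.2.1.2.2 = 0
      · simp only [hy, add_zero, sub_self, mul_zero, zero_mul, zero_div, sub_zero]
        push_cast
        field_simp
        ring
      · have h1 : ((q.2.1.2.2 : ℝ) : ℂ) ≠ 0 := by exact_mod_cast hy
        push_cast
        field_simp
        ring
  exact ⟨C, fun p hp hpN z hz ν hν => hC (p, z, ν) ⟨hp, hpN, hz, hν⟩⟩

end TangentialDerivatives

section ReflectedWaves

theorem abs_sqrt_sub_linear_le {A B C r : ℝ} (hA : 4 / 5 ≤ A) (hB : 4 / 5 ≤ B) (hC : 4 / 5 ≤ C)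
    (h1 : |A - C| ≤ r) (h2 : |B - C| ≤ r) :
    |√B - √A - (B - A) / (2 * √C)| ≤ 2 * r * |B - A| := by
  have hC1 : 4 / 5 ≤ √C := Real.le_sqrt_of_sq_le (by linarith)
  have e : √B - √A - (B - A) / (2 * √C) = (√B - √A) * ((√C - √A) + (√C - √B)) / (2 * √C) := by
    have hA' := Real.sq_sqrt (by linarith : (0 : ℝ) ≤ A)
    have hB' := Real.sq_sqrt (by linarith : (0 : ℝ) ≤ B)
    field_simp
    linear_combination hB' - hA'
  have h3 : |(√C - √A) + (√C - √B)| ≤ 2 * r := by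
    have k1 := abs_sqrt_sub_sqrt_le hC hA
    have k2 := abs_sqrt_sub_sqrt_le hC hB
    rw [abs_sub_comm C] at k1 k2
    exact (abs_add_le _ _).trans (by linarith)
  rw [e, abs_div, abs_of_pos (by linarith : 0 < 2 * √C), div_le_iff₀ (by linarith), abs_mul]
  have h4 := abs_sqrt_sub_sqrt_le hB hA
  have h5 : |√B - √A| * |(√C - √A) + (√C - √B)| ≤ |B - A| * (2 * r) :=
    mul_le_mul h4 h3 (abs_nonneg _) (abs_nonneg _)
  have h6 : 0 ≤ 2 * r * |B - A| := by
    have := (abs_nonneg _).trans h1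
    positivity
  nlinarith

/-- Near each point, either a derivative of the phase is bounded below or some derivative is
uniformly expanding. -/
theorem exists_reflected_dichotomy {N : ℤ} (hN : N ≠ 0) : ∃ c δ a₀ : ℝ, 0 < c ∧ 0 < δ ∧ 0 < a₀ ∧
    a₀ ≤ 1 ∧ ∀ p ∈ WaveParam.Admissible a₀ 0, p.N = N → ∀ w ∈ tangBox,
      (∃ ν ∈ tangDirs, c ≤ |tangDeriv p w ν|) ∨ ∀ z : ℝ × ℝ × ℝ, ∃ ν ∈ tangDirs,
        ∀ v ∈ tangBox, v + z ∈ tangBox → ‖v - w‖ ≤ δ → ‖v + z - w‖ ≤ δ →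
          c * ‖z‖ ≤ |tangDeriv p (v + z) ν - tangDeriv p v ν| := by
  obtain ⟨c₀, hc₀, hc₁, hlow⟩ := exists_reflected_lower_bound hN
  have hN1 : 1 ≤ |(N : ℝ)| := by exact_mod_cast Int.one_le_abs hN
  set M := 2 * |(N : ℝ)| with hM
  set c := c₀ / (726 * M) with hc
  have hM0 : 0 < M := by positivity
  have hcpos : 0 < c := by positivity
  have hcc : c ≤ c₀ := by
    rw [hc, div_le_iff₀ (by positivity)]; nlinarith
  refine ⟨c, c / (8 * (1 + M)), min (c / 5) (1 / 100), hcpos, by positivity, by positivity,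
    (min_le_right _ _).trans (by norm_num), fun p hp hpN w hw => ?_⟩
  obtain ⟨w1, w2, w3⟩ := mem_tangBox.1 hw
  have ha := hp.2.2.1
  have ha1 : p.a ≤ 1 / 100 := hp.2.2.2.1.trans (min_le_right _ _)
  have hac : p.a ≤ c / 5 := hp.2.2.2.1.trans (min_le_left _ _)
  have hT := hp.2.2.2.2.1
  have hq : 4 / 5 ≤ √w.2.2 := Real.le_sqrt_of_sq_le (by linarith [w3.1])
  have hq3 : √w.2.2 ≤ 3 := Real.sqrt_le_iff.2 ⟨by norm_num, by linarith [w3.2]⟩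
  have hτ : |p.T * slowDeriv p.a w.2.2| ≤ 3 / 2 := by
    have hg := abs_slowDeriv_sub_half_le ha (by linarith) (by linarith [w3.1]) w3.2
    have : |slowDeriv p.a w.2.2| ≤ 56 / 100 := by
      rw [abs_le] at *
      constructor <;> linarith
    rw [abs_mul]
    nlinarith [abs_nonneg p.T, abs_nonneg (slowDeriv p.a w.2.2)]
  rcases hlow w.1 w.2.1 w.2.2 p.X _ w1.le w2.le ⟨w3.1.le, w3.2.le⟩ hp.2.2.2.2.2 hτ with h | h | h | h
  · exact Or.inl ⟨(1, 0, 0), by simp [tangDirs], by simpa [tangDeriv] using hcc.trans h⟩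
  · exact Or.inl ⟨(0, 1, 0), by simp [tangDirs], by simpa [tangDeriv] using hcc.trans h⟩
  · refine Or.inl ⟨(0, 0, 1), by simp [tangDirs], ?_⟩
    have e : tangDeriv p w (0, 0, 1) =
        p.T * slowDeriv p.a w.2.2 - w.1 - w.2.1 - 2 * N * √w.2.2 := by
      simp [tangDeriv, tangSlope, hpN]; ring
    rw [e]; exact hcc.trans h
  refine Or.inr fun z => ?_
  have hz := norm_nonneg z
  obtain ⟨z1, z2, z3⟩ := abs_coord_le_norm z
  have hh : |-(N : ℝ) / √w.2.2| ≤ M := by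
    rw [abs_div, abs_neg, abs_of_pos (by linarith : 0 < √w.2.2), div_le_iff₀ (by linarith), hM]
    nlinarith
  have hdet : c₀ / 3 ≤ |4 * w.1 * w.2.1 * (-(N : ℝ) / √w.2.2) - 2 * w.1 - 2 * w.2.1| := by
    have e : 4 * w.1 * w.2.1 * (-(N : ℝ) / √w.2.2) - 2 * w.1 - 2 * w.2.1 =
        -(4 * N * w.1 * w.2.1 + 2 * (w.1 + w.2.1) * √w.2.2) / √w.2.2 := by
      field_simp; ring
    rw [e, abs_div, abs_neg, abs_of_pos (by linarith : 0 < √w.2.2), le_div_iff₀ (by linarith)]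
    nlinarith
  have hlin : 2 * c * ‖z‖ ≤ |2 * w.1 * z.1 - z.2.2| ∨ 2 * c * ‖z‖ ≤ |2 * w.2.1 * z.2.1 - z.2.2| ∨
      2 * c * ‖z‖ ≤ |-z.1 - z.2.1 + -(N : ℝ) / √w.2.2 * z.2.2| := by
    by_contra! hcon
    obtain ⟨k1, k2, k3⟩ := hcon
    have h1 := exists_le_abs_hessian w1.le w2.le hh (by linarith) hdet (by positivity) k1.le k2.le
      k3.le
    rw [← norm_eq_max_coord] at h1
    have hzp : 0 < ‖z‖ := by
      by_contra! h0
      have : ‖z‖ = 0 := le_antisymm h0 hz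
      rw [this, mul_zero] at k1
      exact absurd k1 (not_lt.2 (abs_nonneg _))
    have h2 : 60 * M * (2 * c * ‖z‖) = 120 / 726 * c₀ * ‖z‖ := by
      rw [hc]; field_simp; norm_num
    rw [h2] at h1
    nlinarith [mul_pos hc₀ hzp]
  set δ := c / (8 * (1 + M)) with hδ
  have hδc : (4 + 4 * M) * δ = c / 2 := by rw [hδ]; field_simp; ring
  have hδ0 : 0 < δ := by positivity
  have hMδ : 0 < M * δ := by positivity
  have key : ∀ x s s' r : ℝ, |x| ≤ ‖z‖ → |s - r| ≤ δ → |s' - r| ≤ δ →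
      2 * c * ‖z‖ ≤ |2 * r * x - z.2.2| → c * ‖z‖ ≤ |x * (s + s') - z.2.2| := by
    intro x s s' r hx hs hs' hr
    have h1 : |x * ((s - r) + (s' - r))| ≤ ‖z‖ * (2 * δ) := by
      rw [abs_mul]
      exact mul_le_mul hx ((abs_add_le _ _).trans (by linarith)) (abs_nonneg _) hz
    have h2 := abs_sub_abs_le_abs_sub (2 * r * x - z.2.2) (-(x * ((s - r) + (s' - r))))
    rw [abs_neg, show 2 * r * x - z.2.2 - -(x * ((s - r) + (s' - r))) = x * (s + s') - z.2.2 by ring]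
      at h2
    nlinarith
  have hdist : ∀ v : ℝ × ℝ × ℝ, ‖v - w‖ ≤ δ →
      |v.1 - w.1| ≤ δ ∧ |v.2.1 - w.2.1| ≤ δ ∧ |v.2.2 - w.2.2| ≤ δ := fun v hv => by
    obtain ⟨h1, h2, h3⟩ := abs_coord_le_norm (v - w)
    exact ⟨h1.trans hv, h2.trans hv, h3.trans hv⟩
  rcases hlin with h | h | h
  · refine ⟨(1, 0, 0), by simp [tangDirs], fun v _ _ hv hvz => ?_⟩
    simpa [tangDeriv_add_sub] using
      key z.1 v.1 (v + z).1 w.1 z1 (hdist v hv).1 (hdist _ hvz).1 h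
  · refine ⟨(0, 1, 0), by simp [tangDirs], fun v _ _ hv hvz => ?_⟩
    simpa [tangDeriv_add_sub] using
      key z.2.1 v.2.1 (v + z).2.1 w.2.1 z2 (hdist v hv).2.1 (hdist _ hvz).2.1 h
  · refine ⟨(0, 0, 1), by simp [tangDirs], fun v hvb hvzb hv hvz => ?_⟩
    have a1 := (mem_tangBox.1 hvb).2.2.1
    have a2 : 4 / 5 < v.2.2 + z.2.2 := (mem_tangBox.1 hvzb).2.2.1
    have g1 := abs_slowDeriv_sub_le ha (by linarith) (by linarith : 0 ≤ v.2.2)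
      (by linarith : 0 ≤ v.2.2 + z.2.2)
    have g2 := abs_sqrt_sub_linear_le a1.le a2.le w3.1.le (hdist v hv).2.2 (hdist _ hvz).2.2
    rw [add_sub_cancel_left] at g1 g2
    have g3 : |p.T * (slowDeriv p.a (v.2.2 + z.2.2) - slowDeriv p.a v.2.2)| ≤ c / 2 * ‖z‖ := by
      rw [abs_mul]
      calc _ ≤ 5 / 2 * (p.a * |z.2.2|) := mul_le_mul hT g1 (abs_nonneg _) (by norm_num)
        _ ≤ 5 / 2 * (c / 5 * ‖z‖) := by gcongr
        _ = c / 2 * ‖z‖ := by ring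
    have g4 : |2 * (N : ℝ) * (√(v.2.2 + z.2.2) - √v.2.2 - z.2.2 / (2 * √w.2.2))| ≤
        M * (2 * δ * ‖z‖) := by
      rw [abs_mul, abs_mul, abs_of_pos (by norm_num : (0 : ℝ) < 2)]
      exact mul_le_mul_of_nonneg_left (g2.trans (by gcongr)) hM0.le
    have e : tangDeriv p (v + z) (0, 0, 1) - tangDeriv p v (0, 0, 1) =
        -z.1 - z.2.1 + -(N : ℝ) / √w.2.2 * z.2.2 -
          (2 * (N : ℝ) * (√(v.2.2 + z.2.2) - √v.2.2 - z.2.2 / (2 * √w.2.2)) -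
          p.T * (slowDeriv p.a (v.2.2 + z.2.2) - slowDeriv p.a v.2.2)) := by
      rw [tangDeriv_add_sub, hpN]
      simp only [mul_zero, zero_add, mul_one]
      field_simp
      ring
    rw [e]
    have g5 := abs_sub_abs_le_abs_sub (-z.1 - z.2.1 + -(N : ℝ) / √w.2.2 * z.2.2)
      (2 * (N : ℝ) * (√(v.2.2 + z.2.2) - √v.2.2 - z.2.2 / (2 * √w.2.2)) -
          p.T * (slowDeriv p.a (v.2.2 + z.2.2) - slowDeriv p.a v.2.2))
    have g6 := abs_sub_le_of_abs_le g4 g3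
    have g7 : M * (2 * δ * ‖z‖) ≤ c / 2 * ‖z‖ := by
      rw [← mul_assoc]
      exact mul_le_mul_of_nonneg_right (by linarith) hz
    linarith

/-- Decay of the waves with a fixed nonzero number of reflections. -/
theorem exists_bound_of_ne_zero {R : ℝ → ℝ → ℂ}
    (hR : ∃ Λ₁ : ℝ, 1 ≤ Λ₁ ∧ UnifLineBounded (Set.Ici Λ₁) (fun _ => Set.Ioo (4 / 5 : ℝ) 7)
      (fun _ => (1 : ℝ)) 4 R) (hR1 : ∀ Λ A, ‖R Λ A‖ = 1)
    {χ : ℝ × ℝ × ℝ → ℝ} (hχ : IsTangCutoff χ) {N : ℤ} (hN : N ≠ 0) :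
    ∃ a₀ Λ K : ℝ, 0 < a₀ ∧ 1 ≤ Λ ∧ 0 ≤ K ∧ ∀ p ∈ WaveParam.Admissible a₀ Λ, p.N = N →
      ‖∫ v, tangOsc p v * R (p.eta * p.lam) v.2.2 ^ p.N * χ v‖ ≤ K * p.lam ^ (-(3 / 2) : ℝ) := by
  obtain ⟨c, δ₀, a₀, hc, hδ₀, ha₀, ha₁, hdich⟩ := exists_reflected_dichotomy hN
  obtain ⟨Λ₁, hΛ₁, hR⟩ := hR
  have hN0 := abs_nonneg (N : ℝ)
  set δ := min (min (δ₀ / 2) (1 / 20)) (c / (4 * (10 + 2 * |(N : ℝ)|))) with hδ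
  have hδ1 : 2 * δ ≤ δ₀ := by
    linarith [(min_le_left (min (δ₀ / 2) (1 / 20)) (c / (4 * (10 + 2 * |(N : ℝ)|)))).trans
      (min_le_left _ _)]
  have hδ2 : δ ≤ 1 / 20 := (min_le_left _ _).trans (min_le_right _ _)
  have hδ3 : (10 + 2 * |(N : ℝ)|) * (2 * δ) ≤ c / 2 := by
    have : δ ≤ c / (4 * (10 + 2 * |(N : ℝ)|)) := min_le_right _ _
    rw [le_div_iff₀ (by positivity)] at this
    linarith
  have hδ0 : 0 < δ := by positivity
  have hball : ∀ v ∈ tangCore, Metric.ball v δ ⊆ tangBox := by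
    rintro v ⟨⟨h1, h2⟩, ⟨h3, h4⟩, h5, h6⟩ w hw
    rw [Metric.mem_ball, dist_eq_norm] at hw
    obtain ⟨k1, k2, k3⟩ := abs_coord_le_norm (w - v)
    simp only [Prod.fst_sub, Prod.snd_sub] at k1 k2 k3
    rw [abs_le] at k1 k2 k3
    exact mem_tangBox.2 ⟨abs_lt.2 ⟨by linarith, by linarith⟩, abs_lt.2 ⟨by linarith, by linarith⟩,
      by linarith, by linarith⟩
  have hboxfin : volume tangBox ≠ ⊤ := by
    refine ne_top_of_le_ne_top (isCompact_Icc (a := ((-4, -4, 0) : ℝ × ℝ × ℝ))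
      (b := (4, 4, 7))).measure_lt_top.ne (measure_mono fun v hv => ?_)
    obtain ⟨h1, h2, h3⟩ := mem_tangBox.1 hv
    rw [abs_lt] at h1 h2
    exact ⟨⟨by simp; linarith, by simp; linarith, by simp; linarith [h3.1]⟩,
      by simp; linarith, by simp; linarith, by simp; linarith [h3.2]⟩
  obtain ⟨ρ, hρ, hρc, hρs, hloc⟩ := exists_localization (volume : Measure (ℝ × ℝ × ℝ)) hδ0 hball
    hboxfin
  have hRN : UnifLineBounded (Set.Ici Λ₁) (fun _ => Set.Ioo (4 / 5 : ℝ) 7) (fun _ => (1 : ℝ)) 4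
      fun Λ A => R Λ A ^ N := by
    have h1 := hR.inv one_pos fun Λ _ A _ => (hR1 Λ A).ge
    cases N with
    | ofNat n => simpa using hR.pow n
    | negSucc n => simpa [zpow_negSucc] using h1.pow (n + 1)
  obtain ⟨C₁, hC₁, hamp⟩ : ∃ C, 0 ≤ C ∧ ∀ ν ∈ tangDirs, ∀ Λ ∈ Set.Ici Λ₁, ∀ w,
      LineBounded tangBox ν 4 C fun v => R Λ v.2.2 ^ N * χ v * ρ (v - w) := by
    refine finite_tangDirs.exists_uniform_bound (fun ν _ C D hCD h Λ hΛ w => (h Λ hΛ w).mono hCD)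
      fun ν hν => ?_
    obtain ⟨Cχ, hCχ⟩ := hχ.exists_lineBounded ν 4
    obtain ⟨Cρ, hCρ⟩ := exists_lineBounded_of_contDiff hρ hρc ν 4
    have h1 : UnifLineBounded {q : ℝ × (ℝ × ℝ × ℝ) | q.1 ∈ Set.Ici Λ₁} (fun _ => tangBox)
        (fun _ => ν) 4 fun q v => R q.1 v.2.2 ^ N :=
      (hRN.reparam (fun q : ℝ × (ℝ × ℝ × ℝ) => q.1) fun q hq => hq).comp_third
        (fun _ _ => (abs_le_one_of_mem_tangDirs hν).2.2) fun q _ v hv => (mem_tangBox.1 hv).2.2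
    have h2 : UnifLineBounded {q : ℝ × (ℝ × ℝ × ℝ) | q.1 ∈ Set.Ici Λ₁} (fun _ => tangBox)
        (fun _ => ν) 4 fun q v => (χ v : ℂ) :=
      .of_lineBounded (hCχ.mono_set (Set.subset_univ _))
    have h3 : UnifLineBounded {q : ℝ × (ℝ × ℝ × ℝ) | q.1 ∈ Set.Ici Λ₁} (fun _ => tangBox)
        (fun _ => ν) 4 fun q v => (ρ (v - q.2) : ℂ) :=
      ⟨|Cρ|, abs_nonneg _, fun q _ => by
        simpa [sub_eq_add_neg] using
          (hCρ.comp_add (-q.2) (W := tangBox) fun _ _ => Set.mem_univ _).mono (le_abs_self Cρ)⟩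
    obtain ⟨C, -, hC⟩ := (h1.mul h2).mul h3
    exact ⟨C, fun Λ hΛ w => hC (Λ, w) hΛ⟩
  obtain ⟨C₂, hsub⟩ := exists_lineBounded_tangDeriv_sub 2 N
  obtain ⟨C₃, hdq⟩ := exists_lineBounded_tangDeriv_diffQuot 4 N
  set C₄ := 3 / 2 / c * |C₂| + 3 / 2 with hC₄
  obtain ⟨K₁, hK₁, hb₁⟩ := exists_nonstationary_bound (volume : Measure (ℝ × ℝ × ℝ)) 2 (max C₁ C₄)
    (volume.real tangCore) (c := 1 / 4) (by norm_num) measureReal_nonneg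
  obtain ⟨K₂, hK₂, hb₂⟩ := exists_second_order_bound (E := ℝ × ℝ × ℝ) (by simp) volume (max C₁ C₃)
    (volume.real tangCore) (c := c / 2) (by positivity) measureReal_nonneg
  set K := max (K₁ * (c⁻¹) ^ 2) K₂ with hK
  have hK0 : 0 ≤ K := le_max_of_le_right hK₂
  refine ⟨a₀, 2 * Λ₁, K * volume.real tangBox, ha₀, by linarith, by positivity,
    fun p hp hpN => ?_⟩
  have hl1 : 1 ≤ p.lam := by linarith [hp.2.1]
  have hl0 : 0 < p.lam := by linarith
  have ha := hp.2.2.1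
  have hη := hp.1
  have hpΛ : p.eta * p.lam ∈ Set.Ici Λ₁ := by
    have := hp.2.1
    rw [Set.mem_Ici]; nlinarith [hη.1]
  have hpa : p ∈ WaveParam.Admissible a₀ 0 := WaveParam.Admissible.mono le_rfl (by linarith) hp
  have hp1 : p ∈ WaveParam.Admissible 1 0 := WaveParam.Admissible.mono ha₁ le_rfl hpa
  have hpos : tangBox ⊆ {v | 0 < v.2.2} := fun v hv => by
    have := (mem_tangBox.1 hv).2.2.1
    simp only [Set.mem_ofPred_eq]; linarith
  have hosc : ContinuousOn (tangOsc p) tangBox := (continuousOn_tangOsc ha).mono hpos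
  have hG : Continuous fun v => tangOsc p v * R (p.eta * p.lam) v.2.2 ^ p.N * χ v := by
    refine continuous_mul_of_tsupport_subset isOpen_tangBox (hosc.mul ?_)
      (Complex.continuous_ofReal.comp hχ.contDiff.continuous).continuousOn
      (IsTangCutoff.tsupport_ofReal_subset.trans hχ.tsupport_subset_box)
    rw [hpN]
    exact (hRN.continuousOn hpΛ).comp (by fun_prop) fun v hv => (mem_tangBox.1 hv).2.2
  have hG0 : ∀ v, v ∉ tangCore → tangOsc p v * R (p.eta * p.lam) v.2.2 ^ p.N * χ v = 0 := by
    intro v hv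
    rw [image_eq_zero_of_notMem_tsupport fun h => hv (hχ.tsupport_subset_core h)]
    simp
  have hGc : HasCompactSupport fun v => tangOsc p v * R (p.eta * p.lam) v.2.2 ^ p.N * χ v :=
    HasCompactSupport.intro isCompact_tangCore hG0
  suffices hw : ∀ w ∈ tangBox, ‖∫ v, tangOsc p v * R (p.eta * p.lam) v.2.2 ^ p.N * χ v * ρ (v - w)‖ ≤
      K * p.lam ^ (-(3 / 2) : ℝ) by
    refine (hloc _ _ (by positivity) (hG.integrable_of_hasCompactSupport hGc) hG0 hw).trans
      (le_of_eq (by ring))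
  intro w hw
  set am : ℝ × ℝ × ℝ → ℂ := fun v => R (p.eta * p.lam) v.2.2 ^ N * χ v * ρ (v - w) with ham
  have hint : ∫ v, tangOsc p v * R (p.eta * p.lam) v.2.2 ^ p.N * χ v * ρ (v - w) =
      ∫ v, tangOsc p v * am v := by
    congr with v
    rw [ham, hpN]; ring
  rw [hint]
  set U := tangBox ∩ Metric.ball w (2 * δ) with hU
  have hUo : IsOpen U := isOpen_tangBox.inter Metric.isOpen_ball
  have hUb : U ⊆ tangBox := Set.inter_subset_left
  have hUw : ∀ v ∈ U, ‖v - w‖ ≤ 2 * δ := fun v hv => by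
    have := hv.2
    rw [Metric.mem_ball, dist_eq_norm] at this
    exact this.le
  have hamχ : tsupport am ⊆ tsupport χ := closure_mono fun v hv => by
    simp only [ham, Function.mem_support, ne_eq, mul_eq_zero, not_or, Complex.ofReal_eq_zero] at hv
    exact hv.1.2
  have hamρ : tsupport am ⊆ Metric.closedBall w δ := (closure_mono fun v hv => by
    simp only [ham, Function.mem_support, ne_eq, mul_eq_zero, not_or, Complex.ofReal_eq_zero] at hv
    exact hv.2).trans (hρs w)
  have hamU : tsupport am ⊆ U := fun v hv => ⟨hχ.tsupport_subset_box (hamχ hv),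
    Metric.closedBall_subset_ball (by linarith) (hamρ hv)⟩
  have hamC : tsupport am ⊆ tangCore := hamχ.trans hχ.tsupport_subset_core
  have hampU : ∀ ν ∈ tangDirs, LineBounded U ν 4 C₁ am := fun ν hν =>
    (hamp ν hν _ hpΛ w).mono_set hUb
  rcases hdich p hpa hpN w hw with ⟨ν, hν, hgrad⟩ | hdet
  · set m := |tangDeriv p w ν| with hm
    have hm0 : 0 < m := hc.trans_le hgrad
    have hdiff : ∀ v ∈ U, |tangDeriv p v ν - tangDeriv p w ν| ≤ c / 2 := fun v hv => by
      have h1 := abs_tangDeriv_add_sub_le (z := v - w) ha hp1.2.2.2.1 hp.2.2.2.2.1 hw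
        (by simpa using hUb hv) hν
      rw [add_sub_cancel, hpN] at h1
      exact h1.trans ((mul_le_mul_of_nonneg_left (hUw v hv) (by positivity)).trans hδ3)
    set f : ℝ × ℝ × ℝ → ℂ := fun v => ((p.eta / m : ℝ) : ℂ) *
      ((tangDeriv p v ν - tangDeriv p w ν : ℝ) : ℂ) + ((p.eta * tangDeriv p w ν / m : ℝ) : ℂ) with hf
    have hfe : ∀ v, f v = ((p.eta * tangDeriv p v ν / m : ℝ) : ℂ) := fun v => by
      simp only [hf]; push_cast; field_simp; ring
    have hfb : LineBounded U ν 2 (max C₁ C₄) f := by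
      have h1 := ((hsub p hp1 hpN w hw ν hν).mono_set hUb).mono (le_abs_self C₂)
      have h2 := (h1.const_mul ((p.eta / m : ℝ) : ℂ)).add
        (LineBounded.const (C := 3 / 2) ((p.eta * tangDeriv p w ν / m : ℝ) : ℂ) (by
          rw [Complex.norm_real, Real.norm_eq_abs, abs_div, abs_mul, ← hm, hm, abs_abs, ← hm,
            mul_div_assoc, div_self hm0.ne', mul_one, abs_of_pos (by linarith [hη.1])]
          exact hη.2))
      refine h2.mono (le_max_of_le_right ?_)
      rw [hC₄, Complex.norm_real, Real.norm_eq_abs, abs_of_pos (by have := hη.1; positivity)]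
      have := hη.1
      have := hη.2
      gcongr
    have h := hb₁ U tangCore ν (tangOsc p) f am (p.lam * m) (by positivity) hUo (hosc.mono hUb)
      (fun v _ => (norm_tangOsc p v).le) (fun v hv => ?_) hfb (fun v hv => ?_)
      (((hampU ν hν).of_le (by norm_num)).mono (le_max_left _ _)) isCompact_tangCore hamU hamC le_rfl
    · refine h.trans ?_
      have e1 : p.lam⁻¹ ^ 2 ≤ p.lam ^ (-(3 / 2) : ℝ) := by
        rw [inv_pow, ← Real.rpow_natCast, ← Real.rpow_neg hl0.le]
        exact Real.rpow_le_rpow_of_exponent_le hl1 (by norm_num)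
      calc K₁ * ((p.lam * m)⁻¹) ^ 2 ≤ K₁ * ((p.lam * c)⁻¹) ^ 2 := by gcongr
        _ = (K₁ * c⁻¹ ^ 2) * p.lam⁻¹ ^ 2 := by rw [mul_inv]; ring
        _ ≤ K * p.lam ^ (-(3 / 2) : ℝ) := by
          gcongr
          exact le_max_left _ _
    · have h1 := hasLineDerivAt_tangOsc ha (hpos (hUb hv)) ν
      have e : I * ((p.lam * m : ℝ) : ℂ) * f v = I * (p.lam * p.eta * tangDeriv p v ν : ℝ) := by
        rw [hfe]; push_cast
        have : (m : ℂ) ≠ 0 := by exact_mod_cast hm0.ne'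
        field_simp
      rw [e]; exact h1
    · rw [hfe, Complex.norm_real, Real.norm_eq_abs, abs_div, abs_of_pos hm0, le_div_iff₀ hm0, abs_mul,
        abs_of_pos (by linarith [hη.1] : 0 < p.eta)]
      have h1 := abs_sub_abs_le_abs_sub (tangDeriv p w ν) (tangDeriv p v ν)
      rw [abs_sub_comm, ← hm] at h1
      have h2 := hdiff v hv
      nlinarith [hη.1, abs_nonneg (tangDeriv p v ν)]
  · have h := hb₂ U tangCore (fun v => p.eta * tangPhase p v) am p.lam hl0.ne' hUo
      (((continuousOn_tangPhase ha).mono (hUb.trans hpos)).const_mul _) isCompact_tangCore hamU hamC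
      le_rfl fun z hz => ?_
    · have e : ∀ v, cexp (I * (p.lam * (p.eta * tangPhase p v) : ℝ)) = tangOsc p v := fun v => by
        rw [tangOsc, mul_assoc p.lam]
      simp only [e, abs_of_pos hl0] at h
      refine h.trans ?_
      gcongr
      exact le_max_right _ _
    · obtain ⟨ν, hν, hexp⟩ := hdet z
      have hz0 : 0 < ‖z‖ := norm_pos_iff.2 hz
      refine ⟨ν, fun v => p.eta * (tangDeriv p (v + z) ν - tangDeriv p v ν) / ‖z‖, ?_, ?_, ?_,
        (hampU ν hν).mono (le_max_left _ _)⟩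
      · intro v hv hvz
        have h1 := hasLineDerivAt_tangPhase ha (hpos (hUb hv)) ν
        have h2 := (hasLineDerivAt_tangPhase ha (hpos (hUb hvz)) ν).comp_add_right
        have h3 := (HasDerivAt.fun_sub h2 h1).const_mul p.eta
        have e : ‖z‖ * (p.eta * (tangDeriv p (v + z) ν - tangDeriv p v ν) / ‖z‖) =
            p.eta * (tangDeriv p (v + z) ν - tangDeriv p v ν) := by field_simp
        rw [e]
        unfold HasLineDerivAt
        simpa only [mul_sub] using h3
      · exact ((hdq p hp1 hpN z hz ν hν).mono_set (Set.inter_subset_inter hUb fun v hv => hUb hv)).mono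
          (le_max_right _ _)
      · intro v hv hvz
        have h1 := hexp v (hUb hv) (hUb hvz) ((hUw v hv).trans hδ1) ((hUw _ hvz).trans hδ1)
        rw [abs_div, abs_norm, le_div_iff₀ hz0, abs_mul, abs_of_pos (by linarith [hη.1] : 0 < p.eta)]
        nlinarith [hη.1, abs_nonneg (tangDeriv p (v + z) ν - tangDeriv p v ν)]

end ReflectedWaves

section AllReflections

/-- Summable decay in `N` of the reflected waves. -/
theorem exists_bound_reflected {R : ℝ → ℝ → ℂ}
    (hR : ∃ Λ₁ : ℝ, 1 ≤ Λ₁ ∧ UnifLineBounded (Set.Ici Λ₁) (fun _ => Set.Ioo (4 / 5 : ℝ) 7)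
      (fun _ => (1 : ℝ)) 4 R) (hR1 : ∀ Λ A, ‖R Λ A‖ = 1)
    {χ : ℝ × ℝ × ℝ → ℝ} (hχ : IsTangCutoff χ) :
    ∃ a₀ Λ K : ℝ, 0 < a₀ ∧ a₀ ≤ 1 / 100 ∧ 1 ≤ Λ ∧ 0 ≤ K ∧ ∀ p ∈ WaveParam.Admissible a₀ Λ, p.N ≠ 0 →
      ‖∫ v, tangOsc p v * R (p.eta * p.lam) v.2.2 ^ p.N * χ v‖ ≤
        K * p.lam ^ (-(3 / 2) : ℝ) / (1 + (p.N : ℝ) ^ 2) := by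
  obtain ⟨Λ₁, K₁, hΛ₁, hK₁, h₁⟩ := exists_bound_of_five_le
    (hR.imp fun _ h => ⟨h.1, h.2.of_le (by norm_num)⟩) hR1 hχ
  obtain ⟨C, hC, h₂⟩ := ((Set.finite_Icc (-4 : ℤ) 4).subset
    (Set.sep_subset _ fun N => N ≠ 0)).exists_uniform_bound (Q := fun N C => 0 < C ∧
      ∀ p ∈ WaveParam.Admissible C⁻¹ C, p.N = N →
        ‖∫ v, tangOsc p v * R (p.eta * p.lam) v.2.2 ^ p.N * χ v‖ ≤ C * p.lam ^ (-(3 / 2) : ℝ))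
    (fun N _ C D hCD h => by
      refine ⟨h.1.trans_le hCD, fun p hp hpN => ?_⟩
      have hl : 0 < p.lam := (h.1.trans_le hCD).trans_le hp.2.1
      refine (h.2 p (WaveParam.Admissible.mono (inv_anti₀ h.1 hCD) hCD hp) hpN).trans ?_
      gcongr) fun N hN => by
      obtain ⟨a₀, Λ, K, ha₀, hΛ, hK, h⟩ := exists_bound_of_ne_zero hR hR1 hχ hN.2
      have hm : 0 < max a₀⁻¹ (max Λ K) := lt_max_of_lt_left (inv_pos.2 ha₀)
      refine ⟨max a₀⁻¹ (max Λ K), hm, fun p hp hpN => ?_⟩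
      have hl : 0 < p.lam := hm.trans_le hp.2.1
      refine (h p (WaveParam.Admissible.mono (inv_le_of_inv_le₀ ha₀ (le_max_left _ _))
        ((le_max_left _ _).trans (le_max_right _ _)) hp) hpN).trans ?_
      gcongr
      exact (le_max_right _ _).trans (le_max_right _ _)
  set D := max C 1 with hD
  have hD1 : 1 ≤ D := le_max_right _ _
  refine ⟨min (1 / 100) D⁻¹, max Λ₁ D, 2 * K₁ + 17 * D, by positivity, min_le_left _ _,
    le_max_of_le_left hΛ₁, by positivity, fun p hp hp0 => ?_⟩
  have hl1 : 1 ≤ p.lam := hΛ₁.trans ((le_max_left _ _).trans hp.2.1)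
  have hl : 0 < p.lam := by linarith
  set l := p.lam ^ (-(3 / 2) : ℝ)
  have hl2 : 0 < l := by positivity
  rw [le_div_iff₀ (by positivity)]
  rcases lt_or_ge |(p.N : ℝ)| 5 with hN | hN
  · have hN4 : |p.N| ≤ 4 := by
      have : |p.N| < 5 := by exact_mod_cast hN
      omega
    obtain ⟨hCpos, hb⟩ := h₂ p.N ⟨abs_le.1 hN4, hp0⟩
    have hb' := hb p (WaveParam.Admissible.mono ((min_le_right _ _).trans
      (inv_anti₀ hCpos (le_max_left _ _))) ((le_max_left _ _).trans (le_max_right _ _)) hp) rfl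
    have hsq : (p.N : ℝ) ^ 2 ≤ 16 := by
      have : |(p.N : ℝ)| ≤ 4 := by exact_mod_cast hN4
      rw [← sq_abs]; nlinarith [abs_nonneg (p.N : ℝ)]
    calc _ ≤ C * l * 17 := by gcongr; linarith
      _ ≤ (2 * K₁ + 17 * D) * l := by
        have : C * l ≤ D * l := by gcongr; exact le_max_left _ _
        nlinarith [mul_nonneg hK₁ hl2.le]
  · have hb := h₁ p (WaveParam.Admissible.mono (min_le_left _ _) (le_max_left _ _) hp) hN
    have hN0 : 0 < |(p.N : ℝ)| := by linarith
    have e1 : p.lam⁻¹ ^ 2 ≤ l := by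
      rw [inv_pow, ← Real.rpow_natCast, ← Real.rpow_neg hl.le]
      exact Real.rpow_le_rpow_of_exponent_le hl1 (by norm_num)
    have e2 : (|(p.N : ℝ)|⁻¹) ^ 2 * (1 + (p.N : ℝ) ^ 2) ≤ 2 := by
      rw [inv_pow, sq_abs, inv_mul_le_iff₀ (by positivity)]
      have : 25 ≤ (p.N : ℝ) ^ 2 := by rw [← sq_abs]; nlinarith
      linarith
    calc _ ≤ K₁ * ((p.lam * |(p.N : ℝ)|)⁻¹) ^ 2 * (1 + (p.N : ℝ) ^ 2) := by gcongr
      _ = K₁ * (p.lam⁻¹ ^ 2 * ((|(p.N : ℝ)|⁻¹) ^ 2 * (1 + (p.N : ℝ) ^ 2))) := by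
        rw [mul_inv]; ring
      _ ≤ K₁ * (l * 2) := by gcongr
      _ ≤ (2 * K₁ + 17 * D) * l := by nlinarith [mul_pos (zero_lt_one.trans_le hD1) hl2]

end AllReflections

section FoldCoordinates

/-- The change of variables `S + Υ = T s`, from `(s, Υ, A)` to `(S, Υ, A)`. -/
noncomputable def foldMap (T : ℝ) : ℝ × ℝ × ℝ →L[ℝ] ℝ × ℝ × ℝ :=
  (T • coordS - coordU).prod (ContinuousLinearMap.snd ℝ ℝ (ℝ × ℝ))

@[simp] theorem foldMap_apply (T : ℝ) (w : ℝ × ℝ × ℝ) : foldMap T w = (T * w.1 - w.2.1, w.2) := rfl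

/-- The open box containing the support of the amplitudes in the variables `(s, Υ, A)`. -/
def foldBox : Set (ℝ × ℝ × ℝ) :=
  Set.Ioo (1 / 5) (4 / 5) ×ˢ Set.Ioo (-(31 / 10)) (31 / 10) ×ˢ Set.Ioo (4 / 5) 7

/-- A compact box containing the support of the amplitudes in the variables `(s, Υ, A)`. -/
def foldCore : Set (ℝ × ℝ × ℝ) := Set.Icc (1 / 4) (3 / 4) ×ˢ Set.Icc (-3) 3 ×ˢ Set.Icc (9 / 10) 6

theorem isOpen_foldBox : IsOpen foldBox := isOpen_Ioo.prod (isOpen_Ioo.prod isOpen_Ioo)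

theorem isCompact_foldCore : IsCompact foldCore :=
  isCompact_Icc.prod (isCompact_Icc.prod isCompact_Icc)

theorem mem_foldBox {w : ℝ × ℝ × ℝ} : w ∈ foldBox ↔
    w.1 ∈ Set.Ioo (1 / 5 : ℝ) (4 / 5) ∧ |w.2.1| < 31 / 10 ∧ w.2.2 ∈ Set.Ioo (4 / 5 : ℝ) 7 := by
  simp only [foldBox, Set.mem_prod, abs_lt]; rfl

theorem foldCore_subset_foldBox : foldCore ⊆ foldBox := by
  rintro v ⟨⟨h1, h2⟩, ⟨h3, h4⟩, h5, h6⟩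
  exact mem_foldBox.2 ⟨⟨by linarith, by linarith⟩, abs_lt.2 ⟨by linarith, by linarith⟩,
    by linarith, by linarith⟩

theorem hasLineDerivAt_tangPhase_foldMap {p : WaveParam} {w : ℝ × ℝ × ℝ} (ha : 0 < p.a)
    (hw : 0 < w.2.2) (ν : ℝ × ℝ × ℝ) :
    HasLineDerivAt ℝ (fun w => tangPhase p (foldMap p.T w))
      (tangDeriv p (foldMap p.T w) (foldMap p.T ν)) w ν := by
  have := hasLineDerivAt_tangPhase (v := foldMap p.T w) ha hw (foldMap p.T ν)
  unfold HasLineDerivAt at *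
  simpa only [map_add, map_smul] using this

/-- The increments of the derivatives of the phase in the variables `(s, Υ, A)`, divided by `T`. -/
noncomputable def foldDiff (p : WaveParam) (z w ν : ℝ × ℝ × ℝ) : ℝ :=
  (p.T ^ 2 * (z.1 * (w.1 + (w.1 + z.1))) - 2 * p.T * (w.1 * z.2.1 + z.1 * (w.2.1 + z.2.1))
      + z.2.1 * (w.2.1 + (w.2.1 + z.2.1)) - z.2.2) * ν.1
    + (-(p.T * (z.1 * (w.1 + (w.1 + z.1)))) + 2 * (w.1 * z.2.1 + z.1 * (w.2.1 + z.2.1))) * ν.2.1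
    + (-z.1 + (slowDeriv p.a (w.2.2 + z.2.2) - slowDeriv p.a w.2.2)) * ν.2.2

theorem tangDeriv_foldMap_sub {p : WaveParam} (hN : p.N = 0) (z w ν : ℝ × ℝ × ℝ) :
    tangDeriv p (foldMap p.T (w + z)) (foldMap p.T ν) - tangDeriv p (foldMap p.T w) (foldMap p.T ν) =
      p.T * foldDiff p z w ν := by
  simp only [tangDeriv, tangSlope, foldDiff, foldMap_apply, hN, Prod.fst_add, Prod.snd_add,
    Int.cast_zero]
  ring

theorem exists_lineBounded_foldDiff (k : ℕ) :
    ∃ C, ∀ p ∈ WaveParam.Admissible 1 0, ∀ z : ℝ × ℝ × ℝ, z ≠ 0 → ∀ ν ∈ tangDirs,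
      LineBounded (foldBox ∩ {v | v + z ∈ foldBox}) ν k C
        fun w => ((p.eta * foldDiff p z w ν / ‖z‖ : ℝ) : ℂ) := by
  set P : Set (WaveParam × (ℝ × ℝ × ℝ) × (ℝ × ℝ × ℝ)) :=
    {q | q.1 ∈ WaveParam.Admissible 1 0 ∧ q.2.1 ≠ 0 ∧ q.2.2 ∈ tangDirs}
  set U : WaveParam × (ℝ × ℝ × ℝ) × (ℝ × ℝ × ℝ) → Set (ℝ × ℝ × ℝ) :=
    fun q => foldBox ∩ {v | v + q.2.1 ∈ foldBox} with hU
  have hν : ∀ q ∈ P, |q.2.2.1| ≤ 1 ∧ |q.2.2.2.1| ≤ 1 ∧ |q.2.2.2.2| ≤ 1 :=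
    fun q hq => abs_le_one_of_mem_tangDirs hq.2.2
  have hz0 : ∀ q ∈ P, 0 < ‖q.2.1‖ := fun q hq => norm_pos_iff.2 hq.2.1
  have hx : ∀ q ∈ P, |q.2.1.1 / ‖q.2.1‖| ≤ 1 ∧ |q.2.1.2.1 / ‖q.2.1‖| ≤ 1 ∧
      |q.2.1.2.2 / ‖q.2.1‖| ≤ 1 := by
    intro q hq
    obtain ⟨h1, h2, h3⟩ := abs_coord_le_norm q.2.1
    simp only [abs_div, abs_norm, div_le_one (hz0 q hq)]
    exact ⟨h1, h2, h3⟩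
  have hη : ∀ q ∈ P, |q.1.eta| ≤ 3 / 2 := fun q hq => by
    rw [abs_of_nonneg (by linarith [hq.1.1.1])]; exact hq.1.1.2
  have hT : ∀ q ∈ P, |q.1.T| ≤ 5 / 2 := fun q hq => hq.1.2.2.2.2.1
  have cA : ∀ q ∈ P, ∀ v ∈ U q, coordA v ∈ Set.Ioo (4 / 5 : ℝ) 7 ∩
      {t | t + q.2.1.2.2 ∈ Set.Ioo (4 / 5 : ℝ) 7} := fun q hq v hv =>
    ⟨(mem_foldBox.1 hv.1).2.2, (mem_foldBox.1 hv.2).2.2⟩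
  have cA7 : ∀ q ∈ P, ∀ v ∈ U q, |coordA v| ≤ 7 := fun q hq v hv =>
    abs_le.2 ⟨by linarith [(cA q hq v hv).1.1], (cA q hq v hv).1.2.le⟩
  have cg := ((((unifLineBounded_slowDeriv (k + 1)).diffQuot_of_convex
    fun _ _ => convex_Ioo _ _).reparam (P' := P)
      (fun q : WaveParam × (ℝ × ℝ × ℝ) × (ℝ × ℝ × ℝ) => (q.1.a, q.2.1.2.2))
      fun q hq => ⟨hq.1.2.2.1, hq.1.2.2.2.1⟩).comp_coord (M := 7) (U := U) (ν := fun q => q.2.2)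
        coordA cA7 fun q hq => (hν q hq).2.2.trans (by norm_num)) cA
  have cS := UnifLineBounded.affine (P := P) (U := U) (ν := fun q => q.2.2) (k := k) (M := 4)
    (fun _ => coordS) (fun _ => 0)
    (fun q hq v hv => by
      obtain ⟨h1, h2⟩ := (mem_foldBox.1 hv.1).1
      simp only [coordS_apply]
      exact abs_le.2 ⟨by linarith, by linarith⟩) fun q hq => (hν q hq).1.trans (by norm_num)
  have cS' := UnifLineBounded.affine (P := P) (U := U) (ν := fun q => q.2.2) (k := k) (M := 4)
    (fun _ => coordS) (fun q => q.2.1.1)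
    (fun q hq v hv => by
      obtain ⟨h1, h2⟩ := (mem_foldBox.1 hv.2).1
      simp only [coordS_apply, Prod.fst_add] at *
      exact abs_le.2 ⟨by linarith, by linarith⟩) fun q hq => (hν q hq).1.trans (by norm_num)
  have cU := UnifLineBounded.affine (P := P) (U := U) (ν := fun q => q.2.2) (k := k) (M := 4)
    (fun _ => coordU) (fun _ => 0)
    (fun q hq v hv => by
      obtain ⟨h1, h2⟩ := abs_lt.1 (mem_foldBox.1 hv.1).2.1
      simp only [coordU_apply]
      exact abs_le.2 ⟨by linarith, by linarith⟩) fun q hq => (hν q hq).2.1.trans (by norm_num)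
  have cU' := UnifLineBounded.affine (P := P) (U := U) (ν := fun q => q.2.2) (k := k) (M := 4)
    (fun _ => coordU) (fun q => q.2.1.2.1)
    (fun q hq v hv => by
      obtain ⟨h1, h2⟩ := abs_lt.1 (mem_foldBox.1 hv.2).2.1
      simp only [coordU_apply, Prod.fst_add, Prod.snd_add] at *
      exact abs_le.2 ⟨by linarith, by linarith⟩) fun q hq => (hν q hq).2.1.trans (by norm_num)
  have m2 : ∀ {x y M M' : ℝ}, |x| ≤ M → |y| ≤ M' → |x * y| ≤ M * M' := fun h1 h2 => by
    rw [abs_mul]; exact mul_le_mul h1 h2 (abs_nonneg _) ((abs_nonneg _).trans h1)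
  have hd : ∀ q ∈ P, |q.2.2.2.1 - q.1.T * q.2.2.1| ≤ 1 + 5 / 2 * 1 := fun q hq =>
    abs_sub_le_of_abs_le (hν q hq).2.1 (m2 (hT q hq) (hν q hq).1)
  have k1 : ∀ q ∈ P, ‖((q.1.eta * (q.2.1.1 / ‖q.2.1‖) * q.1.T * (q.2.2.2.1 - q.1.T * q.2.2.1) : ℝ) : ℂ)‖ ≤
      3 / 2 * 1 * (5 / 2) * (1 + 5 / 2 * 1) := fun q hq => by
    rw [Complex.norm_real]
    exact m2 (m2 (m2 (hη q hq) (hx q hq).1) (hT q hq)) (hd q hq)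
  have k2 : ∀ q ∈ P, ‖((q.1.eta * (q.2.1.2.1 / ‖q.2.1‖) * 2 * (q.2.2.2.1 - q.1.T * q.2.2.1) : ℝ) : ℂ)‖ ≤
      3 / 2 * 1 * 2 * (1 + 5 / 2 * 1) := fun q hq => by
    rw [Complex.norm_real]
    exact m2 (m2 (m2 (hη q hq) (hx q hq).2.1) (abs_of_pos two_pos).le) (hd q hq)
  have k3 : ∀ q ∈ P, ‖((q.1.eta * (q.2.1.1 / ‖q.2.1‖) * 2 * (q.2.2.2.1 - q.1.T * q.2.2.1) : ℝ) : ℂ)‖ ≤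
      3 / 2 * 1 * 2 * (1 + 5 / 2 * 1) := fun q hq => by
    rw [Complex.norm_real]
    exact m2 (m2 (m2 (hη q hq) (hx q hq).1) (abs_of_pos two_pos).le) (hd q hq)
  have k4 : ∀ q ∈ P, ‖((q.1.eta * (q.2.1.2.1 / ‖q.2.1‖) * q.2.2.1 : ℝ) : ℂ)‖ ≤ 3 / 2 * 1 * 1 :=
    fun q hq => by
      rw [Complex.norm_real]
      exact m2 (m2 (hη q hq) (hx q hq).2.1) (hν q hq).1
  have k5 : ∀ q ∈ P, ‖((q.1.eta * ((q.2.1.2.2 / ‖q.2.1‖) * q.2.2.1 - -(q.2.1.1 / ‖q.2.1‖) * q.2.2.2.2) :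
      ℝ) : ℂ)‖ ≤ 3 / 2 * (1 * 1 + 1 * 1) :=
    fun q hq => by
      rw [Complex.norm_real]
      exact m2 (hη q hq) (abs_sub_le_of_abs_le (m2 (hx q hq).2.2 (hν q hq).1)
        (m2 ((abs_neg _).trans_le (hx q hq).1) (hν q hq).2.2))
  have k6 : ∀ q ∈ P, ‖((q.1.eta * (q.2.1.2.2 / ‖q.2.1‖) * q.2.2.2.2 : ℝ) : ℂ)‖ ≤ 3 / 2 * 1 * 1 :=
    fun q hq => by
      rw [Complex.norm_real]
      exact m2 (m2 (hη q hq) (hx q hq).2.2) (hν q hq).2.2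
  obtain ⟨C, -, hC⟩ := ((((((cS.const_mul _ k2).add (cU'.const_mul _ k3)).sub
      ((cS.add cS').const_mul _ k1)).add ((cU.add cU').const_mul _ k4)).sub
      (UnifLineBounded.const _ k5)).add (cg.const_mul _ k6)).congr
    (g := fun q w => ((q.1.eta * foldDiff q.1 q.2.1 w q.2.2 / ‖q.2.1‖ : ℝ) : ℂ))
    (fun q _ => isOpen_foldBox.inter (isOpen_foldBox.preimage (by fun_prop))) fun q hq v hv => by
      have h0 : ((‖q.2.1‖ : ℝ) : ℂ) ≠ 0 := by exact_mod_cast (hz0 q hq).ne'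
      simp only [foldDiff, coordS_apply, coordU_apply, coordA_apply]
      by_cases hy : q.2.1.2.2 = 0
      · simp only [hy, add_zero, sub_self, mul_zero, zero_mul, zero_div, sub_zero]
        push_cast
        field_simp
        ring
      · have h1 : ((q.2.1.2.2 : ℝ) : ℂ) ≠ 0 := by exact_mod_cast hy
        push_cast
        field_simp
        ring
  exact ⟨C, fun p hp z hz ν hν => hC (p, z, ν) ⟨hp, hz, hν⟩⟩

/-- Each increment of the phase is nonstationary along one of the coordinate directions. -/
theorem exists_le_abs_foldDiff {p : WaveParam} (ha : 0 < p.a) (ha1 : p.a ≤ 1 / 20000)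
    (hT : |p.T| ≤ 5 / 2) (z : ℝ × ℝ × ℝ) :
    ∃ ν ∈ tangDirs, ∀ w ∈ foldBox, w + z ∈ foldBox → 1 / 20000 * ‖z‖ ≤ |foldDiff p z w ν| := by
  obtain ⟨hx, hζ, hy⟩ := abs_coord_le_norm z
  have hn := norm_nonneg z
  by_cases c1 : 1 / 10000 * ‖z‖ ≤ |z.1|
  · refine ⟨(0, 0, 1), by simp [tangDirs], fun w hw hwz => ?_⟩
    have a1 := (mem_foldBox.1 hw).2.2.1
    have b1 := (mem_foldBox.1 hwz).2.2.1
    simp only [Prod.snd_add] at b1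
    have g1 := abs_slowDeriv_sub_le ha (ha1.trans (by norm_num)) (by linarith : 0 ≤ w.2.2)
      (by linarith : 0 ≤ w.2.2 + z.2.2)
    rw [add_sub_cancel_left] at g1
    have g2 : p.a * |z.2.2| ≤ 1 / 20000 * ‖z‖ := mul_le_mul ha1 hy (abs_nonneg _) (by norm_num)
    have e : foldDiff p z w (0, 0, 1) =
        -(z.1 - (slowDeriv p.a (w.2.2 + z.2.2) - slowDeriv p.a w.2.2)) := by
      simp [foldDiff]; ring
    rw [e, abs_neg]
    have := abs_sub_abs_le_abs_sub z.1 (slowDeriv p.a (w.2.2 + z.2.2) - slowDeriv p.a w.2.2)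
    linarith
  have aux : ∀ w ∈ foldBox, w + z ∈ foldBox → |z.1 * (w.1 + (w.1 + z.1))| ≤ 1 / 10000 * ‖z‖ * (8 / 5) ∧
      |z.1 * (w.2.1 + z.2.1)| ≤ 1 / 10000 * ‖z‖ * (31 / 10) := by
    intro w hw hwz
    obtain ⟨⟨a1, a2⟩, a3, -⟩ := mem_foldBox.1 hw
    obtain ⟨⟨b1, b2⟩, b3, -⟩ := mem_foldBox.1 hwz
    simp only [Prod.fst_add, Prod.snd_add] at b1 b2 b3
    push Not at c1
    rw [abs_mul, abs_mul]
    refine ⟨mul_le_mul c1.le ?_ (abs_nonneg _) (by positivity),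
      mul_le_mul c1.le b3.le (abs_nonneg _) (by positivity)⟩
    exact abs_le.2 ⟨by linarith, by linarith⟩
  by_cases c2 : 1 / 100 * ‖z‖ ≤ |z.2.1|
  · refine ⟨(0, 1, 0), by simp [tangDirs], fun w hw hwz => ?_⟩
    obtain ⟨h1, h2⟩ := aux w hw hwz
    obtain ⟨a1, a2⟩ := (mem_foldBox.1 hw).1
    have e : foldDiff p z w (0, 1, 0) =
        2 * (w.1 * z.2.1) + (2 * (z.1 * (w.2.1 + z.2.1)) - p.T * (z.1 * (w.1 + (w.1 + z.1)))) := by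
      simp [foldDiff]; ring
    have h3 : |p.T * (z.1 * (w.1 + (w.1 + z.1)))| ≤ 5 / 2 * (1 / 10000 * ‖z‖ * (8 / 5)) := by
      rw [abs_mul]; exact mul_le_mul hT h1 (abs_nonneg _) (by norm_num)
    have h4 : |2 * (w.1 * z.2.1)| ≥ 2 * (1 / 5 * (1 / 100 * ‖z‖)) := by
      rw [abs_mul, abs_mul, abs_of_pos (by linarith : 0 < w.1), abs_of_pos (two_pos (α := ℝ))]
      gcongr
    have h5 : |2 * (z.1 * (w.2.1 + z.2.1)) - p.T * (z.1 * (w.1 + (w.1 + z.1)))| ≤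
        2 * (1 / 10000 * ‖z‖ * (31 / 10)) + 5 / 2 * (1 / 10000 * ‖z‖ * (8 / 5)) := by
      refine abs_sub_le_of_abs_le ?_ h3
      rw [abs_mul, abs_of_pos (two_pos (α := ℝ))]
      gcongr
    rw [e]
    have := abs_sub_abs_le_abs_add (2 * (w.1 * z.2.1))
      (2 * (z.1 * (w.2.1 + z.2.1)) - p.T * (z.1 * (w.1 + (w.1 + z.1))))
    linarith
  · refine ⟨(1, 0, 0), by simp [tangDirs], fun w hw hwz => ?_⟩
    obtain ⟨h1, h2⟩ := aux w hw hwz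
    obtain ⟨⟨a1, a2⟩, a3, -⟩ := mem_foldBox.1 hw
    have b3 := (mem_foldBox.1 hwz).2.1
    simp only [Prod.fst_add, Prod.snd_add] at b3
    push Not at c1 c2
    have hyn : |z.2.2| = ‖z‖ := by
      refine le_antisymm hy ?_
      rw [norm_eq_max_coord] at *
      rcases max_choice |z.1| (max |z.2.1| |z.2.2|) with h | h
      · rw [h] at c1 hn; linarith
      · rcases max_choice |z.2.1| |z.2.2| with h' | h'
        · rw [h, h'] at c2 hn; linarith
        · rw [h, h']
    have e : foldDiff p z w (1, 0, 0) = -(z.2.2 - (p.T ^ 2 * (z.1 * (w.1 + (w.1 + z.1)))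
        - 2 * p.T * (w.1 * z.2.1 + z.1 * (w.2.1 + z.2.1))
        + z.2.1 * (w.2.1 + (w.2.1 + z.2.1)))) := by
      simp [foldDiff]
    have h3 : |p.T ^ 2 * (z.1 * (w.1 + (w.1 + z.1)))| ≤
        (5 / 2) ^ 2 * (1 / 10000 * ‖z‖ * (8 / 5)) := by
      rw [abs_mul, abs_pow]; gcongr
    have h4 : |w.1 * z.2.1| ≤ 4 / 5 * (1 / 100 * ‖z‖) := by
      rw [abs_mul, abs_of_pos (by linarith : 0 < w.1)]; gcongr
    have h5 : |2 * p.T * (w.1 * z.2.1 + z.1 * (w.2.1 + z.2.1))| ≤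
        2 * (5 / 2) * (4 / 5 * (1 / 100 * ‖z‖) + 1 / 10000 * ‖z‖ * (31 / 10)) := by
      rw [abs_mul, abs_mul, abs_of_pos (two_pos (α := ℝ))]
      gcongr
      exact (abs_add_le _ _).trans (add_le_add h4 h2)
    have h6 : |z.2.1 * (w.2.1 + (w.2.1 + z.2.1))| ≤ 1 / 100 * ‖z‖ * (31 / 5) := by
      rw [abs_mul]
      exact mul_le_mul c2.le ((abs_add_le _ _).trans (by linarith)) (abs_nonneg _) (by positivity)
    rw [e, abs_neg]
    have h7 := abs_sub_abs_le_abs_sub z.2.2 (p.T ^ 2 * (z.1 * (w.1 + (w.1 + z.1)))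
        - 2 * p.T * (w.1 * z.2.1 + z.1 * (w.2.1 + z.2.1)) + z.2.1 * (w.2.1 + (w.2.1 + z.2.1)))
    have h8 := (abs_add_le _ _).trans (add_le_add (abs_sub_le_of_abs_le h3 h5) h6)
    linarith

end FoldCoordinates

section FoldBound

/-- A smooth cutoff around the stationary value `s = 1/2`. -/
noncomputable def foldBump : ContDiffBump (1 / 2 : ℝ) :=
  ⟨1 / 8, 1 / 4, by norm_num, by norm_num⟩

theorem continuous_foldBump : Continuous (foldBump : ℝ → ℝ) :=
  (foldBump.contDiff (n := 0)).continuous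

theorem tsupport_fold_subset {χ : ℝ × ℝ × ℝ → ℝ} (hχ : IsTangCutoff χ) (T : ℝ) :
    tsupport (fun w : ℝ × ℝ × ℝ => ((χ (foldMap T w) * foldBump w.1 : ℝ) : ℂ)) ⊆ foldCore := by
  refine closure_minimal (fun w hw => ?_) isCompact_foldCore.isClosed
  simp only [Function.mem_support, ne_eq, Complex.ofReal_eq_zero, mul_eq_zero, not_or] at hw
  have h1 := hχ.tsupport_subset_core (subset_tsupport _ hw.1)
  have h2 : w.1 ∈ Metric.closedBall (1 / 2 : ℝ) (1 / 4) := by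
    have : w.1 ∈ tsupport (foldBump : ℝ → ℝ) := subset_tsupport _ hw.2
    rwa [foldBump.tsupport_eq] at this
  rw [Real.closedBall_eq_Icc] at h2
  exact ⟨⟨by linarith [h2.1], by linarith [h2.2]⟩, h1.2⟩

theorem exists_lineBounded_fold {χ : ℝ × ℝ × ℝ → ℝ} (hχ : IsTangCutoff χ) (k : ℕ) :
    ∃ C, 0 ≤ C ∧ ∀ T : ℝ, |T| ≤ 5 / 2 → ∀ ν ∈ tangDirs, LineBounded Set.univ ν k C
      fun w => ((χ (foldMap T w) * foldBump w.1 : ℝ) : ℂ) := by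
  obtain ⟨C₁, h₁⟩ := hχ.exists_lineBounded (1, 0, 0) k
  obtain ⟨C₂, h₂⟩ := hχ.exists_lineBounded (-1, 1, 0) k
  obtain ⟨C₃, h₃⟩ := hχ.exists_lineBounded (0, 0, 1) k
  obtain ⟨C₄, h₄⟩ := exists_lineBounded_of_contDiff foldBump.contDiff foldBump.hasCompactSupport
    (1 : ℝ) k
  have p1 : 0 ≤ C₁ := (norm_nonneg _).trans (h₁.bound 0 (Set.mem_univ _))
  have p2 : 0 ≤ C₂ := (norm_nonneg _).trans (h₂.bound 0 (Set.mem_univ _))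
  have p3 : 0 ≤ C₃ := (norm_nonneg _).trans (h₃.bound 0 (Set.mem_univ _))
  have p4 : 0 ≤ C₄ := (norm_nonneg _).trans (h₄.bound 0 (Set.mem_univ _))
  have h₅ : ∀ ν ∈ tangDirs, LineBounded Set.univ ν k C₄ fun w : ℝ × ℝ × ℝ => ((foldBump w.1 : ℝ) : ℂ) := by
    intro ν hν
    have hb : |ν.1| ≤ 1 := (abs_le_one_of_mem_tangDirs hν).1
    have := (h₄.smul_dir ν.1 p4 hb le_rfl).comp_linear (W := Set.univ) (μ := ν) coordS (by simp)
      (Set.mapsTo_univ _ _)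
    simpa using this
  have h₆ : ∀ T : ℝ, |T| ≤ 5 / 2 → ∀ ν ∈ tangDirs, LineBounded Set.univ ν k
      ((5 / 2) ^ k * C₁ + C₂ + C₃) fun w => (χ (foldMap T w) : ℂ) := by
    intro T hT ν hν
    rcases hν with rfl | rfl | rfl
    · refine ((h₁.smul_dir T p1 hT (by norm_num)).comp_linear (foldMap T) (by simp)
        (Set.mapsTo_univ _ _)).mono (by linarith)
    · refine (h₂.comp_linear (foldMap T) (by simp) (Set.mapsTo_univ _ _)).mono ?_
      have : 0 ≤ (5 / 2 : ℝ) ^ k * C₁ := by positivity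
      linarith
    · refine (h₃.comp_linear (foldMap T) (by simp) (Set.mapsTo_univ _ _)).mono ?_
      have : 0 ≤ (5 / 2 : ℝ) ^ k * C₁ := by positivity
      linarith
  refine ⟨_, ?_, fun T hT ν hν => by
    simpa only [Complex.ofReal_mul] using (h₆ T hT ν hν).mul (by positivity) p4 (h₅ ν hν)⟩
  positivity

/-- The contribution of the neighbourhood of the stationary points of the wave `N = 0`. -/
theorem exists_bound_fold {χ : ℝ × ℝ × ℝ → ℝ} (hχ : IsTangCutoff χ) :
    ∃ K, 0 ≤ K ∧ ∀ p ∈ WaveParam.Admissible (1 / 20000) 1, p.N = 0 → p.T ≠ 0 →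
      ‖∫ w, tangOsc p (foldMap p.T w) * ((χ (foldMap p.T w) * foldBump w.1 : ℝ) : ℂ)‖ ≤
        K * |p.lam * p.T| ^ (-(3 / 2) : ℝ) := by
  obtain ⟨C₁, h₁⟩ := exists_lineBounded_foldDiff 4
  obtain ⟨C₂, -, h₂⟩ := exists_lineBounded_fold hχ 4
  obtain ⟨K, hK, h⟩ := exists_second_order_bound (E := ℝ × ℝ × ℝ) (by simp) volume (max C₁ C₂)
    (volume.real foldCore) (c := 1 / 40000) (by norm_num) measureReal_nonneg
  refine ⟨K, hK, fun p hp hN hT => ?_⟩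
  have hp1 : p ∈ WaveParam.Admissible 1 0 := WaveParam.Admissible.mono (by norm_num) zero_le_one hp
  obtain ⟨⟨hη1, hη2⟩, hl, ha, ha1, hT2, -⟩ := hp
  have hpos : ∀ w ∈ foldBox, 0 < w.2.2 := fun w hw => by linarith [(mem_foldBox.1 hw).2.2.1]
  have hs := tsupport_fold_subset hχ p.T
  have := h foldBox foldCore (fun w => p.eta / p.T * tangPhase p (foldMap p.T w))
    (fun w => ((χ (foldMap p.T w) * foldBump w.1 : ℝ) : ℂ)) (p.lam * p.T)
    (mul_ne_zero (by linarith) hT) isOpen_foldBox ?_ isCompact_foldCore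
    (hs.trans foldCore_subset_foldBox) hs le_rfl ?_
  · convert this using 5 with w
    unfold tangOsc
    congr 3
    field_simp
  · exact continuousOn_const.mul ((continuousOn_tangPhase ha).comp (by fun_prop)
      fun w hw => hpos w hw)
  · intro z hz
    obtain ⟨ν, hν, hb⟩ := exists_le_abs_foldDiff ha ha1 hT2 z
    have hz0 : 0 < ‖z‖ := norm_pos_iff.2 hz
    refine ⟨ν, fun w => p.eta * foldDiff p z w ν / ‖z‖, fun w hw hwz => ?_,
      (h₁ p hp1 z hz ν hν).mono (le_max_left _ _), fun w hw hwz => ?_,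
      ((h₂ p.T hT2 ν hν).mono (le_max_right _ _)).mono_set (Set.subset_univ _)⟩
    · have d1 := hasLineDerivAt_tangPhase_foldMap ha (hpos w hw) ν
      have d2 := (hasLineDerivAt_tangPhase_foldMap ha (hpos _ hwz) ν).comp_add_right
      have d3 := (HasDerivAt.fun_sub d2 d1).const_mul (p.eta / p.T)
      have e : ‖z‖ * (p.eta * foldDiff p z w ν / ‖z‖) = p.eta / p.T *
          (tangDeriv p (foldMap p.T (w + z)) (foldMap p.T ν) -
            tangDeriv p (foldMap p.T w) (foldMap p.T ν)) := by
        rw [tangDeriv_foldMap_sub hN]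
        field_simp
      rw [e]
      unfold HasLineDerivAt
      simpa only [mul_sub] using d3
    · have := hb w hw hwz
      rw [abs_div, abs_mul, abs_norm, le_div_iff₀ hz0, abs_of_pos (by linarith : 0 < p.eta)]
      nlinarith [abs_nonneg (foldDiff p z w ν)]

/-- The change of variables `S + Υ = T s` in integrals. -/
theorem integral_foldMap {F : ℝ × ℝ × ℝ → ℂ} (hF : Continuous F) (hc : HasCompactSupport F) {T : ℝ}
    (hT : T ≠ 0) : ∫ v, F v = |T| * ∫ w, F (foldMap T w) := by
  have hc' : HasCompactSupport fun w => F (foldMap T w) := by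
    refine HasCompactSupport.intro (K := (fun v : ℝ × ℝ × ℝ => ((v.1 + v.2.1) / T, v.2)) '' tsupport F)
      (hc.isCompact.image (by fun_prop)) fun w hw => ?_
    refine image_eq_zero_of_notMem_tsupport fun h => hw ⟨_, h, ?_⟩
    ext <;> simp [hT]
  have hF' : Continuous fun w => F (foldMap T w) := by fun_prop
  have i1 := hF.integrable_of_hasCompactSupport (μ := volume) hc
  have i2 := hF'.integrable_of_hasCompactSupport (μ := volume) hc'
  rw [Measure.volume_eq_prod] at i1 i2 ⊢
  rw [integral_prod_symm _ i1, integral_prod_symm _ i2, ← integral_const_mul]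
  congr 1 with y
  have h1 := Measure.integral_comp_mul_left (fun x => F (x - y.1, y)) T
  simp only [foldMap_apply]
  rw [h1, integral_sub_right_eq_self (fun x => F (x, y)) y.1, abs_inv, Complex.real_smul]
  have : ((|T| : ℝ) : ℂ) ≠ 0 := by exact_mod_cast abs_ne_zero.2 hT
  push_cast
  field_simp

end FoldBound

section DirectWave

/-- Nonstationary phase in the variable `A` away from the stationary points. -/
theorem exists_bound_slice {χ : ℝ × ℝ × ℝ → ℝ} (hχ : IsTangCutoff χ) :
    ∃ K, 0 ≤ K ∧ ∀ p ∈ WaveParam.Admissible (1 / 100) 1, p.N = 0 → ∀ S Υ : ℝ,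
      ‖∫ A, tangOsc p (S, Υ, A) * χ (S, Υ, A)‖ ≤ K ∧
      (0 < |S + Υ - p.T / 2| → |p.T| ≤ 8 * |S + Υ - p.T / 2| →
        ‖∫ A, tangOsc p (S, Υ, A) * χ (S, Υ, A)‖ ≤ K * ((p.lam * |S + Υ - p.T / 2|)⁻¹) ^ 3) := by
  obtain ⟨C₁, h₁⟩ := hχ.exists_lineBounded (0, 0, 1) 3
  have hC₁ : 0 ≤ C₁ := (norm_nonneg _).trans (h₁.bound 0 (Set.mem_univ _))
  set P : Set (WaveParam × ℝ) := {q | q.1 ∈ WaveParam.Admissible (1 / 100) 1 ∧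
    0 < |q.2 - q.1.T / 2| ∧ |q.1.T| ≤ 8 * |q.2 - q.1.T / 2|} with hP
  have hη : ∀ q ∈ P, |q.1.eta| ≤ 3 / 2 := fun q hq => by
    rw [abs_of_nonneg (by linarith [hq.1.1.1])]; exact hq.1.1.2
  have hT : ∀ q ∈ P, abs (q.1.T / |q.2 - q.1.T / 2|) ≤ 8 := fun q hq => by
    rw [abs_div, abs_abs, div_le_iff₀ hq.2.1]; exact hq.2.2
  have hσ : ∀ q ∈ P, abs (q.2 / |q.2 - q.1.T / 2|) ≤ 5 := fun q hq => by
    rw [abs_div, abs_abs, div_le_iff₀ hq.2.1]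
    have h1 := abs_add_le (q.2 - q.1.T / 2) (q.1.T / 2)
    rw [sub_add_cancel, abs_div, abs_of_pos (two_pos (α := ℝ))] at h1
    linarith [hq.2.2]
  have m2 : ∀ {x y M M' : ℝ}, |x| ≤ M → |y| ≤ M' → |x * y| ≤ M * M' := fun h1 h2 => by
    rw [abs_mul]; exact mul_le_mul h1 h2 (abs_nonneg _) ((abs_nonneg _).trans h1)
  have k1 : ∀ q ∈ P, ‖((q.1.eta * (q.1.T / |q.2 - q.1.T / 2|) : ℝ) : ℂ)‖ ≤ 3 / 2 * 8 := fun q hq => by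
    rw [Complex.norm_real]; exact m2 (hη q hq) (hT q hq)
  have k2 : ∀ q ∈ P, ‖((q.1.eta * (q.2 / |q.2 - q.1.T / 2|) : ℝ) : ℂ)‖ ≤ 3 / 2 * 5 := fun q hq => by
    rw [Complex.norm_real]; exact m2 (hη q hq) (hσ q hq)
  have cg := (unifLineBounded_slowDeriv 3).reparam (P' := P) (fun q : WaveParam × ℝ => q.1.a)
    fun q hq => ⟨hq.1.2.2.1, hq.1.2.2.2.1.trans (by norm_num)⟩
  obtain ⟨C₂, -, h₂⟩ := (cg.const_mul _ k1).sub (UnifLineBounded.const _ k2)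
  obtain ⟨K, hK, h⟩ := exists_nonstationary_bound (volume : Measure ℝ) 3 (max C₁ C₂) 6 (c := 1 / 8)
    (by norm_num) (by norm_num)
  refine ⟨max K (C₁ * 6), le_max_of_le_left hK, fun p hp hN S Υ => ?_⟩
  have hs : tsupport (fun A => (χ (S, Υ, A) : ℂ)) ⊆ Set.Icc (9 / 10 : ℝ) 6 := by
    refine closure_minimal (fun A hA => ?_) isClosed_Icc
    simp only [Function.mem_support, ne_eq, Complex.ofReal_eq_zero] at hA
    exact (hχ.tsupport_subset_core (subset_tsupport _ hA)).2.2
  have hvol : volume.real (Set.Icc (9 / 10 : ℝ) 6) ≤ 6 := by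
    rw [Real.volume_real_Icc]; norm_num
  have hsl : LineBounded Set.univ (1 : ℝ) 3 C₁ fun A => (χ (S, Υ, A) : ℂ) := by
    have := h₁.comp_affine (W := Set.univ) (μ := (1 : ℝ))
      ((ContinuousLinearMap.inr ℝ ℝ (ℝ × ℝ)).comp (ContinuousLinearMap.inr ℝ ℝ ℝ)) (S, Υ, 0)
      (by simp) (Set.mapsTo_univ _ _)
    simpa using this
  constructor
  · refine (norm_integral_le_of_tsupport_subset volume (B := Set.Icc (9 / 10 : ℝ) 6) (C := C₁)
      isCompact_Icc.measure_ne_top (fun A => ?_) fun A hA => ?_).trans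
        ((mul_le_mul_of_nonneg_left hvol hC₁).trans (le_max_right _ _))
    · rw [norm_mul, norm_tangOsc, one_mul]
      exact hsl.bound A (Set.mem_univ _)
    · rw [image_eq_zero_of_notMem_tsupport fun h => hA (hs h), mul_zero]
  · intro hd hTd
    set d := |S + Υ - p.T / 2|
    have ha := hp.2.2.1
    have hl : 0 < p.lam := zero_lt_one.trans_le hp.2.1
    have hq : (p, S + Υ) ∈ P := ⟨hp, hd, hTd⟩
    have hpos : ∀ A ∈ Set.Ioo (4 / 5 : ℝ) 7, 0 < A := fun A hA => by linarith [hA.1]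
    refine (h (Set.Ioo (4 / 5) 7) (Set.Icc (9 / 10) 6) 1 (fun A => tangOsc p (S, Υ, A)) _
      (fun A => (χ (S, Υ, A) : ℂ)) (p.lam * d) (by positivity) isOpen_Ioo ?_
      (fun A _ => (norm_tangOsc _ _).le) ?_ ((h₂ _ hq).mono (le_max_right _ _)) ?_
      ((hsl.mono (le_max_left _ _)).mono_set (Set.subset_univ _)) isCompact_Icc
      (hs.trans fun A hA => ⟨by linarith [hA.1], by linarith [hA.2]⟩) hs hvol).trans
      (by gcongr; exact le_max_left _ _)
    · exact (continuousOn_tangOsc ha).comp (by fun_prop) fun A hA => hpos A hA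
    · intro A hA
      have h1 := hasLineDerivAt_tangOsc ha (v := (S, Υ, A)) (hpos A hA) (0, 0, 1)
      have e : I * (p.lam * p.eta * tangDeriv p (S, Υ, A) (0, 0, 1) : ℝ) * tangOsc p (S, Υ, A) =
          I * (p.lam * d : ℝ) * (((p.eta * (p.T / d) : ℝ) : ℂ) * (slowDeriv p.a A : ℂ) -
            ((p.eta * ((S + Υ) / d) : ℝ) : ℂ)) * tangOsc p (S, Υ, A) := by
        have hd0 : (d : ℂ) ≠ 0 := by exact_mod_cast hd.ne'
        simp only [tangDeriv, tangSlope, hN]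
        push_cast
        field_simp
        ring
      rw [e] at h1
      unfold HasLineDerivAt at h1 ⊢
      simpa using h1
    · intro A hA
      have g1 := abs_slowDeriv_sub_half_le ha (hp.2.2.2.1.trans (by norm_num)) (hpos A hA) hA.2
      have g2 : |p.T * (slowDeriv p.a A - 1 / 2)| ≤ 8 * d * (6 / 100) := by
        rw [abs_mul]
        exact mul_le_mul hTd (g1.trans (by linarith [hp.2.2.2.1])) (abs_nonneg _) (by positivity)
      have g3 := abs_sub_abs_le_abs_sub (S + Υ - p.T / 2) (p.T * (slowDeriv p.a A - 1 / 2))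
      have e : ((p.eta * (p.T / d) : ℝ) : ℂ) * (slowDeriv p.a A : ℂ) -
          ((p.eta * ((S + Υ) / d) : ℝ) : ℂ) = ((-(p.eta * ((S + Υ - p.T / 2 -
            p.T * (slowDeriv p.a A - 1 / 2)) / d)) : ℝ) : ℂ) := by
        push_cast
        ring
      change 1 / 8 ≤ ‖((p.eta * (p.T / d) : ℝ) : ℂ) * (slowDeriv p.a A : ℂ) -
          ((p.eta * ((S + Υ) / d) : ℝ) : ℂ)‖
      rw [e, Complex.norm_real, Real.norm_eq_abs, abs_neg, abs_mul, abs_div, abs_of_pos hd,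
        abs_of_pos (by linarith [hp.1.1] : 0 < p.eta), ← mul_div_assoc, le_div_iff₀ hd]
      nlinarith [hp.1.1, abs_nonneg (S + Υ - p.T / 2 - p.T * (slowDeriv p.a A - 1 / 2))]

theorem integral_inv_one_add_mul_sq {l : ℝ} (hl : 0 < l) (b : ℝ) :
    Integrable (fun x : ℝ => (1 + (l * (x + b)) ^ 2)⁻¹) ∧
      ∫ x : ℝ, (1 + (l * (x + b)) ^ 2)⁻¹ = l⁻¹ * π := by
  constructor
  · exact (integrable_inv_one_add_sq.comp_mul_left' hl.ne').comp_add_right b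
  · rw [integral_add_right_eq_self (fun x : ℝ => (1 + (l * x) ^ 2)⁻¹) b,
      Measure.integral_comp_mul_left (fun x : ℝ => (1 + x ^ 2)⁻¹) l, integral_univ_inv_one_add_sq,
      abs_of_pos (inv_pos.2 hl), smul_eq_mul]

/-- Integration in `(S, Υ)` of a bound concentrated along the line `S + Υ = c`. -/
theorem norm_integral_le_of_slice_le {F : ℝ × ℝ × ℝ → ℂ} (hF : Continuous F)
    (hFs : tsupport F ⊆ tangCore) {D l c : ℝ} (hl : 0 < l)
    (h : ∀ S Υ : ℝ, ‖∫ A, F (S, Υ, A)‖ ≤ D * (1 + (l * (S + Υ - c)) ^ 2)⁻¹) :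
    ‖∫ v, F v‖ ≤ D * (l⁻¹ * π) * 6 := by
  have hc : HasCompactSupport F := isCompact_tangCore.of_isClosed_subset (isClosed_tsupport F) hFs
  have i1 := hF.integrable_of_hasCompactSupport (μ := volume) hc
  rw [Measure.volume_eq_prod] at i1 ⊢
  rw [integral_prod _ i1]
  have hB : volume.real (Set.Icc (-3 : ℝ) 3) = 6 := by rw [Real.volume_real_Icc]; norm_num
  rw [← hB]
  have hzero : ∀ S : ℝ, S ∉ Set.Icc (-3 : ℝ) 3 → ∀ y, F (S, y) = 0 := fun S hS y =>
    image_eq_zero_of_notMem_tsupport fun h => hS (hFs h).1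
  refine norm_integral_le_of_tsupport_subset volume isCompact_Icc.measure_ne_top (fun S => ?_)
    fun S hS => by simp [hzero S hS]
  have hFS : Continuous fun y => F (S, y) := by fun_prop
  have hcS : HasCompactSupport fun y => F (S, y) := by
    refine HasCompactSupport.intro (isCompact_tangCore.image continuous_snd) fun y hy => ?_
    exact image_eq_zero_of_notMem_tsupport fun h => hy ⟨_, hFs h, rfl⟩
  have i2 := hFS.integrable_of_hasCompactSupport (μ := volume) hcS
  rw [Measure.volume_eq_prod] at i2 ⊢
  rw [integral_prod _ i2]
  obtain ⟨i3, e3⟩ := integral_inv_one_add_mul_sq hl (S - c)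
  rw [← e3, ← integral_const_mul]
  refine norm_integral_le_of_norm_le (i3.const_mul D) (Eventually.of_forall fun Υ => ?_)
  have := h S Υ
  rwa [show S + Υ - c = Υ + (S - c) by ring] at this

/-- The dispersive bound for the wave `N = 0`. -/
theorem exists_bound_direct {χ : ℝ × ℝ × ℝ → ℝ} (hχ : IsTangCutoff χ) :
    ∃ K, 0 ≤ K ∧ ∀ p ∈ WaveParam.Admissible (1 / 20000) 1, p.N = 0 → p.T ≠ 0 →
      ‖∫ v, tangOsc p v * χ v‖ ≤ K * p.lam⁻¹ * min 1 ((p.lam * |p.T|) ^ (-(1 / 2) : ℝ)) := by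
  obtain ⟨K₁, hK₁, h₁⟩ := exists_bound_slice hχ
  obtain ⟨K₂, hK₂, h₂⟩ := exists_bound_fold hχ
  refine ⟨520 * K₁ * π * 6 + K₂, by positivity, fun p hp hN hT => ?_⟩
  have h₁ := h₁ p (WaveParam.Admissible.mono (by norm_num) le_rfl hp) hN
  have h₂ := h₂ p hp hN hT
  have hl : 0 < p.lam := zero_lt_one.trans_le hp.2.1
  have hT0 : 0 < |p.T| := abs_pos.2 hT
  have ha := hp.2.2.1
  have hbox : ContinuousOn (tangOsc p) tangBox := (continuousOn_tangOsc ha).mono fun v hv => by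
    have := (mem_tangBox.1 hv).2.2.1
    change 0 < v.2.2
    linarith
  have hcont : Continuous fun v => tangOsc p v * (χ v : ℂ) :=
    continuous_mul_of_tsupport_subset isOpen_tangBox hbox
      (Complex.continuous_ofReal.comp hχ.contDiff.continuous).continuousOn
      (IsTangCutoff.tsupport_ofReal_subset.trans hχ.tsupport_subset_box)
  have hsupp := (IsTangCutoff.tsupport_mul_subset (χ := χ) (tangOsc p)).trans hχ.tsupport_subset_core
  have hfar : ∀ S Υ : ℝ, |p.T| ≤ 8 * |S + Υ - p.T / 2| → 1 ≤ p.lam * |p.T| →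
      ‖∫ A, tangOsc p (S, Υ, A) * χ (S, Υ, A)‖ ≤
        520 * K₁ * (p.lam * |p.T|)⁻¹ * (1 + (p.lam * (S + Υ - p.T / 2)) ^ 2)⁻¹ := by
    intro S Υ hd hT1
    have hd0 : 0 < |S + Υ - p.T / 2| := by linarith
    refine ((h₁ S Υ).2 hd0 hd).trans ?_
    rw [mul_pow p.lam, ← sq_abs (S + Υ - p.T / 2), ← mul_pow]
    set x := p.lam * |S + Υ - p.T / 2| with hx
    have hx0 : 0 < x := by positivity
    have hxT : p.lam * |p.T| ≤ 8 * x := by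
      rw [hx]
      nlinarith
    have e1 : x⁻¹ ≤ 8 * (p.lam * |p.T|)⁻¹ := by
      rw [← div_eq_mul_inv, le_div_iff₀ (by positivity), inv_mul_le_iff₀ hx0]
      linarith
    have e2 : (x⁻¹) ^ 2 ≤ 65 * (1 + x ^ 2)⁻¹ := by
      rw [← div_eq_mul_inv, le_div_iff₀ (by positivity), inv_pow, inv_mul_le_iff₀ (by positivity)]
      nlinarith
    calc K₁ * x⁻¹ ^ 3 = K₁ * (x⁻¹ * x⁻¹ ^ 2) := by ring
      _ ≤ K₁ * (8 * (p.lam * |p.T|)⁻¹ * (65 * (1 + x ^ 2)⁻¹)) := by gcongr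
      _ = _ := by ring
  rcases le_or_gt (p.lam * |p.T|) 1 with hT1 | hT1
  · rw [min_eq_left (Real.one_le_rpow_of_pos_of_le_one_of_nonpos (by positivity) hT1 (by norm_num)),
      mul_one]
    refine (norm_integral_le_of_slice_le hcont hsupp hl (D := 2 * K₁) (c := p.T / 2)
      fun S Υ => ?_).trans ?_
    · have hmain : ∀ x : ℝ, 0 ≤ x → x ≤ 1 → K₁ ≤ 2 * K₁ * (1 + x ^ 2)⁻¹ := by
        intro x hx0 hx1
        rw [← div_eq_mul_inv, le_div_iff₀ (by positivity)]
        nlinarith [mul_le_mul_of_nonneg_left (pow_le_one₀ hx0 hx1 : x ^ 2 ≤ 1) hK₁]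
      rw [mul_pow p.lam, ← sq_abs (S + Υ - p.T / 2), ← mul_pow]
      rcases le_or_gt (p.lam * |S + Υ - p.T / 2|) 1 with hx | hx
      · exact (h₁ S Υ).1.trans (hmain _ (by positivity) hx)
      · have hd0 : 0 < |S + Υ - p.T / 2| := by
          by_contra hcon
          have : p.lam * |S + Υ - p.T / 2| ≤ 0 := mul_nonpos_of_nonneg_of_nonpos hl.le (not_lt.1 hcon)
          linarith
        have hd : |p.T| ≤ 8 * |S + Υ - p.T / 2| := by
          have : |p.T| < |S + Υ - p.T / 2| := lt_of_mul_lt_mul_left (hT1.trans_lt hx) hl.le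
          linarith
        refine ((h₁ S Υ).2 hd0 hd).trans ?_
        set x := p.lam * |S + Υ - p.T / 2|
        have : (x⁻¹) ^ 3 ≤ 2 * (1 + x ^ 2)⁻¹ := by
          rw [← div_eq_mul_inv, le_div_iff₀ (by positivity), inv_pow, inv_mul_le_iff₀ (by positivity)]
          nlinarith [mul_pos (zero_lt_one.trans hx) (zero_lt_one.trans hx)]
        calc K₁ * x⁻¹ ^ 3 ≤ K₁ * (2 * (1 + x ^ 2)⁻¹) := by gcongr
          _ = _ := by ring
    · have : 0 ≤ p.lam⁻¹ := by positivity
      have h3 : 2 * K₁ * π * 6 ≤ 520 * K₁ * π * 6 + K₂ := by nlinarith [mul_nonneg hK₁ pi_pos.le]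
      calc 2 * K₁ * (p.lam⁻¹ * π) * 6 = 2 * K₁ * π * 6 * p.lam⁻¹ := by ring
        _ ≤ _ := by gcongr
  · rw [min_eq_right (Real.rpow_le_one_of_one_le_of_nonpos hT1.le (by norm_num))]
    set m := (p.lam * |p.T|) ^ (-(1 / 2) : ℝ) with hm
    set θ : ℝ × ℝ × ℝ → ℝ := fun v => foldBump ((v.1 + v.2.1) / p.T) with hθ
    have hθc : Continuous θ := continuous_foldBump.comp (by fun_prop)
    have hc1 : Continuous fun v => tangOsc p v * (χ v : ℂ) * (1 - (θ v : ℂ)) := by fun_prop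
    have hc2 : Continuous fun v => tangOsc p v * (χ v : ℂ) * (θ v : ℂ) := by fun_prop
    have hs1 : tsupport (fun v => tangOsc p v * (χ v : ℂ) * (1 - (θ v : ℂ))) ⊆ tangCore :=
      (tsupport_mul_subset_left (f := fun v => tangOsc p v * (χ v : ℂ))).trans hsupp
    have hs2 : tsupport (fun v => tangOsc p v * (χ v : ℂ) * (θ v : ℂ)) ⊆ tangCore :=
      (tsupport_mul_subset_left (f := fun v => tangOsc p v * (χ v : ℂ))).trans hsupp
    have k1 := isCompact_tangCore.of_isClosed_subset (isClosed_tsupport _) hs1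
    have k2 := isCompact_tangCore.of_isClosed_subset (isClosed_tsupport _) hs2
    have hsplit : ∫ v, tangOsc p v * χ v = (∫ v, tangOsc p v * (χ v : ℂ) * (1 - (θ v : ℂ))) +
        ∫ v, tangOsc p v * (χ v : ℂ) * (θ v : ℂ) := by
      rw [← integral_add (hc1.integrable_of_hasCompactSupport k1)
        (hc2.integrable_of_hasCompactSupport k2)]
      congr 1 with v
      ring
    have b1 : ‖∫ v, tangOsc p v * (χ v : ℂ) * (1 - (θ v : ℂ))‖ ≤
        520 * K₁ * (p.lam * |p.T|)⁻¹ * (p.lam⁻¹ * π) * 6 := by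
      refine norm_integral_le_of_slice_le hc1 hs1 hl (c := p.T / 2) fun S Υ => ?_
      have e : ∀ A, tangOsc p (S, Υ, A) * (χ (S, Υ, A) : ℂ) * (1 - (θ (S, Υ, A) : ℂ)) =
          tangOsc p (S, Υ, A) * (χ (S, Υ, A) : ℂ) * (1 - (foldBump ((S + Υ) / p.T) : ℝ)) :=
        fun A => rfl
      simp only [e]
      rw [integral_mul_const, norm_mul]
      have hθ1 : ‖1 - ((foldBump ((S + Υ) / p.T) : ℝ) : ℂ)‖ ≤ 1 := by
        rw [← Complex.ofReal_one, ← Complex.ofReal_sub, Complex.norm_real, Real.norm_eq_abs]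
        exact abs_le.2 ⟨by linarith [foldBump.le_one (x := (S + Υ) / p.T)],
          by linarith [foldBump.nonneg (x := (S + Υ) / p.T)]⟩
      by_cases hd : |p.T| ≤ 8 * |S + Υ - p.T / 2|
      · exact (mul_le_of_le_one_right (norm_nonneg _) hθ1).trans (hfar S Υ hd hT1.le)
      · have : foldBump ((S + Υ) / p.T) = 1 := by
          refine foldBump.one_of_mem_closedBall ?_
          rw [Metric.mem_closedBall, Real.dist_eq]
          have e2 : (S + Υ) / p.T - 1 / 2 = (S + Υ - p.T / 2) / p.T := by field_simp
          rw [e2, abs_div, div_le_iff₀ hT0]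
          change _ ≤ 1 / 8 * |p.T|
          linarith
        rw [this]
        simp only [Complex.ofReal_one, sub_self, norm_zero, mul_zero]
        positivity
    have b2 : ‖∫ v, tangOsc p v * (χ v : ℂ) * (θ v : ℂ)‖ ≤ K₂ * p.lam⁻¹ * m := by
      rw [integral_foldMap hc2 k2 hT, norm_mul, Complex.norm_real, Real.norm_eq_abs, abs_abs]
      have e : ∀ w, tangOsc p (foldMap p.T w) * (χ (foldMap p.T w) : ℂ) * (θ (foldMap p.T w) : ℂ) =
          tangOsc p (foldMap p.T w) * ((χ (foldMap p.T w) * foldBump w.1 : ℝ) : ℂ) := by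
        intro w
        have : θ (foldMap p.T w) = foldBump w.1 := by
          simp only [hθ, foldMap_apply, sub_add_cancel]
          rw [mul_div_cancel_left₀ _ hT]
        rw [this, Complex.ofReal_mul, mul_assoc]
      simp only [e]
      refine (mul_le_mul_of_nonneg_left h₂ hT0.le).trans_eq ?_
      rw [abs_mul, abs_of_pos hl, hm, show (-(3 / 2) : ℝ) = -(1 / 2) - 1 by norm_num,
        Real.rpow_sub_one (by positivity)]
      field_simp
    have b3 : (p.lam * |p.T|)⁻¹ ≤ m := by
      rw [hm, ← Real.rpow_neg_one]
      exact Real.rpow_le_rpow_of_exponent_le hT1.le (by norm_num)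
    rw [hsplit]
    refine (norm_add_le _ _).trans ((add_le_add b1 b2).trans ?_)
    calc _ ≤ 520 * K₁ * m * (p.lam⁻¹ * π) * 6 + K₂ * p.lam⁻¹ * m := by gcongr
      _ = _ := by ring

end DirectWave

/-- The bounds for the direct wave and for the reflected waves in a common form, summable in the
number of reflections. -/
theorem exists_bound_wave {R : ℝ → ℝ → ℂ}
    (hR : ∃ Λ₁ : ℝ, 1 ≤ Λ₁ ∧ UnifLineBounded (Set.Ici Λ₁) (fun _ => Set.Ioo (4 / 5 : ℝ) 7)
      (fun _ => (1 : ℝ)) 4 R) (hR1 : ∀ Λ A, ‖R Λ A‖ = 1)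
    {χ : ℝ × ℝ × ℝ → ℝ} (hχ : IsTangCutoff χ) :
    ∃ a₀ Λ K : ℝ, 0 < a₀ ∧ a₀ < 1 ∧ 1 ≤ Λ ∧ 0 ≤ K ∧
      ∀ p ∈ WaveParam.Admissible a₀ Λ, p.T ≠ 0 →
        ‖∫ v, tangOsc p v * R (p.eta * p.lam) v.2.2 ^ p.N * χ v‖ ≤
          K * p.lam⁻¹ * min 1 ((p.lam * |p.T|) ^ (-(1 / 2) : ℝ)) / (1 + (p.N : ℝ) ^ 2) := by
  obtain ⟨a₀, Λ, K₁, ha₀, ha₁, hΛ, hK₁, h₁⟩ := exists_bound_reflected hR hR1 hχ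
  obtain ⟨K₂, hK₂, h₂⟩ := exists_bound_direct hχ
  refine ⟨min a₀ (1 / 20000), Λ, 2 * K₁ + K₂, by positivity,
    (min_le_right _ _).trans_lt (by norm_num), hΛ, by positivity, fun p hp hT => ?_⟩
  have hl1 : 1 ≤ p.lam := hΛ.trans hp.2.1
  have hl : 0 < p.lam := zero_lt_one.trans_le hl1
  have hTpos : 0 < |p.T| := abs_pos.2 hT
  have hm : 0 ≤ min 1 ((p.lam * |p.T|) ^ (-(1 / 2) : ℝ)) := by positivity
  by_cases hN : p.N = 0
  · have h := h₂ p (WaveParam.Admissible.mono (min_le_right _ _) hΛ hp) hN hT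
    simp only [hN, zpow_zero, mul_one, Int.cast_zero, ne_eq, OfNat.ofNat_ne_zero,
      not_false_eq_true, zero_pow, add_zero, div_one]
    refine h.trans ?_
    gcongr
    linarith
  · refine (h₁ p (WaveParam.Admissible.mono (min_le_left _ _) le_rfl hp) hN).trans ?_
    have hpow : p.lam ^ (-(3 / 2) : ℝ) = p.lam⁻¹ * p.lam ^ (-(1 / 2) : ℝ) := by
      rw [← Real.rpow_neg_one, ← Real.rpow_add hl]; norm_num
    have hhalf : p.lam ^ (-(1 / 2) : ℝ) ≤ 2 * min 1 ((p.lam * |p.T|) ^ (-(1 / 2) : ℝ)) := by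
      have hle1 : p.lam ^ (-(1 / 2) : ℝ) ≤ 1 :=
        Real.rpow_le_one_of_one_le_of_nonpos hl1 (by norm_num)
      have h4 : (4 : ℝ) ^ (-(1 / 2) : ℝ) = 1 / 2 := by
        rw [show (4 : ℝ) = 2 ^ (2 : ℝ) by norm_num, ← Real.rpow_mul (by norm_num)]
        norm_num [Real.rpow_neg_one]
      have hmono : (p.lam * 4) ^ (-(1 / 2) : ℝ) ≤ (p.lam * |p.T|) ^ (-(1 / 2) : ℝ) :=
        Real.rpow_le_rpow_of_nonpos (by positivity)
          (by gcongr; linarith [hp.2.2.2.2.1]) (by norm_num)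
      rw [Real.mul_rpow hl.le (by norm_num), h4] at hmono
      rw [mul_min_of_nonneg _ _ (by norm_num : (0 : ℝ) ≤ 2)]
      exact le_min (by linarith) (by linarith)
    rw [hpow]
    refine div_le_div_of_nonneg_right ?_ (by positivity)
    calc K₁ * (p.lam⁻¹ * p.lam ^ (-(1 / 2) : ℝ))
        ≤ K₁ * (p.lam⁻¹ * (2 * min 1 ((p.lam * |p.T|) ^ (-(1 / 2) : ℝ)))) := by gcongr
      _ = 2 * K₁ * p.lam⁻¹ * min 1 ((p.lam * |p.T|) ^ (-(1 / 2) : ℝ)) := by ring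
      _ ≤ _ := by gcongr; linarith

/-- A bound for an integral over `ℝ⁴` from bounds for its slices in the last variable. -/
theorem norm_integral_le_of_norm_slice_le {F : ℝ × ℝ × ℝ × ℝ → ℂ} {M : ℝ} (hM : 0 ≤ M)
    (hle : ∀ η, ‖∫ v : ℝ × ℝ × ℝ, F (v.1, v.2.1, v.2.2, η)‖ ≤ M)
    (hzero : ∀ η ∉ Set.Icc (1 / 2 : ℝ) (3 / 2), ∀ v : ℝ × ℝ × ℝ, F (v.1, v.2.1, v.2.2, η) = 0) :
    ‖∫ v, F v‖ ≤ M := by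
  let e : (ℝ × ℝ × ℝ) × ℝ ≃ᵐ ℝ × ℝ × ℝ × ℝ :=
    MeasurableEquiv.prodAssoc.trans
      (MeasurableEquiv.prodCongr (MeasurableEquiv.refl ℝ) MeasurableEquiv.prodAssoc)
  have he : MeasurePreserving e volume volume :=
    ((MeasurePreserving.id (volume : Measure ℝ)).prod
      (measurePreserving_prodAssoc (volume : Measure ℝ) (volume : Measure ℝ)
        (volume : Measure ℝ))).comp
      (measurePreserving_prodAssoc (volume : Measure ℝ) (volume : Measure (ℝ × ℝ))
        (volume : Measure ℝ))
  by_cases hF : Integrable F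
  · have hFe : Integrable (F ∘ e) := he.integrable_comp_of_integrable hF
    rw [← he.integral_comp']
    change ‖∫ z : (ℝ × ℝ × ℝ) × ℝ, (F ∘ e) z ∂(volume.prod volume)‖ ≤ M
    rw [integral_prod_symm _ hFe]
    refine (norm_integral_le_of_tsupport_subset volume (B := Set.Icc (1 / 2 : ℝ) (3 / 2))
      (by simp) hle fun η hη => ?_).trans ?_
    · exact integral_eq_zero_of_ae (ae_of_all _ (hzero η hη))
    · norm_num [Measure.real]
  · rw [integral_undef hF, norm_zero]; exact hM

/-- The oscillatory factor of `Wtan` in terms of the direct phase and the reflection factor. -/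
theorem cexp_PsiTan_eq (L : ℝ → ℝ) {h a : ℝ} (hl : a ^ ((3 : ℝ) / 2) / h ≠ 0) (N : ℤ)
    (T X Y η : ℝ) (v : ℝ × ℝ × ℝ) :
    cexp (I * ((a ^ ((3 : ℝ) / 2) / h * PsiTan L h a N T X Y v.2.1 v.1 v.2.2 η : ℝ) : ℂ)) =
      tangOsc ⟨η, a ^ ((3 : ℝ) / 2) / h, a, T, X, Y, N⟩ v *
        cexp (I * (Bfun L (η * (a ^ ((3 : ℝ) / 2) / h) * v.2.2 ^ ((3 : ℝ) / 2)) : ℝ)) ^ N := by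
  rw [tangOsc, ← Complex.exp_int_mul, ← Complex.exp_add]
  congr 1
  simp only [PsiTan, tangPhase, slow]
  generalize a ^ ((3 : ℝ) / 2) / h = l at *
  generalize Bfun L _ = b
  have hr : l * (N / l * b) = N * b := by field_simp
  rw [mul_add, hr]
  push_cast
  ring

/-- Integrating the slice bounds in `η`. -/
theorem norm_Wtan_le {L ψ : ℝ → ℝ} {χ₂ : ℝ × ℝ → ℝ} {ψ₃ : ℝ → ℝ} {h a T X Y M P : ℝ} {N : ℤ}
    (hl : a ^ ((3 : ℝ) / 2) / h ≠ 0) (hh : 0 < h) (hψs : tsupport ψ ⊆ Set.Icc (1 / 2 : ℝ) (3 / 2))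
    (hP : ∀ η, |ψ η| ≤ P) (hM0 : 0 ≤ M)
    (hM : ∀ η ∈ Set.Icc (1 / 2 : ℝ) (3 / 2),
      ‖∫ v : ℝ × ℝ × ℝ, tangOsc ⟨η, a ^ ((3 : ℝ) / 2) / h, a, T, X, Y, N⟩ v *
        cexp (I * (Bfun L (η * (a ^ ((3 : ℝ) / 2) / h) * v.2.2 ^ ((3 : ℝ) / 2)) : ℝ)) ^ N *
        ((χ₂ (v.1, v.2.1) * ψ₃ v.2.2 : ℝ) : ℂ)‖ ≤ M) :
    ‖Wtan L ψ χ₂ ψ₃ h a N T X Y‖ ≤ a ^ 2 / h ^ 3 * (9 / 4 * P * M) := by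
  have hP0 : 0 ≤ P := (abs_nonneg _).trans (hP 0)
  have hψ0 : ∀ η ∉ Set.Icc (1 / 2 : ℝ) (3 / 2), ψ η = 0 := fun η hη =>
    image_eq_zero_of_notMem_tsupport fun h => hη (hψs h)
  rw [Wtan, norm_mul, Complex.norm_real, Real.norm_of_nonneg (by positivity)]
  gcongr
  · nlinarith [Real.pi_gt_three]
  refine norm_integral_le_of_norm_slice_le (by positivity) (fun η => ?_) fun η hη v => ?_
  · by_cases hη : η ∈ Set.Icc (1 / 2 : ℝ) (3 / 2)
    · have : ∀ v : ℝ × ℝ × ℝ,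
          cexp (I * ((a ^ ((3 : ℝ) / 2) / h * PsiTan L h a N T X Y v.2.1 v.1 v.2.2 η : ℝ) : ℂ)) *
            ((η ^ 2 * ψ η * χ₂ (v.1, v.2.1) * ψ₃ v.2.2 : ℝ) : ℂ) =
          ((η ^ 2 * ψ η : ℝ) : ℂ) * (tangOsc ⟨η, a ^ ((3 : ℝ) / 2) / h, a, T, X, Y, N⟩ v *
            cexp (I * (Bfun L (η * (a ^ ((3 : ℝ) / 2) / h) * v.2.2 ^ ((3 : ℝ) / 2)) : ℝ)) ^ N *
            ((χ₂ (v.1, v.2.1) * ψ₃ v.2.2 : ℝ) : ℂ)) := fun v => by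
        rw [cexp_PsiTan_eq L hl]; push_cast; ring
      simp only [this]
      rw [integral_const_mul, norm_mul, Complex.norm_real, Real.norm_eq_abs, abs_mul,
        abs_of_nonneg (sq_nonneg η)]
      gcongr
      · nlinarith [hη.1, hη.2]
      · exact hP η
      · exact hM η hη
    · simp only [hψ0 η hη, mul_zero, zero_mul, Complex.ofReal_zero, integral_zero, norm_zero]
      positivity
  · simp only [hψ0 η hη, mul_zero, zero_mul, Complex.ofReal_zero]

theorem summable_one_div_one_add_int_sq : Summable fun N : ℤ => 1 / (1 + (N : ℝ) ^ 2) := by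
  refine Summable.of_norm_bounded_eventually
    (Real.summable_one_div_int_pow.2 (by norm_num : 1 < 2)) ?_
  filter_upwards [(Set.finite_singleton (0 : ℤ)).compl_mem_cofinite] with N hN
  have hN : (N : ℝ) ≠ 0 := by exact_mod_cast hN
  rw [Real.norm_of_nonneg (by positivity)]
  gcongr
  linarith

/-- The semiclassical parameter `λ = a^{3/2} / h` is large in the range of the parameters. -/
theorem le_rpow_div_of_rpow_le {ε Λ h a : ℝ} (hε : ε ∈ Set.Ioo (0 : ℝ) (1 / 10)) (hΛ : 1 ≤ Λ)
    (hh : 0 < h) (hle : h ≤ Λ ^ (-(2 / (3 * ε)))) (ha : h ^ ((2 : ℝ) / 3 - ε) ≤ a) :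
    Λ ≤ a ^ ((3 : ℝ) / 2) / h := by
  have hε0 : 0 < ε := hε.1
  have hΛ0 : 0 < Λ := by linarith
  have h1 : h ^ (1 - 3 / 2 * ε) ≤ a ^ ((3 : ℝ) / 2) := by
    refine le_trans (le_of_eq ?_) (Real.rpow_le_rpow (by positivity) ha (by norm_num))
    rw [← Real.rpow_mul hh.le]; congr 1; ring
  have h2 : Λ ≤ h ^ (-(3 / 2 * ε)) := by
    refine le_trans (le_of_eq ?_) (Real.rpow_le_rpow_of_nonpos hh hle (by linarith))
    rw [← Real.rpow_mul hΛ0.le]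
    have : -(2 / (3 * ε)) * -(3 / 2 * ε) = 1 := by field_simp
    rw [this, Real.rpow_one]
  rw [le_div_iff₀ hh]
  calc Λ * h ≤ h ^ (-(3 / 2 * ε)) * h := by gcongr
    _ = h ^ (1 - 3 / 2 * ε) := by
      nth_rewrite 2 [← Real.rpow_one h]
      rw [← Real.rpow_add hh]; congr 1; ring
    _ ≤ _ := h1

/-- The decay factors in the rescaled time `T` and in the time `t = √(a (1 + a)) T`. -/
theorem min_rpow_le_two_mul_min {h a T : ℝ} (hh : 0 < h) (ha : 0 < a) (ha1 : a ≤ 1)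
    (hT : 0 < |T|) :
    min 1 ((a ^ ((3 : ℝ) / 2) / h * |T|) ^ (-(1 / 2) : ℝ)) ≤
      2 * min 1 ((h / (a * (√(a * (1 + a)) * |T|))) ^ ((1 : ℝ) / 2)) := by
  have hsq : a ^ ((3 : ℝ) / 2) = a * √a := by
    rw [Real.sqrt_eq_rpow]; nth_rewrite 2 [← Real.rpow_one a]
    rw [← Real.rpow_add ha]; norm_num
  have h1a : √(1 + a) ≤ 4 := by
    rw [Real.sqrt_le_left (by norm_num)]; linarith
  have ha' : 0 < √a := Real.sqrt_pos.2 ha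
  have h1a' : 0 < √(1 + a) := Real.sqrt_pos.2 (by linarith)
  have h4 : (4 : ℝ) ^ ((1 : ℝ) / 2) = 2 := by
    rw [show (4 : ℝ) = 2 ^ (2 : ℝ) by norm_num, ← Real.rpow_mul (by norm_num)]
    norm_num
  have key : (a ^ ((3 : ℝ) / 2) / h * |T|) ^ (-(1 / 2) : ℝ) ≤
      2 * (h / (a * (√(a * (1 + a)) * |T|))) ^ ((1 : ℝ) / 2) := by
    nth_rewrite 3 [← h4]
    rw [← Real.mul_rpow (by norm_num) (by positivity), Real.rpow_neg (by positivity),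
      ← Real.inv_rpow (by positivity)]
    refine Real.rpow_le_rpow (by positivity) ?_ (by norm_num)
    rw [hsq, Real.sqrt_mul ha.le]
    rw [show (a * √a / h * |T|)⁻¹ = h / (a * √a * |T|) by field_simp,
      show 4 * (h / (a * (√a * √(1 + a) * |T|))) = h / (a * √a * |T|) * (4 / √(1 + a)) by
        field_simp]
    refine le_mul_of_one_le_right (by positivity) ?_
    rwa [one_le_div h1a']
  rw [mul_min_of_nonneg _ _ (by norm_num : (0 : ℝ) ≤ 2)]
  exact min_le_min (by norm_num) key

theorem sq_div_mul_inv_rpow {h a : ℝ} (hh : 0 < h) (ha : 0 < a) :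
    a ^ 2 / h ^ 3 * (a ^ ((3 : ℝ) / 2) / h)⁻¹ = √a / h ^ 2 := by
  have h2 : a ^ 2 = a ^ ((3 : ℝ) / 2) * √a := by
    rw [Real.sqrt_eq_rpow, ← Real.rpow_add ha]; norm_num
  have : a ^ ((3 : ℝ) / 2) ≠ 0 := by positivity
  rw [h2]
  field_simp

/-- dispersive bound for the tangential wave `W_{0,a}` and for `G^♯`
for `|T| ≤ 5/2` (i.e. up to the first reflection), with `t = √(a(1+a)) T`. -/
theorem dispersion_tangential_smallT
    (Ai : ℂ → ℂ)
    (hAi_diff : Differentiable ℂ Ai)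
    (hAi_diff' : Differentiable ℂ (deriv Ai))
    (hAi_ode : ∀ z : ℂ, deriv (deriv Ai) z = z * Ai z)
    (hAi_zero : Ai 0 = (3 : ℂ) ^ (-(2 : ℂ)/3) / Complex.Gamma (2/3))
    (hAi_zero' : deriv Ai 0 = -((3 : ℂ) ^ (-(1 : ℂ)/3)) / Complex.Gamma (1/3))
    (hAi_real : ∀ x : ℝ, (Ai x).im = 0)
    (L : ℝ → ℝ)
    (hL_cont : Continuous L)
    (hL_zero : L 0 = Real.pi / 3)
    (hAp_ne : ∀ w : ℝ, Aplus Ai w ≠ 0)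
    (hL_char : ∀ w : ℝ, Complex.exp (-(L w : ℂ) * Complex.I) = -(Aminus Ai w) / (Aplus Ai w))
    (ψ : ℝ → ℝ) (hψ : ContDiff ℝ (⊤ : ℕ∞) ψ) (hψs : tsupport ψ ⊆ Set.Icc (1/2 : ℝ) (3/2))
    (χ₂ : ℝ × ℝ → ℝ) (hχ₂ : ContDiff ℝ (⊤ : ℕ∞) χ₂) (hχ₂c : HasCompactSupport χ₂)
    (hχ₂s : tsupport χ₂ ⊆ {p : ℝ × ℝ | |p.1| < 3 ∧ |p.2| < 3})
    (ψ₃ : ℝ → ℝ) (hψ₃ : ContDiff ℝ (⊤ : ℕ∞) ψ₃) (hψ₃s : tsupport ψ₃ ⊆ Set.Icc (9/10 : ℝ) 6)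
    (ε : ℝ) (hε : ε ∈ Set.Ioo (0:ℝ) (1/10)) :
    ∃ a₀ ∈ Set.Ioo (0:ℝ) 1, ∃ h₀ ∈ Set.Ioo (0:ℝ) 1, ∃ C : ℝ,
      ∀ h a : ℝ, 0 < h → h ≤ h₀ → h ^ ((2:ℝ)/3 - ε) ≤ a → a ≤ a₀ →
      ∀ X : ℝ, 0 ≤ X → ∀ Y T : ℝ, 0 < |T| → |T| ≤ 5/2 →
        ‖Wtan L ψ χ₂ ψ₃ h a 0 T X Y‖ + ‖Gsharp L ψ χ₂ ψ₃ h a T X Y‖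
          ≤ C * (Real.sqrt a / h ^ 2) *
            min 1 ((h / (a * (Real.sqrt (a * (1 + a)) * |T|))) ^ ((1:ℝ)/2)) := by
  have hψc : HasCompactSupport ψ := isCompact_Icc.of_isClosed_subset (isClosed_tsupport ψ) hψs
  obtain ⟨P, hP⟩ := hψ.continuous.bounded_above_of_compact_support hψc
  have hP0 : 0 ≤ P := (norm_nonneg _).trans (hP 0)
  obtain ⟨a₀, Λ, K, ha₀, ha₁, hΛ, hK, hwave⟩ := exists_bound_wave
    (exists_unifLineBounded_reflection hAi_diff hAi_diff' hAi_ode hAi_zero hAi_zero' hL_char 4)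
    (fun _ _ => norm_cexp_I_mul _) (IsTangCutoff.of_prod hχ₂ hχ₂s hψ₃ hψ₃s)
  set s := ∑' N : ℤ, 1 / (1 + (N : ℝ) ^ 2)
  have hΛ0 : 0 < Λ := zero_lt_one.trans_le hΛ
  refine ⟨a₀, ⟨ha₀, ha₁⟩, min (1 / 2) (Λ ^ (-(2 / (3 * ε)))),
    ⟨by positivity, (min_le_left _ _).trans_lt (by norm_num)⟩,
    9 / 4 * P * K * 2 * (1 + s), fun h a hh hh₀ hha haa₀ X hX Y T hT hT5 => ?_⟩
  have ha : 0 < a := (Real.rpow_pos_of_pos hh _).trans_le hha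
  have hΛl : Λ ≤ a ^ ((3 : ℝ) / 2) / h :=
    le_rpow_div_of_rpow_le hε hΛ hh (hh₀.trans (min_le_right _ _)) hha
  have hl : 0 < a ^ ((3 : ℝ) / 2) / h := hΛ0.trans_le hΛl
  have hm := min_rpow_le_two_mul_min hh ha (haa₀.trans ha₁.le) hT
  set m := min 1 ((h / (a * (√(a * (1 + a)) * |T|))) ^ ((1 : ℝ) / 2))
  have hm0 : 0 ≤ m := by positivity
  have hW : ∀ N : ℤ, ‖Wtan L ψ χ₂ ψ₃ h a N T X Y‖ ≤
      9 / 4 * P * K * 2 * (√a / h ^ 2) * m * (1 / (1 + (N : ℝ) ^ 2)) := fun N => by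
    refine (norm_Wtan_le (M := K * (a ^ ((3 : ℝ) / 2) / h)⁻¹ *
      min 1 ((a ^ ((3 : ℝ) / 2) / h * |T|) ^ (-(1 / 2) : ℝ)) / (1 + (N : ℝ) ^ 2))
      hl.ne' hh hψs hP (by positivity) fun η hη =>
      hwave ⟨η, a ^ ((3 : ℝ) / 2) / h, a, T, X, Y, N⟩ ⟨hη, hΛl, ha, haa₀, hT5, hX⟩
        (abs_pos.1 hT)).trans ?_
    rw [← sq_div_mul_inv_rpow hh ha]
    calc _ ≤ a ^ 2 / h ^ 3 * (9 / 4 * P *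
          (K * (a ^ ((3 : ℝ) / 2) / h)⁻¹ * (2 * m) / (1 + (N : ℝ) ^ 2))) := by gcongr
      _ = _ := by ring
  have hG : ‖Gsharp L ψ χ₂ ψ₃ h a T X Y‖ ≤ 9 / 4 * P * K * 2 * (√a / h ^ 2) * m * s :=
    tsum_of_norm_bounded (summable_one_div_one_add_int_sq.hasSum.mul_left _) fun N =>
      (norm_indicator_le_norm_self _ _).trans (hW N)
  have hW0 := hW 0
  simp only [Int.cast_zero, ne_eq, OfNat.ofNat_ne_zero, not_false_eq_true, zero_pow, add_zero,
    div_one, mul_one] at hW0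
  calc _ ≤ _ := add_le_add hW0 hG
    _ = _ := by ring
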